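/- arXiv:1607.07827 — 2 statements merged into one kernel-verified Lean document; each statement's English description precedes it below -/
import Mathlib

section
/- Let Ψ_q : V(F_q) → {0,1} be the characteristic function of the set of singular x (those with Disc(x) = 0). Fix a non-square l ∈ F_q^×. Then for every y ∈ V(F_q): \hatΨ_q(y) = q^{-1} + 2q^{-2} − q^{-3} − 2q^{-4} − q^{-5} + 2q^{-6} + q^{-7} − q^{-8} if y = (0,0); \hatΨ_q(y) = q^{-3} − q^{-4} − 2q^{-5} + 2q^{-6} + q^{-7} − q^{-8} if y is in the G-orbit of (0, w^2); \hatΨ_q(y) = 2q^{-4} − 5q^{-5} + 3q^{-6} + q^{-7} − q^{-8} if y is in the G-orbit of (0, vw); \hatΨ_q(y) = q^{-4} − 3q^{-5} + 2q^{-6} + q^{-7} − q^{-8} if y is in the G-orbit of (w^2, vw); \hatΨ_q(y) = −q^{-5} + q^{-6} + q^{-7} − q^{-8} if y is in the G-orbit of one of (0, v^2 − l w^2), (0, u^2 − vw), (vw, uw), (w^2, v^2), (vw, v^2 + l w^2); \hatΨ_q(y) = −q^{-6} + 2q^{-7} − q^{-8} if y is in the G-orbit of (w^2, u^2 − v^2);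 \hatΨ_q(y) = q^{-6} − q^{-8} if y is in the G-orbit of (w^2, u^2 − l v^2); \hatΨ_q(y) = q^{-7} − q^{-8} if y is in the G-orbit of one of (w^2, uw + v^2), (vw, uw + v^2), (v^2 − w^2, uw), (v^2 − l w^2, uw); and \hatΨ_q(y) = −q^{-8} if Disc(y) ≠ 0. -/
open scoped Classical
open MvPolynomial Matrix

noncomputable section

/-- The standard additive character `t ↦ exp(2πi·Tr_{F/F_p}(t)/p)` of a finite field `F`
of characteristic `p`. -/
def psiF (p : ℕ) [Fact p.Prime] (F : Type*) [Field F] [Fintype F] [CharP F p] (t : F) : ℂ :=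
  letI : Algebra (ZMod p) F := ZMod.algebra F p
  Complex.exp (2 * Real.pi * Complex.I * ((Algebra.trace (ZMod p) F t).val : ℂ) / (p : ℂ))

variable {F : Type*} [Field F] [Fintype F]

/-- The ternary quadratic form `a u² + b uv + c uw + d v² + e vw + f w²`
attached to `(a,b,c,d,e,f)`. -/
def TQ (c : Fin 6 → F) : MvPolynomial (Fin 3) F :=
  C (c 0) * X 0 ^ 2 + C (c 1) * X 0 * X 1 + C (c 2) * X 0 * X 2 +
    C (c 3) * X 1 ^ 2 + C (c 4) * X 1 * X 2 + C (c 5) * X 2 ^ 2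

/-- Substitution corresponding to the linear change of variables `(u,v,w) ↦ (u,v,w)·g`. -/
def subst3 (g : Matrix (Fin 3) (Fin 3) F) (P : MvPolynomial (Fin 3) F) : MvPolynomial (Fin 3) F :=
  aeval (fun j => ∑ i : Fin 3, C (g i j) * X i) P

/-- The action of `GL₂(F) × GL₃(F)` on pairs of ternary quadratic forms:
`(g₁,g₂)∘(A,B) = (α g₂Ag₂ᵀ + β g₂Bg₂ᵀ, γ g₂Ag₂ᵀ + δ g₂Bg₂ᵀ)` for `g₁ = [[α,β],[γ,δ]]`,
written at the level of the associated quadratic forms. -/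
def pairActT (g₁ : Matrix.GeneralLinearGroup (Fin 2) F)
    (g₂ : Matrix.GeneralLinearGroup (Fin 3) F)
    (PQ : MvPolynomial (Fin 3) F × MvPolynomial (Fin 3) F) :
    MvPolynomial (Fin 3) F × MvPolynomial (Fin 3) F :=
  (C ((g₁ : Matrix (Fin 2) (Fin 2) F) 0 0) * subst3 (g₂ : Matrix (Fin 3) (Fin 3) F) PQ.1 +
     C ((g₁ : Matrix (Fin 2) (Fin 2) F) 0 1) * subst3 (g₂ : Matrix (Fin 3) (Fin 3) F) PQ.2,
   C ((g₁ : Matrix (Fin 2) (Fin 2) F) 1 0) * subst3 (g₂ : Matrix (Fin 3) (Fin 3) F) PQ.1 +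
     C ((g₁ : Matrix (Fin 2) (Fin 2) F) 1 1) * subst3 (g₂ : Matrix (Fin 3) (Fin 3) F) PQ.2)

/-- `x` lies in the `GL₂(F) × GL₃(F)`-orbit of `r` (pairs of ternary quadratic forms). -/
def InOrbitPT (r x : (Fin 6 → F) × (Fin 6 → F)) : Prop :=
  ∃ (g₁ : Matrix.GeneralLinearGroup (Fin 2) F) (g₂ : Matrix.GeneralLinearGroup (Fin 3) F),
    pairActT g₁ g₂ (TQ r.1, TQ r.2) = (TQ x.1, TQ x.2)

/-- The symmetric 3×3 matrix attached to the ternary quadratic form `(a,b,c,d,e,f)`. -/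
def gram3 (x : Fin 6 → F) : Matrix (Fin 3) (Fin 3) F :=
  !![x 0, x 1 / 2, x 2 / 2; x 1 / 2, x 3, x 4 / 2; x 2 / 2, x 4 / 2, x 5]

/-- The cubic resolvent `r_x(u,v) = -4 det(Au + Bv)` of a pair `x = (A,B)` of ternary
quadratic forms, a binary cubic form in the variables `u = X 0`, `v = X 1`. -/
def resolventPT (x : (Fin 6 → F) × (Fin 6 → F)) : MvPolynomial (Fin 2) F :=
  (-4 : MvPolynomial (Fin 2) F) *
    (Matrix.of fun i j => C (gram3 x.1 i j) * X 0 + C (gram3 x.2 i j) * X 1).det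

/-- Discriminant of the binary cubic form `a u³ + b u²v + c uv² + d v³`. -/
def discCubic (a b c d : F) : F :=
  b^2*c^2 + 18*a*b*c*d - 4*a*c^3 - 4*b^3*d - 27*a^2*d^2

/-- `Disc(x) = disc(r_x)` for a pair of ternary quadratic forms. -/
def DiscPT (x : (Fin 6 → F) × (Fin 6 → F)) : F :=
  discCubic
    (coeff (Finsupp.single 0 3) (resolventPT x))
    (coeff (Finsupp.single 0 2 + Finsupp.single 1 1) (resolventPT x))
    (coeff (Finsupp.single 0 1 + Finsupp.single 1 2) (resolventPT x))
    (coeff (Finsupp.single 1 3) (resolventPT x))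

/-- The bilinear form on pairs of ternary quadratic forms: the sum over both components
of the weighted coefficient pairing `aa' + bb'/2 + cc'/2 + dd' + ee'/2 + ff'`. -/
def bformPT (x y : (Fin 6 → F) × (Fin 6 → F)) : F :=
  (x.1 0 * y.1 0 + x.1 1 * y.1 1 / 2 + x.1 2 * y.1 2 / 2 + x.1 3 * y.1 3 +
      x.1 4 * y.1 4 / 2 + x.1 5 * y.1 5) +
    (x.2 0 * y.2 0 + x.2 1 * y.2 1 / 2 + x.2 2 * y.2 2 / 2 + x.2 3 * y.2 3 +
      x.2 4 * y.2 4 / 2 + x.2 5 * y.2 5)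

/-- The Fourier transform on the space of pairs of ternary quadratic forms over `F`. -/
def FTPT (p : ℕ) [Fact p.Prime] [CharP F p] (Φ : (Fin 6 → F) × (Fin 6 → F) → ℂ)
    (y : (Fin 6 → F) × (Fin 6 → F)) : ℂ :=
  ((Fintype.card F : ℂ) ^ 12)⁻¹ *
    ∑ x : (Fin 6 → F) × (Fin 6 → F), Φ x * psiF p F (bformPT x y)

namespace TernaryPencil

section Algebra

variable {K : Type*} [Field K]

/-! ### Symmetric matrices in coordinates

A symmetric `3 × 3` matrix is stored as `(s₀₀, s₀₁, s₀₂, s₁₁, s₁₂, s₂₂)`. -/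

/-- The symmetric bilinear form `vᵀ A w`. -/
def bil (A : Fin 6 → K) (v w : Fin 3 → K) : K :=
  A 0 * v 0 * w 0 + A 1 * (v 0 * w 1 + v 1 * w 0) + A 2 * (v 0 * w 2 + v 2 * w 0) +
    A 3 * v 1 * w 1 + A 4 * (v 1 * w 2 + v 2 * w 1) + A 5 * v 2 * w 2

/-- The product `A v`. -/
def app (A : Fin 6 → K) (v : Fin 3 → K) : Fin 3 → K :=
  ![A 0 * v 0 + A 1 * v 1 + A 2 * v 2, A 1 * v 0 + A 3 * v 1 + A 4 * v 2,
    A 2 * v 0 + A 4 * v 1 + A 5 * v 2]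

/-- The symmetric matrix `l mᵀ + m lᵀ`. -/
def prodForm (l m : Fin 3 → K) : Fin 6 → K :=
  ![2 * (l 0 * m 0), l 0 * m 1 + l 1 * m 0, l 0 * m 2 + l 2 * m 0, 2 * (l 1 * m 1),
    l 1 * m 2 + l 2 * m 1, 2 * (l 2 * m 2)]

/-- The symmetric matrix `m mᵀ`. -/
def sqForm (m : Fin 3 → K) : Fin 6 → K :=
  ![m 0 * m 0, m 0 * m 1, m 0 * m 2, m 1 * m 1, m 1 * m 2, m 2 * m 2]

/-- The trace pairing `tr (A B)`. -/
def pairing (A B : Fin 6 → K) : K :=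
  A 0 * B 0 + 2 * (A 1 * B 1) + 2 * (A 2 * B 2) + A 3 * B 3 + 2 * (A 4 * B 4) + A 5 * B 5

/-- The determinant. -/
def det3 (A : Fin 6 → K) : K :=
  A 0 * A 3 * A 5 + 2 * (A 4 * A 2 * A 1) - A 0 * A 4 ^ 2 - A 3 * A 2 ^ 2 - A 5 * A 1 ^ 2

/-- The adjugate. -/
def adj3 (A : Fin 6 → K) : Fin 6 → K :=
  ![A 3 * A 5 - A 4 ^ 2, A 2 * A 4 - A 1 * A 5, A 1 * A 4 - A 2 * A 3,
    A 0 * A 5 - A 2 ^ 2, A 1 * A 2 - A 0 * A 4, A 0 * A 3 - A 1 ^ 2]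

/-- The cross product of two vectors. -/
def cross (v w : Fin 3 → K) : Fin 3 → K :=
  ![v 1 * w 2 - v 2 * w 1, v 2 * w 0 - v 0 * w 2, v 0 * w 1 - v 1 * w 0]

theorem det3_add_smul (A B : Fin 6 → K) (t : K) :
    det3 (A + t • B) =
      det3 A + pairing (adj3 A) B * t + pairing (adj3 B) A * t ^ 2 + det3 B * t ^ 3 := by
  simp [det3, adj3, pairing]; ring

theorem pairing_adj3_add_smul (A B : Fin 6 → K) (t : K) :
    pairing (adj3 (A + t • B)) B =
      pairing (adj3 A) B + 2 * pairing (adj3 B) A * t + 3 * det3 B * t ^ 2 := by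
  simp [det3, adj3, pairing]; ring

omit [Field K] in
theorem ext6 {A B : Fin 6 → K} (h0 : A 0 = B 0) (h1 : A 1 = B 1) (h2 : A 2 = B 2)
    (h3 : A 3 = B 3) (h4 : A 4 = B 4) (h5 : A 5 = B 5) : A = B := by
  funext i; fin_cases i <;> assumption

omit [Field K] in
theorem ext3 {v w : Fin 3 → K} (h0 : v 0 = w 0) (h1 : v 1 = w 1) (h2 : v 2 = w 2) : v = w := by
  funext i; fin_cases i <;> assumption

theorem vec_ne_zero {v : Fin 3 → K} (hv : v ≠ 0) : v 0 ≠ 0 ∨ v 1 ≠ 0 ∨ v 2 ≠ 0 := by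
  by_contra! h
  exact hv (ext3 h.1 h.2.1 h.2.2)

theorem app_eq_zero_iff {A : Fin 6 → K} {v : Fin 3 → K} :
    app A v = 0 ↔ A 0 * v 0 + A 1 * v 1 + A 2 * v 2 = 0 ∧ A 1 * v 0 + A 3 * v 1 + A 4 * v 2 = 0 ∧
      A 2 * v 0 + A 4 * v 1 + A 5 * v 2 = 0 := by
  constructor
  · intro h
    exact ⟨congrFun h 0, congrFun h 1, congrFun h 2⟩
  · rintro ⟨h0, h1, h2⟩
    exact ext3 h0 h1 h2

omit [Field K] in
theorem eq_iff6 {A B : Fin 6 → K} :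
    A = B ↔ A 0 = B 0 ∧ A 1 = B 1 ∧ A 2 = B 2 ∧ A 3 = B 3 ∧ A 4 = B 4 ∧ A 5 = B 5 := by
  constructor
  · rintro rfl; simp
  · rintro ⟨h0, h1, h2, h3, h4, h5⟩; exact ext6 h0 h1 h2 h3 h4 h5

theorem bil_eq_dotProduct (A : Fin 6 → K) (v w : Fin 3 → K) : bil A v w = w ⬝ᵥ app A v := by
  simp [bil, app, dotProduct, Fin.sum_univ_three]; ring

theorem pairing_prodForm (A : Fin 6 → K) (l m : Fin 3 → K) :
    pairing A (prodForm l m) = 2 * bil A l m := by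
  simp [bil, prodForm, pairing]; ring

theorem pairing_sqForm (A : Fin 6 → K) (m : Fin 3 → K) :
    pairing A (sqForm m) = bil A m m := by
  simp [bil, sqForm, pairing]; ring

/-- A functional killing the orthogonal complement of `P` is a multiple of `P`. -/
theorem exists_smul_of_forall_dotProduct {P a : Fin 3 → K} (hP : P ≠ 0)
    (h : ∀ m : Fin 3 → K, m ⬝ᵥ P = 0 → m ⬝ᵥ a = 0) : ∃ c : K, a = c • P := by
  have e0 := h ![0, P 2, -P 1] (by simp [dotProduct, Fin.sum_univ_three]; ring)
  have e1 := h ![-P 2, 0, P 0] (by simp [dotProduct, Fin.sum_univ_three]; ring)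
  have e2 := h ![P 1, -P 0, 0] (by simp [dotProduct, Fin.sum_univ_three]; ring)
  simp [dotProduct, Fin.sum_univ_three] at e0 e1 e2
  rcases vec_ne_zero hP with h0 | h0 | h0
  · refine ⟨a 0 / P 0, ext3 ?_ ?_ ?_⟩ <;> simp <;> field_simp <;> grind
  · refine ⟨a 1 / P 1, ext3 ?_ ?_ ?_⟩ <;> simp <;> field_simp <;> grind
  · refine ⟨a 2 / P 2, ext3 ?_ ?_ ?_⟩ <;> simp <;> field_simp <;> grind

theorem cross_eq_zero {P Q : Fin 3 → K} (hP : P ≠ 0) (h : cross P Q = 0) : ∃ c : K, Q = c • P := by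
  have e0 := congrFun h 0
  have e1 := congrFun h 1
  have e2 := congrFun h 2
  simp [cross] at e0 e1 e2
  rcases vec_ne_zero hP with h0 | h0 | h0
  · refine ⟨Q 0 / P 0, ext3 ?_ ?_ ?_⟩ <;> simp <;> field_simp <;> grind
  · refine ⟨Q 1 / P 1, ext3 ?_ ?_ ?_⟩ <;> simp <;> field_simp <;> grind
  · refine ⟨Q 2 / P 2, ext3 ?_ ?_ ?_⟩ <;> simp <;> field_simp <;> grind

theorem bil_smul_sqForm (c : K) (m v w : Fin 3 → K) :
    bil (c • sqForm m) v w = c * (v ⬝ᵥ m) * (w ⬝ᵥ m) := by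
  simp [bil, sqForm, dotProduct, Fin.sum_univ_three]; ring

theorem bil_prodForm (l m v w : Fin 3 → K) :
    bil (prodForm l m) v w = (v ⬝ᵥ l) * (w ⬝ᵥ m) + (v ⬝ᵥ m) * (w ⬝ᵥ l) := by
  simp [bil, prodForm, dotProduct, Fin.sum_univ_three]; ring

theorem app_prodForm (l m v : Fin 3 → K) :
    app (prodForm l m) v = (m ⬝ᵥ v) • l + (l ⬝ᵥ v) • m := by
  apply ext3 <;> simp [app, prodForm, dotProduct, Fin.sum_univ_three] <;> ring

theorem app_smul_sqForm (c : K) (m v : Fin 3 → K) :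
    app (c • sqForm m) v = (c * (m ⬝ᵥ v)) • m := by
  apply ext3 <;> simp [app, sqForm, dotProduct, Fin.sum_univ_three] <;> ring

theorem sqForm_smul (t : K) (m : Fin 3 → K) : sqForm (t • m) = t ^ 2 • sqForm m := by
  apply ext6 <;> simp [sqForm] <;> ring

theorem adj3_smul_sqForm (c : K) (m : Fin 3 → K) : adj3 (c • sqForm m) = 0 := by
  apply ext6 <;> simp [sqForm, adj3] <;> ring

theorem sqForm_ne_zero {m : Fin 3 → K} (hm : m ≠ 0) : sqForm m ≠ 0 := by
  intro h
  rcases vec_ne_zero hm with h0 | h0 | h0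
  · have := congrFun h 0; simp [sqForm] at this; exact h0 this
  · have := congrFun h 3; simp [sqForm] at this; exact h0 this
  · have := congrFun h 5; simp [sqForm] at this; exact h0 this

theorem eq_smul_of_smul_sqForm_eq {c c' : K} {m m' : Fin 3 → K} (hm : m ≠ 0) (hc' : c' ≠ 0)
    (h : c • sqForm m = c' • sqForm m') : ∃ t : K, m' = t • m := by
  refine exists_smul_of_forall_dotProduct hm fun v hv => ?_
  have := congrArg (fun A => bil A v v) h
  simpa [bil_smul_sqForm, hv, hc'] using this

/-- A form whose matrix has rank at most one is a multiple of a square. -/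
theorem exists_eq_smul_sqForm {A : Fin 6 → K} (h : adj3 A = 0) :
    ∃ (c : K) (m : Fin 3 → K), A = c • sqForm m := by
  have e0 := congrFun h 0
  have e1 := congrFun h 1
  have e2 := congrFun h 2
  have e3 := congrFun h 3
  have e4 := congrFun h 4
  have e5 := congrFun h 5
  simp [adj3] at e0 e1 e2 e3 e4 e5
  by_cases h0 : A 0 = 0
  · by_cases h3 : A 3 = 0
    · have h1 : A 1 = 0 := by simpa [h0] using e5
      have h2 : A 2 = 0 := by simpa [h0] using e3
      have h4 : A 4 = 0 := by simpa [h3] using e0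
      refine ⟨A 5, ![0, 0, 1], ext6 ?_ ?_ ?_ ?_ ?_ ?_⟩ <;> simp [sqForm, *]
    · have h1 : A 1 = 0 := by simpa [h0] using e5
      have h2 : A 2 = 0 := by simpa [h0] using e3
      refine ⟨1 / A 3, ![0, A 3, A 4], ext6 ?_ ?_ ?_ ?_ ?_ ?_⟩ <;> simp [sqForm, *]
      field_simp
      linear_combination e0
  · refine ⟨1 / A 0, ![A 0, A 1, A 2], ext6 ?_ ?_ ?_ ?_ ?_ ?_⟩ <;> simp [sqForm, *] <;>
      field_simp
    · linear_combination e5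
    · linear_combination -e4
    · linear_combination e3

theorem adj3_eq_of_app_eq_zero {A : Fin 6 → K} {P : Fin 3 → K} (hP : P ≠ 0) (h : app A P = 0) :
    ∃ c : K, adj3 A = c • sqForm P := by
  obtain ⟨e0, e1, e2⟩ := app_eq_zero_iff.1 h
  rcases vec_ne_zero hP with h0 | h0 | h0
  · have h1 : A 1 = -(A 3 * P 1 + A 4 * P 2) / P 0 := by field_simp; linear_combination e1
    have h2 : A 2 = -(A 4 * P 1 + A 5 * P 2) / P 0 := by field_simp; linear_combination e2
    have h3 : A 0 = -(A 1 * P 1 + A 2 * P 2) / P 0 := by field_simp; linear_combination e0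
    refine ⟨(A 3 * A 5 - A 4 ^ 2) / P 0 ^ 2, ext6 ?_ ?_ ?_ ?_ ?_ ?_⟩ <;>
      simp [adj3, sqForm, h3] <;> (try simp only [h1, h2]) <;> field_simp <;> ring1
  · have h1 : A 1 = -(A 0 * P 0 + A 2 * P 2) / P 1 := by field_simp; linear_combination e0
    have h2 : A 4 = -(A 2 * P 0 + A 5 * P 2) / P 1 := by field_simp; linear_combination e2
    have h3 : A 3 = -(A 1 * P 0 + A 4 * P 2) / P 1 := by field_simp; linear_combination e1
    refine ⟨(A 0 * A 5 - A 2 ^ 2) / P 1 ^ 2, ext6 ?_ ?_ ?_ ?_ ?_ ?_⟩ <;>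
      simp [adj3, sqForm, h3] <;> (try simp only [h1, h2]) <;> field_simp <;> ring1
  · have h1 : A 2 = -(A 0 * P 0 + A 1 * P 1) / P 2 := by field_simp; linear_combination e0
    have h2 : A 4 = -(A 1 * P 0 + A 3 * P 1) / P 2 := by field_simp; linear_combination e1
    have h3 : A 5 = -(A 2 * P 0 + A 4 * P 1) / P 2 := by field_simp; linear_combination e2
    refine ⟨(A 0 * A 3 - A 1 ^ 2) / P 2 ^ 2, ext6 ?_ ?_ ?_ ?_ ?_ ?_⟩ <;>
      simp [adj3, sqForm, h3] <;> (try simp only [h1, h2]) <;> field_simp <;> ring1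

/-- The matrix with coordinates `A`. -/
def toMat (A : Fin 6 → K) : Matrix (Fin 3) (Fin 3) K :=
  !![A 0, A 1, A 2; A 1, A 3, A 4; A 2, A 4, A 5]

theorem det_toMat (A : Fin 6 → K) : (toMat A).det = det3 A := by
  simp [toMat, Matrix.det_fin_three, det3]; ring

theorem toMat_mulVec (A : Fin 6 → K) (v : Fin 3 → K) : toMat A *ᵥ v = app A v := by
  apply ext3 <;> simp [toMat, app, Matrix.mulVec, dotProduct, Fin.sum_univ_three]

theorem det3_eq_zero_iff {A : Fin 6 → K} : det3 A = 0 ↔ ∃ P : Fin 3 → K, P ≠ 0 ∧ app A P = 0 := by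
  rw [← det_toMat, ← Matrix.exists_mulVec_eq_zero_iff]
  simp [toMat_mulVec]

theorem prodForm_injective (h2 : (2 : K) ≠ 0) {l m m' : Fin 3 → K} (hl : l ≠ 0)
    (h : prodForm l m = prodForm l m') : m = m' := by
  obtain ⟨e0, e1, e2, e3, e4, e5⟩ := eq_iff6.1 h
  simp [prodForm, h2] at e0 e1 e2 e3 e4 e5
  rcases vec_ne_zero hl with h0 | h0 | h0 <;> apply ext3 <;> simp_all

theorem exists_eq_prodForm (h2 : (2 : K) ≠ 0) {A : Fin 6 → K} {b : Fin 3 → K} (hb : b ≠ 0)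
    (h : ∀ v : Fin 3 → K, v ⬝ᵥ b = 0 → bil A v v = 0) : ∃ m : Fin 3 → K, A = prodForm b m := by
  have key : ∀ x y z : K, bil A ![y * b 2 - z * b 1, z * b 0 - x * b 2, x * b 1 - y * b 0]
      ![y * b 2 - z * b 1, z * b 0 - x * b 2, x * b 1 - y * b 0] = 0 := fun x y z => by
    apply h; simp [dotProduct, Fin.sum_univ_three]; ring
  have e0 := key 1 0 0
  have e1 := key 0 1 0
  have e2 := key 0 0 1
  have e01 := key 1 1 0
  have e02 := key 1 0 1
  have e12 := key 0 1 1
  simp [bil] at e0 e1 e2 e01 e02 e12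
  rcases vec_ne_zero hb with h0 | h0 | h0
  · refine ⟨![A 0 / (2 * b 0), (A 1 - A 0 / (2 * b 0) * b 1) / b 0,
      (A 2 - A 0 / (2 * b 0) * b 2) / b 0], ext6 ?_ ?_ ?_ ?_ ?_ ?_⟩ <;>
      simp [prodForm] <;> field_simp <;> try ring1
    · linear_combination e2
    · linear_combination e1 + e2 - e12
    · linear_combination e1
  · refine ⟨![(A 1 - A 3 / (2 * b 1) * b 0) / b 1, A 3 / (2 * b 1),
      (A 4 - A 3 / (2 * b 1) * b 2) / b 1], ext6 ?_ ?_ ?_ ?_ ?_ ?_⟩ <;>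
      simp [prodForm] <;> field_simp <;> try ring1
    · linear_combination e2
    · linear_combination e0 + e2 - e02
    · linear_combination e0
  · refine ⟨![(A 2 - A 5 / (2 * b 2) * b 0) / b 2, (A 4 - A 5 / (2 * b 2) * b 1) / b 2,
      A 5 / (2 * b 2)], ext6 ?_ ?_ ?_ ?_ ?_ ?_⟩ <;>
      simp [prodForm] <;> field_simp <;> try ring1
    · linear_combination e1
    · linear_combination e0 + e1 - e01
    · linear_combination e0

theorem eq_smul_sqForm_cross {A : Fin 6 → K} {P Q : Fin 3 → K} (hP : app A P = 0)
    (hQ : app A Q = 0) (h : cross P Q ≠ 0) : ∃ a : K, A = a • sqForm (cross P Q) := by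
  obtain ⟨p0, p1, p2⟩ := app_eq_zero_iff.1 hP
  obtain ⟨q0, q1, q2⟩ := app_eq_zero_iff.1 hQ
  have row : ∀ x y z : K, x * P 0 + y * P 1 + z * P 2 = 0 → x * Q 0 + y * Q 1 + z * Q 2 = 0 →
      cross (cross P Q) ![x, y, z] = 0 := by
    intro x y z h1 h2
    apply ext3 <;> simp [cross] <;> grind
  obtain ⟨r, hr⟩ := cross_eq_zero h (row _ _ _ p0 q0)
  obtain ⟨s, hs⟩ := cross_eq_zero h (row _ _ _ p1 q1)
  obtain ⟨t, ht⟩ := cross_eq_zero h (row _ _ _ p2 q2)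
  generalize cross P Q = n at *
  have r0 := congrFun hr 0
  have r1 := congrFun hr 1
  have r2 := congrFun hr 2
  have s0 := congrFun hs 0
  have s1 := congrFun hs 1
  have s2 := congrFun hs 2
  have t0 := congrFun ht 0
  have t1 := congrFun ht 1
  have t2 := congrFun ht 2
  simp at r0 r1 r2 s0 s1 s2 t0 t1 t2
  rcases vec_ne_zero h with h0 | h0 | h0
  · refine ⟨r / n 0, ext6 ?_ ?_ ?_ ?_ ?_ ?_⟩ <;> simp [sqForm] <;> field_simp <;> grind
  · refine ⟨s / n 1, ext6 ?_ ?_ ?_ ?_ ?_ ?_⟩ <;> simp [sqForm] <;> field_simp <;> grind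
  · refine ⟨t / n 2, ext6 ?_ ?_ ?_ ?_ ?_ ?_⟩ <;> simp [sqForm] <;> field_simp <;> grind

theorem exists_combination {R P c : Fin 3 → K} (hx : cross R P ≠ 0) (hc : c ⬝ᵥ cross R P = 0) :
    ∃ s t : K, c = s • R + t • P := by
  simp only [cross, dotProduct, Fin.sum_univ_three] at hc
  rcases vec_ne_zero hx with h0 | h0 | h0 <;> simp [cross] at h0 hc
  · refine ⟨(c 1 * P 2 - c 2 * P 1) / (R 1 * P 2 - R 2 * P 1),
      (R 1 * c 2 - R 2 * c 1) / (R 1 * P 2 - R 2 * P 1), ext3 ?_ ?_ ?_⟩ <;> simp <;> field_simp <;>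
      grind
  · refine ⟨(c 2 * P 0 - c 0 * P 2) / (R 2 * P 0 - R 0 * P 2),
      (R 2 * c 0 - R 0 * c 2) / (R 2 * P 0 - R 0 * P 2), ext3 ?_ ?_ ?_⟩ <;> simp <;> field_simp <;>
      grind
  · refine ⟨(c 0 * P 1 - c 1 * P 0) / (R 0 * P 1 - R 1 * P 0),
      (R 0 * c 1 - R 1 * c 0) / (R 0 * P 1 - R 1 * P 0), ext3 ?_ ?_ ?_⟩ <;> simp <;> field_simp <;>
      grind

theorem app_add_smul (A B : Fin 6 → K) (t : K) (v : Fin 3 → K) :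
    app (A + t • B) v = app A v + t • app B v := by
  apply ext3 <;> simp [app] <;> ring

theorem app_combination (A : Fin 6 → K) (s t : K) (v w : Fin 3 → K) :
    app A (s • v + t • w) = s • app A v + t • app A w := by
  apply ext3 <;> simp [app] <;> ring

/-- If a singular conic is tangent at a base point `P` to the line `b`, it contains that line. -/
theorem bil_eq_zero_of_det3_eq_zero {C : Fin 6 → K} {P b c : Fin 3 → K} (hC : det3 C = 0)
    (hb : b ≠ 0) (hPb : app C P = b) (hP : P ⬝ᵥ b = 0) (hc : c ⬝ᵥ b = 0) : bil C c c = 0 := by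
  obtain ⟨R, hR, hCR⟩ := det3_eq_zero_iff.1 hC
  have hRb : R ⬝ᵥ b = 0 := by
    have h1 := app_eq_zero_iff.1 hCR
    rw [← hPb]
    simp [app, dotProduct, Fin.sum_univ_three]
    linear_combination P 0 * h1.1 + P 1 * h1.2.1 + P 2 * h1.2.2
  have hx : cross R P ≠ 0 := by
    intro h
    obtain ⟨t, ht⟩ := cross_eq_zero hR h
    apply hb
    obtain ⟨f0, f1, f2⟩ := app_eq_zero_iff.1 hCR
    rw [← hPb, ht, app_eq_zero_iff]
    simp
    refine ⟨?_, ?_, ?_⟩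
    · linear_combination t * f0
    · linear_combination t * f1
    · linear_combination t * f2
  have hbx : ∃ s : K, b = s • cross R P := by
    apply cross_eq_zero hx
    simp [dotProduct, Fin.sum_univ_three] at hRb hP
    apply ext3 <;> simp [cross] <;> grind
  obtain ⟨s, rfl⟩ := hbx
  have hs : s ≠ 0 := by rintro rfl; simp at hb
  obtain ⟨x, y, hxy⟩ := exists_combination hx (by simpa [hs] using hc)
  rw [bil_eq_dotProduct]
  conv_lhs => rw [hxy, app_combination, hCR, hPb, smul_zero, zero_add, ← hxy]
  rw [dotProduct_smul, hc, smul_zero]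

end Algebra

/-- The indicator of a proposition, as a complex number. -/
def ind (p : Prop) : ℂ := if p then 1 else 0

theorem ind_of {p : Prop} (h : p) : ind p = 1 := if_pos h

theorem ind_not {p : Prop} (h : ¬ p) : ind p = 0 := if_neg h

theorem ind_and (p r : Prop) : ind (p ∧ r) = ind p * ind r := by
  by_cases hp : p <;> by_cases hr : r <;> simp [ind, hp, hr]

/-- The number of solutions of a predicate on a finite type, as a complex number. -/
def cnt {α : Type*} [Fintype α] (p : α → Prop) : ℂ := ∑ a, ind (p a)

/-- The order of the field, as a complex number. -/
def ord (F : Type*) [Fintype F] : ℂ := Fintype.card F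

theorem cnt_eq_card {α : Type*} [Fintype α] (p : α → Prop) :
    cnt p = (Finset.univ.filter p).card := by
  simp [cnt, ind]

theorem cnt_congr {α : Type*} [Fintype α] {p r : α → Prop} (h : ∀ a, p a ↔ r a) :
    cnt p = cnt r := by
  rw [funext fun a => propext (h a)]

theorem cnt_eq_zero {α : Type*} [Fintype α] {p : α → Prop} (h : ∀ a, ¬ p a) : cnt p = 0 := by
  simp [cnt, ind, h]

theorem cnt_eq_zero_iff {α : Type*} [Fintype α] {p : α → Prop} : cnt p = 0 ↔ ∀ a, ¬ p a := by
  rw [cnt_eq_card]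
  simp [Finset.filter_eq_empty_iff]

theorem cnt_eq_one {α : Type*} [Fintype α] {p : α → Prop} (a : α) (h : ∀ b, p b ↔ b = a) :
    cnt p = 1 := by
  simp [cnt, ind, h]

theorem cnt_true {α : Type*} [Fintype α] : cnt (fun _ : α => True) = Fintype.card α := by
  simp [cnt, ind]

theorem ord_ne_zero : ord F ≠ 0 := by simp [ord]

theorem ord_sub_one_ne_zero : ord F - 1 ≠ 0 := by
  rw [ord, sub_ne_zero]
  exact_mod_cast Fintype.one_lt_card.ne'

theorem cnt_ne_zero_and {p : (Fin 3 → F) → Prop} (h : p 0) :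
    cnt (fun v => v ≠ 0 ∧ p v) = cnt p - 1 := by
  have : cnt p = cnt (fun v => v ≠ 0 ∧ p v) + cnt (fun v : Fin 3 → F => v = 0) := by
    simp only [cnt, ← Finset.sum_add_distrib]
    refine Finset.sum_congr rfl fun v _ => ?_
    by_cases hv : v = 0
    · subst hv; simp [ind, h]
    · simp [ind, hv]
  rw [this, cnt_eq_one (p := fun v : Fin 3 → F => v = 0) 0 (fun b => Iff.rfl)]
  ring

theorem cnt_smul {b : Fin 3 → F} (hb : b ≠ 0) {p : (Fin 3 → F) → Prop}
    (h : ∀ v, p v ↔ v ≠ 0 ∧ ∃ c : F, v = c • b) : cnt p = ord F - 1 := by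
  have h1 : Finset.univ.filter p = (Finset.univ.filter (fun c : F => c ≠ 0)).image (· • b) := by
    ext v
    simp only [Finset.mem_filter, Finset.mem_univ, true_and, Finset.mem_image, h]
    constructor
    · rintro ⟨hv, c, rfl⟩
      exact ⟨c, fun hc => hv (by simp [hc]), rfl⟩
    · rintro ⟨c, hc, rfl⟩
      exact ⟨smul_ne_zero hc hb, c, rfl⟩
  rw [cnt_eq_card, h1, Finset.card_image_of_injective _ (smul_left_injective F hb),
    Finset.filter_ne' Finset.univ (0 : F), Finset.card_erase_of_mem (Finset.mem_univ _),
    Finset.card_univ, Nat.cast_sub Fintype.card_pos]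
  simp [ord]

theorem cnt_dotProduct_eq_zero {b : Fin 3 → F} (hb : b ≠ 0) :
    cnt (fun v : Fin 3 → F => v ⬝ᵥ b = 0) = ord F ^ 2 := by
  have hlin : ∀ v : Fin 3 → F, v ⬝ᵥ b = Fintype.linearCombination F b v := by
    intro v; simp [dotProduct, Fintype.linearCombination_apply]
  set f : (Fin 3 → F) →ₗ[F] F := Fintype.linearCombination F b with hf
  have hsurj : Function.Surjective f := by
    refine LinearMap.surjective fun h0 => ?_
    apply hb
    funext i
    have := LinearMap.congr_fun h0 (Pi.single i 1)
    rw [← hlin] at this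
    simpa using this
  have hrank := LinearMap.finrank_range_add_finrank_ker f
  rw [LinearMap.range_eq_top.2 hsurj, finrank_top] at hrank
  simp at hrank
  have hcard : Fintype.card (LinearMap.ker f) = Fintype.card F ^ 2 := by
    rw [Module.card_eq_pow_finrank (K := F), show Module.finrank F (LinearMap.ker f) = 2 by omega]
  have : (Finset.univ.filter (fun v : Fin 3 → F => v ⬝ᵥ b = 0)).card = Fintype.card F ^ 2 := by
    rw [← hcard, Fintype.card_subtype]
    simp [hlin]
  rw [cnt_eq_card, this, ord]
  exact Nat.cast_pow _ _

theorem cnt_ne_zero_and_dotProduct {b : Fin 3 → F} (hb : b ≠ 0) :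
    cnt (fun v : Fin 3 → F => v ≠ 0 ∧ v ⬝ᵥ b = 0) = ord F ^ 2 - 1 := by
  rw [cnt_ne_zero_and (p := fun v => v ⬝ᵥ b = 0) (by simp), cnt_dotProduct_eq_zero hb]

theorem cnt_ne_zero : cnt (fun v : Fin 3 → F => v ≠ 0) = ord F ^ 3 - 1 := by
  have := cnt_ne_zero_and (F := F) (p := fun _ => True) trivial
  simpa [cnt_true, ord] using this

/-! ### Double roots of binary cubics -/

omit [Fintype F] in
theorem cubic_eq_zero_of_div {a b c d n m : F} (hm : m ≠ 0)
    (h : a * m ^ 3 + b * n * m ^ 2 + c * n ^ 2 * m + d * n ^ 3 = 0) :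
    a + b * (n / m) + c * (n / m) ^ 2 + d * (n / m) ^ 3 = 0 := by
  field_simp
  linear_combination h

omit [Fintype F] in
theorem quadratic_eq_zero_of_div {b c d n m : F} (hm : m ≠ 0)
    (h : b * m ^ 2 + 2 * c * n * m + 3 * d * n ^ 2 = 0) :
    b + 2 * c * (n / m) + 3 * d * (n / m) ^ 2 = 0 := by
  field_simp
  linear_combination h

/-- The number of multiple roots on the projective line of a binary cubic. -/
theorem cnt_double_root (h2 : (2 : F) ≠ 0) (a b c d : F) :
    cnt (fun t : F => a + b * t + c * t ^ 2 + d * t ^ 3 = 0 ∧ b + 2 * c * t + 3 * d * t ^ 2 = 0) +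
      ind (d = 0 ∧ c = 0) =
    ind (discCubic a b c d = 0) + ord F * ind (a = 0 ∧ b = 0 ∧ c = 0 ∧ d = 0) := by
  by_cases hcd : d = 0 ∧ c = 0
  · obtain ⟨rfl, rfl⟩ := hcd
    by_cases hab : a = 0 ∧ b = 0
    · obtain ⟨rfl, rfl⟩ := hab
      simp [discCubic, cnt, ord, ind, add_comm]
    · rw [cnt_eq_zero]
      · simp [discCubic, ind, hab]
      · rintro t ⟨h0, h1⟩
        simp only [zero_mul, mul_zero, add_zero] at h0 h1
        exact hab ⟨by simpa [h1] using h0, h1⟩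
  rw [ind_not hcd, ind_not (by tauto : ¬ (a = 0 ∧ b = 0 ∧ c = 0 ∧ d = 0))]
  by_cases hex : ∃ t : F, a + b * t + c * t ^ 2 + d * t ^ 3 = 0 ∧ b + 2 * c * t + 3 * d * t ^ 2 = 0
  · obtain ⟨t, h0, h1⟩ := hex
    have hb : b = -(2 * c * t + 3 * d * t ^ 2) := by linear_combination h1
    have ha : a = -(b * t + c * t ^ 2 + d * t ^ 3) := by linear_combination h0
    rw [cnt_eq_one t, ind_of]
    · simp
    · rw [ha, hb, discCubic]; ring
    · refine fun s => ⟨?_, fun h => h ▸ ⟨h0, h1⟩⟩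
      rintro ⟨k0, k1⟩
      by_contra hst
      have hne : s - t ≠ 0 := sub_ne_zero.2 hst
      have e1 : (s - t) ^ 2 * ((c + 3 * d * t) + d * (s - t)) = 0 := by
        linear_combination k0 - h0 - (s - t) * h1
      have e2 : (s - t) * (2 * (c + 3 * d * t) + 3 * d * (s - t)) = 0 := by
        linear_combination k1 - h1
      simp only [mul_eq_zero, pow_eq_zero_iff, hne, false_or, ne_eq, OfNat.ofNat_ne_zero,
        not_false_eq_true] at e1 e2
      have hd : d = 0 := by
        have : d * (s - t) = 0 := by linear_combination e2 - 2 * e1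
        simpa [hne] using this
      exact hcd ⟨hd, by simpa [hd] using e1⟩
  · rw [cnt_eq_zero (fun t ht => hex ⟨t, ht⟩), ind_not]
    · simp
    intro hD
    apply hex
    rw [discCubic] at hD
    by_cases hM : c ^ 2 - 3 * b * d = 0
    · have hd : d ≠ 0 := by
        rintro rfl
        exact hcd ⟨rfl, by simpa using hM⟩
      by_cases h3 : (3 : F) = 0
      · have hc : c = 0 := by simpa [h3] using hM
        subst hc
        have hb : b = 0 := by
          have : b ^ 3 * d = 0 := by linear_combination -hD + (-9 * a ^ 2 * d ^ 2 - b ^ 3 * d) * h3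
          simpa [hd] using this
        subst hb
        have : CharP F 3 := by
          exact (CharP.charP_iff_prime_eq_zero Nat.prime_three).2 (by exact_mod_cast h3)
        have : Fact (Nat.Prime 3) := ⟨Nat.prime_three⟩
        obtain ⟨t, ht⟩ := (bijective_frobenius F 3).2 (-a / d)
        rw [frobenius_def] at ht
        refine ⟨t, ?_, by simp [h3]⟩
        rw [ht]
        field_simp
        ring
      · have hN : 9 * a * d - b * c = 0 := by
          have : (9 * a * d - b * c) ^ 2 = 0 := by
            linear_combination (-3) * hD + 4 * (b ^ 2 - 3 * a * c) * hM
          simpa using this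
        have h3d : 3 * d ≠ 0 := mul_ne_zero h3 hd
        refine ⟨-c / (3 * d), cubic_eq_zero_of_div h3d ?_, quadratic_eq_zero_of_div h3d ?_⟩
        · linear_combination (3 * d ^ 2) * hN + 2 * c * d * hM
        · linear_combination (-3 * d) * hM
    · have hM' : 2 * (c ^ 2 - 3 * b * d) ≠ 0 := mul_ne_zero h2 hM
      refine ⟨(9 * a * d - b * c) / (2 * (c ^ 2 - 3 * b * d)), cubic_eq_zero_of_div hM' ?_,
        quadratic_eq_zero_of_div hM' ?_⟩
      · linear_combination (-27 * a * d ^ 2 + 9 * b * c * d - 2 * c ^ 3) * hD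
      · linear_combination (-9 * d) * hD

section Algebra

variable {K : Type*} [Field K]

theorem pairing_comm (A B : Fin 6 → K) : pairing A B = pairing B A := by
  simp [pairing]; ring

theorem pairing_smul_left (c : K) (A B : Fin 6 → K) : pairing (c • A) B = c * pairing A B := by
  simp [pairing]; ring

theorem app_smul (A : Fin 6 → K) (c : K) (v : Fin 3 → K) : app A (c • v) = c • app A v := by
  apply ext3 <;> simp [app] <;> ring

theorem bil_smul_smul (A : Fin 6 → K) (c : K) (v : Fin 3 → K) :
    bil A (c • v) (c • v) = c ^ 2 * bil A v v := by
  simp [bil]; ring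

theorem bil_add_smul (A B : Fin 6 → K) (t : K) (v w : Fin 3 → K) :
    bil (A + t • B) v w = bil A v w + t * bil B v w := by
  simp [bil]; ring

theorem prodForm_zero (l : Fin 3 → K) : prodForm l 0 = 0 := by
  apply ext6 <;> simp [prodForm]

theorem app_zero_form (v : Fin 3 → K) : app (0 : Fin 6 → K) v = 0 := by
  apply ext3 <;> simp [app]

theorem bil_zero_form (v w : Fin 3 → K) : bil (0 : Fin 6 → K) v w = 0 := by
  simp [bil]

theorem prodForm_smul_left {c : K} (hc : c ≠ 0) (l m : Fin 3 → K) :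
    prodForm (c • l) (c⁻¹ • m) = prodForm l m := by
  apply ext6 <;> simp [prodForm] <;> field_simp <;> simp

theorem cross_smul_right (c : K) (v w : Fin 3 → K) : cross v (c • w) = c • cross v w := by
  apply ext3 <;> simp [cross] <;> ring

theorem cross_self (v : Fin 3 → K) : cross v v = 0 := by
  apply ext3 <;> simp [cross] <;> ring

theorem dotProduct_cross_left (v w : Fin 3 → K) : v ⬝ᵥ cross v w = 0 := by
  simp [cross, dotProduct, Fin.sum_univ_three]; ring

theorem dotProduct_cross_right (v w : Fin 3 → K) : w ⬝ᵥ cross v w = 0 := by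
  simp [cross, dotProduct, Fin.sum_univ_three]; ring

theorem exists_orthogonal (m n : Fin 3 → K) :
    ∃ P : Fin 3 → K, P ≠ 0 ∧ m ⬝ᵥ P = 0 ∧ n ⬝ᵥ P = 0 := by
  obtain ⟨P, hP, h⟩ := (Matrix.exists_mulVec_eq_zero_iff
    (M := !![m 0, m 1, m 2; n 0, n 1, n 2; 0, 0, 0])).2 (by simp [Matrix.det_fin_three])
  have h0 := congrFun h 0
  have h1 := congrFun h 1
  refine ⟨P, hP, ?_, ?_⟩
  · simpa [Matrix.mulVec, dotProduct, Fin.sum_univ_three] using h0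
  · simpa [Matrix.mulVec, dotProduct, Fin.sum_univ_three] using h1

/-- Two nonproportional linear factors of a form pass through a common vertex. -/
theorem app_cross_eq_zero {l m l' m' : Fin 3 → K} (h : prodForm l m = prodForm l' m')
    (hx : cross l l' ≠ 0) : app (prodForm l m) (cross l l') = 0 := by
  have e1 : app (prodForm l m) (cross l l') = (m ⬝ᵥ cross l l') • l := by
    rw [app_prodForm, dotProduct_cross_left, zero_smul, add_zero]
  have e2 : app (prodForm l m) (cross l l') = (m' ⬝ᵥ cross l l') • l' := by
    rw [h, app_prodForm, dotProduct_cross_right, zero_smul, add_zero]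
  have e3 := congrArg (cross l) (e1.symm.trans e2)
  rw [cross_smul_right, cross_smul_right, cross_self, smul_zero, eq_comm, smul_eq_zero] at e3
  rw [e2, e3.resolve_right hx, zero_smul]

/-- A linear factor of a square is proportional to its root. -/
theorem exists_smul_of_smul_sqForm_eq_prodForm {a : K} {n l m : Fin 3 → K} (ha : a ≠ 0)
    (hn : n ≠ 0) (hl : l ≠ 0) (h : a • sqForm n = prodForm l m) : ∃ c : K, l = c • n := by
  obtain ⟨c, hc⟩ : ∃ c : K, n = c • l := by
    refine exists_smul_of_forall_dotProduct hl fun v hv => ?_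
    have := congrArg (fun A => bil A v v) h
    simpa [bil_smul_sqForm, bil_prodForm, hv, ha] using this
  have hc0 : c ≠ 0 := by rintro rfl; exact hn (by simpa using hc)
  exact ⟨c⁻¹, by rw [hc, smul_smul, inv_mul_cancel₀ hc0, one_smul]⟩

theorem smul_sqForm_eq_prodForm (h2 : (2 : K) ≠ 0) (a : K) (n : Fin 3 → K) :
    a • sqForm n = prodForm n ((a / 2) • n) := by
  apply ext6 <;> simp [prodForm, sqForm] <;> field_simp <;> ring

/-! ### Degenerate members of a pencil -/

/-- The resolvent of the pencil through `A` and `B` has a multiple root at `A`. -/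
def Dbl (A B : Fin 6 → K) : Prop := det3 A = 0 ∧ pairing (adj3 A) B = 0

theorem Dbl.of_point {A B : Fin 6 → K} {P : Fin 3 → K} (hP : P ≠ 0) (hA : app A P = 0)
    (hB : bil B P P = 0) : Dbl A B := by
  obtain ⟨c, hc⟩ := adj3_eq_of_app_eq_zero hP hA
  refine ⟨det3_eq_zero_iff.2 ⟨P, hP, hA⟩, ?_⟩
  rw [hc, pairing_smul_left, pairing_comm, pairing_sqForm, hB, mul_zero]

theorem Dbl.of_adj3_eq_zero {A : Fin 6 → K} (h : adj3 A = 0) (B : Fin 6 → K) : Dbl A B := by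
  obtain ⟨c, m, rfl⟩ := exists_eq_smul_sqForm h
  refine ⟨?_, ?_⟩
  · simp [det3, sqForm]; ring
  · rw [h]; simp [pairing]

theorem Dbl.exists_point {A B : Fin 6 → K} (h : Dbl A B) (hA : adj3 A ≠ 0) :
    ∃ (P : Fin 3 → K) (c : K), P ≠ 0 ∧ c ≠ 0 ∧ app A P = 0 ∧ adj3 A = c • sqForm P ∧
      bil B P P = 0 := by
  obtain ⟨P, hP, hAP⟩ := det3_eq_zero_iff.1 h.1
  obtain ⟨c, hc⟩ := adj3_eq_of_app_eq_zero hP hAP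
  have hc0 : c ≠ 0 := by rintro rfl; exact hA (by simpa using hc)
  refine ⟨P, c, hP, hc0, hAP, hc, ?_⟩
  have := h.2
  rw [hc, pairing_smul_left, pairing_comm, pairing_sqForm] at this
  simpa [hc0] using this

/-- A pencil all of whose members are singular and without common vertex has a common line. -/
theorem exists_common_line (h2 : (2 : K) ≠ 0) {A B : Fin 6 → K} (hA : Dbl A B) (hB : Dbl B A)
    (hk : ∀ P : Fin 3 → K, P ≠ 0 → app A P = 0 → app B P ≠ 0) (hadj : adj3 A ≠ 0) :
    ∃ b m m' : Fin 3 → K, b ≠ 0 ∧ A = prodForm b m ∧ B = prodForm b m' := by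
  obtain ⟨P, c, hP, -, hAP, -, hBP⟩ := hA.exists_point hadj
  have hb := hk P hP hAP
  have hPb : P ⬝ᵥ app B P = 0 := by rw [← bil_eq_dotProduct, hBP]
  have h1 : ∀ v : Fin 3 → K, v ⬝ᵥ app B P = 0 → bil B v v = 0 := fun v hv =>
    bil_eq_zero_of_det3_eq_zero hB.1 hb rfl hPb hv
  have h3 : ∀ v : Fin 3 → K, v ⬝ᵥ app B P = 0 → bil A v v = 0 := fun v hv => by
    have := bil_eq_zero_of_det3_eq_zero (C := A + (1 : K) • B) (P := P)
      (by rw [det3_add_smul, hA.1, hA.2, hB.1, hB.2]; ring) hb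
      (by rw [app_add_smul, hAP]; simp) hPb hv
    rwa [bil_add_smul, h1 v hv, mul_zero, add_zero] at this
  obtain ⟨m, hm⟩ := exists_eq_prodForm h2 hb h3
  obtain ⟨m', hm'⟩ := exists_eq_prodForm h2 hb h1
  exact ⟨_, m, m', hb, hm, hm'⟩

theorem Dbl.of_common_line {l m m' : Fin 3 → K} : Dbl (prodForm l m) (prodForm l m') := by
  constructor
  · simp [det3, prodForm]; ring
  · simp [pairing, adj3, prodForm]; ring

/-- Incidence of a common vertex with a common line of a nonzero pencil. -/
theorem flag_iff (h2 : (2 : K) ≠ 0) {A B : Fin 6 → K} (hAB : ¬ (A = 0 ∧ B = 0))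
    {l P : Fin 3 → K} (hl : l ≠ 0) :
    (l ⬝ᵥ P = 0 ∧ (∃ m : Fin 3 → K, m ⬝ᵥ P = 0 ∧ A = prodForm l m) ∧
      ∃ m : Fin 3 → K, m ⬝ᵥ P = 0 ∧ B = prodForm l m) ↔
    (app A P = 0 ∧ app B P = 0) ∧
      (∃ m : Fin 3 → K, A = prodForm l m) ∧ ∃ m : Fin 3 → K, B = prodForm l m := by
  constructor
  · rintro ⟨h0, ⟨m, hm, rfl⟩, m', hm', rfl⟩
    refine ⟨⟨?_, ?_⟩, ⟨m, rfl⟩, m', rfl⟩ <;> simp [app_prodForm, *]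
  · rintro ⟨⟨hA, hB⟩, ⟨m, rfl⟩, m', rfl⟩
    rw [app_prodForm] at hA hB
    have h0 : l ⬝ᵥ P = 0 := by
      by_contra h0
      have key : ∀ n : Fin 3 → K, (n ⬝ᵥ P) • l + (l ⬝ᵥ P) • n = 0 → n = 0 := fun n hn => by
        have := congrArg (fun v => v ⬝ᵥ P) hn
        simp only [add_dotProduct, smul_dotProduct, smul_eq_mul, zero_dotProduct] at this
        have : 2 * (l ⬝ᵥ P) * (n ⬝ᵥ P) = 0 := by linear_combination this
        have hnP : n ⬝ᵥ P = 0 := by simpa [h2, h0] using this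
        simpa [hnP, h0] using hn
      exact hAB ⟨by rw [key m hA, prodForm_zero], by rw [key m' hB, prodForm_zero]⟩
    simp only [h0, zero_smul, add_zero, smul_eq_zero, hl, or_false] at hA hB
    exact ⟨h0, ⟨m, hA, rfl⟩, m', hB, rfl⟩

theorem exists_common_vertex_of_adj3_eq_zero {A B : Fin 6 → K} (hA : adj3 A = 0)
    (hB : adj3 B = 0) : ∃ P : Fin 3 → K, P ≠ 0 ∧ app A P = 0 ∧ app B P = 0 := by
  obtain ⟨c, m, rfl⟩ := exists_eq_smul_sqForm hA
  obtain ⟨d, n, rfl⟩ := exists_eq_smul_sqForm hB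
  obtain ⟨P, hP, hm, hn⟩ := exists_orthogonal m n
  exact ⟨P, hP, by simp [app_smul_sqForm, hm], by simp [app_smul_sqForm, hn]⟩

end Algebra

/-! ### Counting functions -/

/-- The number of vertices of `A` lying on `B`. -/
def nPt (A B : Fin 6 → F) : ℂ := cnt fun P => P ≠ 0 ∧ app A P = 0 ∧ bil B P P = 0

/-- The defect of `nPt` at forms of rank at most one. -/
def dPt (A B : Fin 6 → F) : ℂ := if adj3 A = 0 then ord F - 1 - nPt A B else 0

/-- The number of common vertices. -/
def kap (A B : Fin 6 → F) : ℂ := cnt fun P => P ≠ 0 ∧ app A P = 0 ∧ app B P = 0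

/-- The number of common linear factors. -/
def phi (A B : Fin 6 → F) : ℂ :=
  cnt fun l => l ≠ 0 ∧ (∃ m : Fin 3 → F, A = prodForm l m) ∧ ∃ m : Fin 3 → F, B = prodForm l m

/-- The number of pairs of a common line and a common vertex on it. -/
def ff (A B : Fin 6 → F) : ℂ :=
  ∑ l : Fin 3 → F, cnt fun P : Fin 3 → F => l ≠ 0 ∧ P ≠ 0 ∧ l ⬝ᵥ P = 0 ∧
    (∃ m : Fin 3 → F, m ⬝ᵥ P = 0 ∧ A = prodForm l m) ∧
      ∃ m : Fin 3 → F, m ⬝ᵥ P = 0 ∧ B = prodForm l m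

/-- The number of flags annihilated by both forms. -/
def gg (A B : Fin 6 → F) : ℂ :=
  ∑ l : Fin 3 → F, cnt fun P : Fin 3 → F => l ≠ 0 ∧ P ≠ 0 ∧ l ⬝ᵥ P = 0 ∧
    (∀ m : Fin 3 → F, m ⬝ᵥ P = 0 → bil A l m = 0) ∧
      ∀ m : Fin 3 → F, m ⬝ᵥ P = 0 → bil B l m = 0

/-- The indicator of singular pencils. -/
def sing (A B : Fin 6 → F) : ℂ :=
  ind (discCubic (det3 A) (pairing (adj3 A) B) (pairing (adj3 B) A) (det3 B) = 0)

/-- The indicator of pencils with vanishing resolvent. -/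
def nul (A B : Fin 6 → F) : ℂ := ind (Dbl A B ∧ Dbl B A)

/-- The sum of `dPt` over the members of a pencil. -/
def dPencil (A B : Fin 6 → F) : ℂ := ∑ t : F, dPt (A + t • B) B + dPt B A

theorem nPt_add_dPt (A B : Fin 6 → F) :
    nPt A B + dPt A B = (ord F - 1) * ind (Dbl A B) := by
  by_cases hA : adj3 A = 0
  · rw [dPt, if_pos hA, ind_of (Dbl.of_adj3_eq_zero hA B)]; ring
  rw [dPt, if_neg hA, add_zero]
  by_cases hD : Dbl A B
  · obtain ⟨P, c, hP, hc, hAP, hadj, hBP⟩ := hD.exists_point hA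
    rw [ind_of hD, mul_one]
    refine cnt_smul hP fun v => ⟨?_, ?_⟩
    · rintro ⟨hv, hAv, -⟩
      obtain ⟨c', hc'⟩ := adj3_eq_of_app_eq_zero hv hAv
      refine ⟨hv, eq_smul_of_smul_sqForm_eq hP (c := c) (c' := c') ?_ (hadj.symm.trans hc')⟩
      rintro rfl
      exact hA (by simpa using hc')
    · rintro ⟨hv, t, ht⟩
      rw [ht] at hv ⊢
      exact ⟨hv, by rw [app_smul, hAP, smul_zero], by rw [bil_smul_smul, hBP, mul_zero]⟩
  · rw [ind_not hD, mul_zero, nPt, cnt_eq_zero]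
    rintro P ⟨hP, h1, h2⟩
    exact hD (Dbl.of_point hP h1 h2)

theorem sum_ite_dbl (h2 : (2 : F) ≠ 0) (A B : Fin 6 → F) :
    ∑ t : F, ind (Dbl (A + t • B) B) + ind (Dbl B A) =
      sing A B + ord F * nul A B := by
  have := cnt_double_root h2 (det3 A) (pairing (adj3 A) B) (pairing (adj3 B) A) (det3 B)
  simp only [cnt, ← det3_add_smul, ← pairing_adj3_add_smul] at this
  simp only [sing, nul, Dbl] at this ⊢
  simpa only [and_assoc, and_comm (a := pairing (adj3 B) A = 0)] using this

theorem cnt_line_aux {l a b : Fin 3 → F} (hl : l ≠ 0) :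
    cnt (fun P : Fin 3 → F => P ≠ 0 ∧ l ⬝ᵥ P = 0 ∧ (∃ c : F, a = c • P) ∧ ∃ c : F, b = c • P) =
      (ord F - 1) * (cnt (fun t : F => a + t • b = 0 ∧ l ⬝ᵥ b = 0) +
        ind (b = 0 ∧ l ⬝ᵥ a = 0)) := by
  have hsw : ∀ {c : F} {P v : Fin 3 → F}, v ≠ 0 → v = c • P → P = c⁻¹ • v := by
    intro c P v hv h
    have hc : c ≠ 0 := by rintro rfl; exact hv (by simpa using h)
    rw [h, smul_smul, inv_mul_cancel₀ hc, one_smul]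
  by_cases hb : b = 0
  · subst hb
    by_cases ha : a = 0
    · subst ha
      have : cnt (fun _ : F => True) = ord F := cnt_true
      simp only [smul_zero, add_zero, dotProduct_zero, and_self, this, ind_of]
      rw [cnt_congr (r := fun P => P ≠ 0 ∧ P ⬝ᵥ l = 0), cnt_ne_zero_and_dotProduct hl]
      · ring
      · intro P
        rw [dotProduct_comm]
        exact ⟨fun h => ⟨h.1, h.2.1⟩, fun h => ⟨h.1, h.2, 0, by simp⟩⟩
    · simp only [smul_zero, add_zero, dotProduct_zero, ha, and_true, true_and]
      rw [cnt_eq_zero (p := fun _ : F => False) (fun _ => id), zero_add]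
      by_cases h0 : l ⬝ᵥ a = 0
      · rw [ind_of h0, mul_one]
        refine cnt_smul ha fun P => ⟨?_, ?_⟩
        · rintro ⟨hP, -, ⟨c, hc⟩, -⟩
          exact ⟨hP, c⁻¹, hsw ha hc⟩
        · rintro ⟨hP, c, hc⟩
          exact ⟨hP, by rw [hc, dotProduct_smul, h0, smul_zero], ⟨c⁻¹, hsw hP hc⟩, 0, by simp⟩
      · rw [ind_not h0, mul_zero, cnt_eq_zero]
        rintro P ⟨-, h, ⟨c, rfl⟩, -⟩
        exact h0 (by rw [dotProduct_smul, h, smul_zero])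
  · rw [ind_not (fun h => hb h.1), add_zero]
    by_cases h : l ⬝ᵥ b = 0 ∧ ∃ c : F, a = c • b
    · obtain ⟨h0, c, rfl⟩ := h
      rw [cnt_smul hb, cnt_eq_one (-c), mul_one]
      · intro t
        rw [← add_smul, smul_eq_zero]
        simp only [hb, or_false, h0, and_true]
        exact ⟨fun h => by linear_combination h, fun h => by linear_combination h⟩
      · refine fun P => ⟨?_, ?_⟩
        · rintro ⟨hP, -, -, d, hd⟩
          exact ⟨hP, d⁻¹, hsw hb hd⟩
        · rintro ⟨hP, d, hd⟩
          refine ⟨hP, by rw [hd, dotProduct_smul, h0, smul_zero], ⟨c * d⁻¹, ?_⟩, d⁻¹, hsw hP hd⟩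
          rw [mul_smul, ← hsw hP hd]
    · rw [cnt_eq_zero, cnt_eq_zero, mul_zero]
      · rintro t ⟨h1, h0⟩
        exact h ⟨h0, -t, by rw [neg_smul]; exact eq_neg_of_add_eq_zero_left h1⟩
      · rintro P ⟨hP, h0, ⟨c, rfl⟩, d, rfl⟩
        have hd : d ≠ 0 := by rintro rfl; exact hb (by simp)
        exact h ⟨by rw [dotProduct_smul, h0, smul_zero], c * d⁻¹, by
          rw [smul_smul, mul_assoc, inv_mul_cancel₀ hd, mul_one]⟩

omit [Fintype F] in
theorem forall_bil_eq_zero_iff {A : Fin 6 → F} {l P : Fin 3 → F} (hP : P ≠ 0) :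
    (∀ m : Fin 3 → F, m ⬝ᵥ P = 0 → bil A l m = 0) ↔ ∃ c : F, app A l = c • P := by
  simp only [bil_eq_dotProduct]
  refine ⟨exists_smul_of_forall_dotProduct hP, ?_⟩
  rintro ⟨c, hc⟩ m hm
  rw [hc, dotProduct_smul, hm, smul_zero]

theorem gg_eq (A B : Fin 6 → F) :
    gg A B = (ord F - 1) * (∑ t : F, nPt (A + t • B) B + nPt B A) := by
  have h1 : ∀ l : Fin 3 → F, cnt (fun P : Fin 3 → F => l ≠ 0 ∧ P ≠ 0 ∧ l ⬝ᵥ P = 0 ∧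
      (∀ m : Fin 3 → F, m ⬝ᵥ P = 0 → bil A l m = 0) ∧
        ∀ m : Fin 3 → F, m ⬝ᵥ P = 0 → bil B l m = 0) =
      (ord F - 1) * (∑ t : F, ind (l ≠ 0 ∧ app (A + t • B) l = 0 ∧ bil B l l = 0) +
        ind (l ≠ 0 ∧ app B l = 0 ∧ bil A l l = 0)) := by
    intro l
    by_cases hl : l = 0
    · simp [hl, cnt, ind]
    · have := cnt_line_aux (a := app A l) (b := app B l) hl
      simp only [cnt, app_add_smul, bil_eq_dotProduct (v := l) (w := l), ne_eq, hl,
        not_false_eq_true, true_and] at this ⊢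
      refine Eq.trans ?_ this
      refine Finset.sum_congr rfl fun P _ => ?_
      by_cases hP : P = 0
      · simp [hP]
      · rw [forall_bil_eq_zero_iff hP, forall_bil_eq_zero_iff hP]
  rw [gg, Finset.sum_congr rfl fun l _ => h1 l, ← Finset.mul_sum, Finset.sum_add_distrib,
    Finset.sum_comm]
  rfl

theorem kap_comm (A B : Fin 6 → F) : kap A B = kap B A :=
  cnt_congr fun P => by rw [and_comm (a := app A P = 0)]

theorem phi_comm (A B : Fin 6 → F) : phi A B = phi B A :=
  cnt_congr fun P => by rw [and_comm (a := ∃ m : Fin 3 → F, A = prodForm P m)]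

theorem ff_eq_mul (h2 : (2 : F) ≠ 0) {A B : Fin 6 → F} (hAB : ¬ (A = 0 ∧ B = 0)) :
    ff A B = kap A B * phi A B := by
  rw [mul_comm, kap, phi, cnt, cnt, Finset.sum_mul_sum, ff]
  refine Finset.sum_congr rfl fun l _ => Finset.sum_congr rfl fun P _ => ?_
  rw [← ind_and]
  refine congrArg ind (propext ?_)
  by_cases hl : l = 0
  · simp [hl]
  have h := flag_iff h2 hAB (P := P) hl
  exact ⟨fun k => ⟨⟨k.1, (h.1 k.2.2).2⟩, k.2.1, (h.1 k.2.2).1⟩,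
    fun k => ⟨k.1.1, k.2.1, h.2 ⟨k.2.2, k.1.2⟩⟩⟩

theorem kap_zero : kap (0 : Fin 6 → F) 0 = ord F ^ 3 - 1 := by
  rw [← cnt_ne_zero]
  exact cnt_congr fun P => by simp [app_zero_form]

theorem phi_zero : phi (0 : Fin 6 → F) 0 = ord F ^ 3 - 1 := by
  rw [← cnt_ne_zero]
  exact cnt_congr fun P =>
    ⟨fun h => h.1, fun h => ⟨h, ⟨0, (prodForm_zero P).symm⟩, 0, (prodForm_zero P).symm⟩⟩

theorem sum_cnt_flag :
    ∑ l : Fin 3 → F, cnt (fun P : Fin 3 → F => l ≠ 0 ∧ P ≠ 0 ∧ l ⬝ᵥ P = 0) =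
      (ord F ^ 3 - 1) * (ord F ^ 2 - 1) := by
  rw [← cnt_ne_zero, cnt, Finset.sum_mul]
  refine Finset.sum_congr rfl fun l _ => ?_
  by_cases hl : l = 0
  · simp [hl, cnt, ind]
  · rw [← cnt_ne_zero_and_dotProduct hl, ind_of hl, one_mul]
    exact cnt_congr fun P => by rw [dotProduct_comm]; simp [hl]

theorem ff_zero : ff (0 : Fin 6 → F) 0 = (ord F ^ 3 - 1) * (ord F ^ 2 - 1) := by
  rw [← sum_cnt_flag]
  refine Finset.sum_congr rfl fun l _ => cnt_congr fun P =>
    ⟨fun h => ⟨h.1, h.2.1, h.2.2.1⟩, fun h => ⟨h.1, h.2.1, h.2.2, ?_⟩⟩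
  exact ⟨⟨0, by simp, (prodForm_zero l).symm⟩, 0, by simp, (prodForm_zero l).symm⟩

theorem gg_zero : gg (0 : Fin 6 → F) 0 = (ord F ^ 3 - 1) * (ord F ^ 2 - 1) := by
  rw [← sum_cnt_flag]
  exact Finset.sum_congr rfl fun l _ => cnt_congr fun P => by simp [bil_zero_form]

theorem kap_eq_zero {A B : Fin 6 → F} (h : ¬ (Dbl A B ∧ Dbl B A)) : kap A B = 0 := by
  refine cnt_eq_zero ?_
  rintro P ⟨hP, hA, hB⟩
  exact h ⟨Dbl.of_point hP hA (by rw [bil_eq_dotProduct, hB, dotProduct_zero]),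
    Dbl.of_point hP hB (by rw [bil_eq_dotProduct, hA, dotProduct_zero])⟩

theorem phi_eq_zero {A B : Fin 6 → F} (h : ¬ (Dbl A B ∧ Dbl B A)) : phi A B = 0 := by
  refine cnt_eq_zero ?_
  rintro l ⟨-, ⟨m, rfl⟩, m', rfl⟩
  exact h ⟨Dbl.of_common_line, Dbl.of_common_line⟩

theorem phi_eq_of_no_vertex (h2 : (2 : F) ≠ 0) {A B : Fin 6 → F} (hA : Dbl A B) (hB : Dbl B A)
    (hk : ∀ P : Fin 3 → F, P ≠ 0 → app A P = 0 → app B P ≠ 0) (hadj : adj3 A ≠ 0) :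
    phi A B = ord F - 1 := by
  obtain ⟨b, m, m', hb, hm, hm'⟩ := exists_common_line h2 hA hB hk hadj
  refine cnt_smul hb fun l => ⟨?_, ?_⟩
  · rintro ⟨hl, ⟨n, hn⟩, n', hn'⟩
    refine ⟨hl, cross_eq_zero hb ?_⟩
    by_contra hx
    refine hk _ hx ?_ ?_
    · rw [hm]; exact app_cross_eq_zero (hm.symm.trans hn) hx
    · rw [hm']; exact app_cross_eq_zero (hm'.symm.trans hn') hx
  · rintro ⟨hl, c, rfl⟩
    have hc : c ≠ 0 := by rintro rfl; exact hl (by simp)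
    exact ⟨hl, ⟨c⁻¹ • m, by rw [hm, prodForm_smul_left hc]⟩, c⁻¹ • m',
      by rw [hm', prodForm_smul_left hc]⟩

theorem phi_eq_of_two_vertices (h2 : (2 : F) ≠ 0) {A B : Fin 6 → F} (hAB : ¬ (A = 0 ∧ B = 0))
    {P Q : Fin 3 → F} (hP : app A P = 0 ∧ app B P = 0) (hQ : app A Q = 0 ∧ app B Q = 0)
    (hx : cross P Q ≠ 0) : phi A B = ord F - 1 := by
  obtain ⟨a, ha⟩ := eq_smul_sqForm_cross hP.1 hQ.1 hx
  obtain ⟨b, hb⟩ := eq_smul_sqForm_cross hP.2 hQ.2 hx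
  refine cnt_smul hx fun l => ⟨?_, ?_⟩
  · rintro ⟨hl, ⟨n, hn⟩, n', hn'⟩
    refine ⟨hl, ?_⟩
    by_cases ha0 : a = 0
    · by_cases hb0 : b = 0
      · exact absurd ⟨by rw [ha, ha0, zero_smul], by rw [hb, hb0, zero_smul]⟩ hAB
      · exact exists_smul_of_smul_sqForm_eq_prodForm hb0 hx hl (hb.symm.trans hn')
    · exact exists_smul_of_smul_sqForm_eq_prodForm ha0 hx hl (ha.symm.trans hn)
  · rintro ⟨hl, c, rfl⟩
    have hc : c ≠ 0 := by rintro rfl; exact hl (by simp)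
    exact ⟨hl, ⟨c⁻¹ • ((a / 2) • cross P Q),
        by rw [prodForm_smul_left hc, ← smul_sqForm_eq_prodForm h2, ← ha]⟩,
      c⁻¹ • ((b / 2) • cross P Q),
        by rw [prodForm_smul_left hc, ← smul_sqForm_eq_prodForm h2, ← hb]⟩

theorem kap_or_phi_eq (h2 : (2 : F) ≠ 0) {A B : Fin 6 → F} (hAB : ¬ (A = 0 ∧ B = 0))
    (hA : Dbl A B) (hB : Dbl B A) : kap A B = ord F - 1 ∨ phi A B = ord F - 1 := by
  by_cases hk : ∃ P : Fin 3 → F, P ≠ 0 ∧ app A P = 0 ∧ app B P = 0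
  · obtain ⟨P, hP, hAP⟩ := hk
    by_cases hQ : ∃ Q : Fin 3 → F, (app A Q = 0 ∧ app B Q = 0) ∧ cross P Q ≠ 0
    · obtain ⟨Q, hQ, hx⟩ := hQ
      exact Or.inr (phi_eq_of_two_vertices h2 hAB hAP hQ hx)
    · push Not at hQ
      refine Or.inl (cnt_smul hP fun Q => ⟨fun h => ⟨h.1, cross_eq_zero hP (hQ Q h.2)⟩, ?_⟩)
      rintro ⟨h0, c, rfl⟩
      exact ⟨h0, by rw [app_smul, hAP.1, smul_zero], by rw [app_smul, hAP.2, smul_zero]⟩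
  · right
    by_cases h : adj3 A = 0
    · by_cases h' : adj3 B = 0
      · exact absurd (exists_common_vertex_of_adj3_eq_zero h h') hk
      · rw [phi_comm]
        exact phi_eq_of_no_vertex h2 hB hA (fun P hP h1 h3 => hk ⟨P, hP, h3, h1⟩) h'
    · exact phi_eq_of_no_vertex h2 hA hB (fun P hP h1 h3 => hk ⟨P, hP, h1, h3⟩) h

theorem nul_eq (h2 : (2 : F) ≠ 0) (A B : Fin 6 → F) :
    (ord F - 1) ^ 2 * nul A B = (ord F - 1) * (kap A B + phi A B) - ff A B +
      (ord F - 1) ^ 2 * ord F ^ 3 * ind (A = 0 ∧ B = 0) := by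
  by_cases hAB : A = 0 ∧ B = 0
  · obtain ⟨rfl, rfl⟩ := hAB
    have : Dbl (0 : Fin 6 → F) 0 := Dbl.of_adj3_eq_zero (by apply ext6 <;> simp [adj3]) 0
    rw [nul, ind_of ⟨this, this⟩, ind_of ⟨rfl, rfl⟩, kap_zero, phi_zero, ff_zero]
    ring
  · rw [ind_not hAB, ff_eq_mul h2 hAB, nul]
    by_cases hD : Dbl A B ∧ Dbl B A
    · rw [ind_of hD]
      rcases kap_or_phi_eq h2 hAB hD.1 hD.2 with h | h <;> rw [h] <;> ring
    · rw [ind_not hD, kap_eq_zero hD, phi_eq_zero hD]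
      ring

/-- The indicator of singular pencils in terms of counting functions. -/
theorem sing_eq (h2 : (2 : F) ≠ 0) (A B : Fin 6 → F) :
    (ord F - 1) ^ 2 * sing A B = gg A B + (ord F - 1) * dPencil A B -
      ord F * (ord F - 1) * (kap A B + phi A B) + ord F * ff A B -
        ord F ^ 4 * (ord F - 1) ^ 2 * ind (A = 0 ∧ B = 0) := by
  have h1 := sum_ite_dbl h2 A B
  have h3 : ∑ t : F, nPt (A + t • B) B + nPt B A + dPencil A B =
      (ord F - 1) * (∑ t : F, ind (Dbl (A + t • B) B) + ind (Dbl B A)) := by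
    rw [dPencil, mul_add, Finset.mul_sum, ← nPt_add_dPt B A,
      ← Finset.sum_congr rfl fun t _ => nPt_add_dPt (A + t • B) B, Finset.sum_add_distrib]
    ring
  rw [h1] at h3
  have h4 := nul_eq h2 A B
  have h5 := gg_eq A B
  linear_combination (-1 : ℂ) * h5 - (ord F - 1) * h3 - ord F * h4

/-! ### Fourier transforms -/

section Fourier

variable {ψ : AddChar F ℂ}

/-- Orthogonality of characters on a subspace cut out by `p`. -/
theorem sum_ind_mul_char (hψ : ψ.IsPrimitive) {V : Type*} [AddCommGroup V] [Module F V] [Fintype V]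
    {p : V → Prop} (padd : ∀ v w, p v → p w → p (v + w)) (psmul : ∀ (c : F) v, p v → p (c • v))
    {f : V → F} (fadd : ∀ v w, f (v + w) = f v + f w) (fsmul : ∀ (c : F) v, f (c • v) = c * f v) :
    ∑ v, ind (p v) * ψ (f v) = cnt p * ind (∀ v, p v → f v = 0) := by
  by_cases h : ∀ v, p v → f v = 0
  · rw [ind_of h, mul_one]
    refine Finset.sum_congr rfl fun v _ => ?_
    by_cases hv : p v
    · rw [h v hv, AddChar.map_zero_eq_one, mul_one]
    · rw [ind_not hv, zero_mul]
  · rw [ind_not h, mul_zero]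
    push Not at h
    obtain ⟨v₀, hp, hf⟩ := h
    obtain ⟨c, hc⟩ : ∃ c, ψ (f v₀ * c) ≠ 1 := by
      by_contra! hall
      exact hψ hf (DFunLike.ext _ _ fun c => by simpa using hall c)
    have hw : p (c • v₀) := psmul c v₀ hp
    have hp' : ∀ v, p (v + c • v₀) ↔ p v := fun v => by
      refine ⟨fun hv => ?_, fun hv => padd _ _ hv hw⟩
      simpa [add_assoc] using padd _ _ hv (psmul (-1) _ hw)
    have key : ∑ v, ind (p v) * ψ (f v) = ψ (f v₀ * c) * ∑ v, ind (p v) * ψ (f v) := by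
      rw [Finset.mul_sum]
      refine (Equiv.sum_comp (Equiv.addRight (c • v₀)) _).symm.trans ?_
      refine Finset.sum_congr rfl fun v _ => ?_
      simp only [Equiv.coe_addRight, hp', fadd, fsmul, AddChar.map_add_eq_mul]
      rw [mul_comm c]
      ring
    have : (ψ (f v₀ * c) - 1) * ∑ v, ind (p v) * ψ (f v) = 0 := by
      rw [sub_mul, one_mul, ← key, sub_self]
    simpa [sub_ne_zero.2 hc] using this

theorem sum_char_mul (hψ : ψ.IsPrimitive) (a : F) :
    ∑ c : F, ψ (c * a) = ord F * ind (a = 0) := by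
  have := sum_ind_mul_char hψ (V := F) (p := fun _ => True) (fun _ _ _ _ => trivial)
    (fun _ _ _ => trivial) (f := fun c => c * a) (fun _ _ => add_mul _ _ _)
    (fun _ _ => by simp [mul_assoc])
  simp only [ind_of trivial, one_mul, forall_true_left, cnt_true] at this
  rw [this, ord]
  congr 2
  exact propext ⟨fun h => by simpa using h 1, fun h => by simp [h]⟩

theorem sum_ind_ne_zero_mul_char (hψ : ψ.IsPrimitive) (a : F) :
    ∑ c : F, ind (c ≠ 0) * ψ (c * a) = ord F * ind (a = 0) - 1 := by
  rw [← sum_char_mul hψ, ← Finset.add_sum_erase _ _ (Finset.mem_univ (0 : F)),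
    ← Finset.add_sum_erase _ (fun c => ψ (c * a)) (Finset.mem_univ (0 : F))]
  simp only [ne_eq, not_true_eq_false, zero_mul, AddChar.map_zero_eq_one, add_sub_cancel_left]
  rw [ind_not not_false, zero_mul, zero_add]
  refine Finset.sum_congr rfl fun c hc => ?_
  rw [ind_of (Finset.ne_of_mem_erase hc), one_mul]

omit [Fintype F] in
theorem pairing_add_left (A B C : Fin 6 → F) : pairing (A + B) C = pairing A C + pairing B C := by
  simp [pairing]; ring

omit [Fintype F] in
theorem pairing_nondegenerate (h2 : (2 : F) ≠ 0) {C : Fin 6 → F} (h : ∀ A, pairing A C = 0) :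
    C = 0 := by
  have h' := fun i : Fin 6 => h (Pi.single i 1)
  have e0 := h' 0
  have e1 := h' 1
  have e2 := h' 2
  have e3 := h' 3
  have e4 := h' 4
  have e5 := h' 5
  simp [pairing, h2] at e0 e1 e2 e3 e4 e5
  exact ext6 e0 e1 e2 e3 e4 e5

theorem sum_char_pairing (h2 : (2 : F) ≠ 0) (hψ : ψ.IsPrimitive) (C : Fin 6 → F) :
    ∑ A, ψ (pairing A C) = ord F ^ 6 * ind (C = 0) := by
  have := sum_ind_mul_char hψ (V := Fin 6 → F) (p := fun _ => True) (fun _ _ _ _ => trivial)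
    (fun _ _ _ => trivial) (f := fun A => pairing A C) (fun _ _ => pairing_add_left _ _ _)
    (fun _ _ => pairing_smul_left _ _ _)
  simp only [ind_of trivial, one_mul, forall_true_left, cnt_true] at this
  rw [this, ord]
  congr 1
  · simp
  · refine congrArg ind (propext ⟨pairing_nondegenerate h2, ?_⟩)
    rintro rfl A
    simp [pairing]

/-- The unnormalized Fourier transform on forms. -/
def four (ψ : AddChar F ℂ) (f : (Fin 6 → F) → ℂ) (C : Fin 6 → F) : ℂ :=
  ∑ A, f A * ψ (pairing A C)

/-- The unnormalized Fourier transform on pencils. -/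
def fourPair (ψ : AddChar F ℂ) (f : (Fin 6 → F) → (Fin 6 → F) → ℂ) (C D : Fin 6 → F) : ℂ :=
  ∑ A, ∑ B, f A B * ψ (pairing A C + pairing B D)

theorem fourPair_mul (f g : (Fin 6 → F) → ℂ) (C D : Fin 6 → F) :
    fourPair ψ (fun A B => f A * g B) C D = four ψ f C * four ψ g D := by
  rw [four, four, Finset.sum_mul_sum]
  refine Finset.sum_congr rfl fun A _ => Finset.sum_congr rfl fun B _ => ?_
  rw [AddChar.map_add_eq_mul]
  ring

theorem fourPair_add (f g : (Fin 6 → F) → (Fin 6 → F) → ℂ) (C D : Fin 6 → F) :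
    fourPair ψ (fun A B => f A B + g A B) C D = fourPair ψ f C D + fourPair ψ g C D := by
  simp only [fourPair, add_mul, Finset.sum_add_distrib]

theorem fourPair_const_mul (c : ℂ) (f : (Fin 6 → F) → (Fin 6 → F) → ℂ) (C D : Fin 6 → F) :
    fourPair ψ (fun A B => c * f A B) C D = c * fourPair ψ f C D := by
  simp only [fourPair, mul_assoc, Finset.mul_sum]

theorem fourPair_sum {ι : Type*} [Fintype ι] (f : ι → (Fin 6 → F) → (Fin 6 → F) → ℂ)
    (C D : Fin 6 → F) :
    fourPair ψ (fun A B => ∑ i, f i A B) C D = ∑ i, fourPair ψ (f i) C D := by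
  simp only [fourPair, Finset.sum_mul]
  exact (Finset.sum_congr rfl fun A _ => Finset.sum_comm).trans Finset.sum_comm

theorem fourPair_swap (f : (Fin 6 → F) → (Fin 6 → F) → ℂ) (C D : Fin 6 → F) :
    fourPair ψ (fun A B => f B A) C D = fourPair ψ f D C := by
  rw [fourPair, Finset.sum_comm]
  simp only [fourPair, add_comm]

theorem fourPair_shear (f : (Fin 6 → F) → (Fin 6 → F) → ℂ) (t : F) (C D : Fin 6 → F) :
    fourPair ψ (fun A B => f (A + t • B) B) C D = fourPair ψ f C (D + (-t) • C) := by
  rw [fourPair, Finset.sum_comm]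
  refine Eq.trans (Finset.sum_congr rfl fun B _ => ?_) Finset.sum_comm
  refine Eq.trans ?_ (Equiv.sum_comp (Equiv.addRight (t • B)) _)
  refine Finset.sum_congr rfl fun A _ => ?_
  simp only [Equiv.coe_addRight]
  congr 2
  simp [pairing]
  ring

theorem four_four (h2 : (2 : F) ≠ 0) (hψ : ψ.IsPrimitive) (f : (Fin 6 → F) → ℂ) (C : Fin 6 → F) :
    four ψ (four ψ f) C = ord F ^ 6 * f (-C) := by
  have h1 : ∀ A B : Fin 6 → F, pairing A B + pairing B C = pairing B (A + C) := fun A B => by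
    simp [pairing]; ring
  simp only [four, Finset.sum_mul, mul_assoc, ← AddChar.map_add_eq_mul, h1]
  rw [Finset.sum_comm]
  simp only [← Finset.mul_sum, sum_char_pairing h2 hψ, add_eq_zero_iff_eq_neg]
  rw [Finset.sum_eq_single (-C)]
  · rw [ind_of rfl]; ring
  · intro A _ hA
    rw [ind_not hA]; ring
  · simp

theorem four_const_mul (c : ℂ) (f : (Fin 6 → F) → ℂ) (C : Fin 6 → F) :
    four ψ (fun A => c * f A) C = c * four ψ f C := by
  simp only [four, mul_assoc, Finset.mul_sum]

section Line

variable (M : Submodule F (Fin 3 → F)) (l : Fin 3 → F)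

theorem four_exists_prodForm (h2 : (2 : F) ≠ 0) (hψ : ψ.IsPrimitive) (hl : l ≠ 0)
    (C : Fin 6 → F) : four ψ (fun A => ind (∃ m ∈ M, A = prodForm l m)) C =
      cnt (· ∈ M) * ind (∀ m ∈ M, bil C l m = 0) := by
  have h1 := sum_ind_mul_char hψ (V := Fin 3 → F) (p := (· ∈ M)) (fun _ _ => M.add_mem)
    (fun c _ => M.smul_mem c) (f := fun m => pairing (prodForm l m) C)
    (fun m n => by simp [pairing, prodForm]; ring) (fun c m => by simp [pairing, prodForm]; ring)
  have h3 : ∀ m : Fin 3 → F, pairing (prodForm l m) C = 0 ↔ bil C l m = 0 := fun m => by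
    rw [pairing_comm, pairing_prodForm]; simp [h2]
  simp only [h3] at h1
  rw [← h1]
  have h4 : ∀ A : Fin 6 → F, ind (∃ m ∈ M, A = prodForm l m) =
      ∑ m : Fin 3 → F, ind (m ∈ M) * ind (A = prodForm l m) := fun A => by
    by_cases h : ∃ m ∈ M, A = prodForm l m
    · obtain ⟨m, hm, hA⟩ := h
      rw [ind_of ⟨m, hm, hA⟩, Finset.sum_eq_single m, ind_of hm, ind_of hA, mul_one]
      · intro n _ hn
        rw [ind_not (p := A = _), mul_zero]
        rintro rfl
        exact hn (prodForm_injective h2 hl hA)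
      · simp
    · rw [ind_not h, Finset.sum_eq_zero]
      intro m _
      rw [← ind_and, ind_not]
      rintro ⟨h5, h6⟩
      exact h ⟨m, h5, h6⟩
  simp only [four, h4, Finset.sum_mul]
  rw [Finset.sum_comm]
  refine Finset.sum_congr rfl fun m _ => ?_
  rw [Finset.sum_eq_single (prodForm l m)]
  · rw [ind_of rfl, mul_one]
  · intro A _ hA
    rw [ind_not hA]; ring
  · simp

theorem four_forall_bil (h2 : (2 : F) ≠ 0) (hψ : ψ.IsPrimitive) (hl : l ≠ 0)
    (C : Fin 6 → F) : cnt (· ∈ M) * four ψ (fun A => ind (∀ m ∈ M, bil A l m = 0)) C =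
      ord F ^ 6 * ind (∃ m ∈ M, C = prodForm l m) := by
  rw [← four_const_mul, ← funext fun A => four_exists_prodForm M l h2 hψ hl A]
  refine (four_four h2 hψ (fun A => ind (∃ m ∈ M, A = prodForm l m)) C).trans ?_
  congr 2
  refine propext ⟨?_, ?_⟩
  · rintro ⟨m, hm, h⟩
    refine ⟨-m, M.neg_mem hm, ?_⟩
    rw [← neg_neg C, h]
    apply ext6 <;> simp [prodForm] <;> ring
  · rintro ⟨m, hm, rfl⟩
    refine ⟨-m, M.neg_mem hm, ?_⟩
    apply ext6 <;> simp [prodForm] <;> ring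

end Line

omit [Field F] in
theorem cnt_true_vec : cnt (fun _ : Fin 3 → F => True) = ord F ^ 3 := by
  simp [cnt_true, ord]

theorem fourPair_phi (h2 : (2 : F) ≠ 0) (hψ : ψ.IsPrimitive) (C D : Fin 6 → F) :
    fourPair ψ phi C D = ord F ^ 6 * kap C D := by
  unfold phi kap cnt
  simp only [fourPair_sum, ind_and, fourPair_const_mul, fourPair_mul, Finset.mul_sum]
  refine Finset.sum_congr rfl fun l _ => ?_
  by_cases hl : l = 0
  · simp [ind, hl]
  have h := four_exists_prodForm (ψ := ψ) ⊤ l h2 hψ hl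
  have h0 : ∀ A : Fin 6 → F, (∀ m : Fin 3 → F, bil A l m = 0) ↔ app A l = 0 := fun A => by
    simp only [bil_eq_dotProduct]
    exact ⟨fun h => dotProduct_eq_zero _ (fun v => by rw [dotProduct_comm]; exact h v),
      fun h m => by rw [h, dotProduct_zero]⟩
  simp only [Submodule.mem_top, cnt_true_vec, true_and, forall_true_left, h0] at h
  rw [h, h]
  ring

theorem fourPair_kap (h2 : (2 : F) ≠ 0) (hψ : ψ.IsPrimitive) (C D : Fin 6 → F) :
    fourPair ψ kap C D = ord F ^ 6 * phi C D := by
  unfold phi kap cnt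
  simp only [fourPair_sum, ind_and, fourPair_const_mul, fourPair_mul, Finset.mul_sum]
  refine Finset.sum_congr rfl fun l _ => ?_
  by_cases hl : l = 0
  · simp [ind, hl]
  have h := four_forall_bil (ψ := ψ) ⊤ l h2 hψ hl
  have h0 : ∀ A : Fin 6 → F, (∀ m : Fin 3 → F, bil A l m = 0) ↔ app A l = 0 := fun A => by
    simp only [bil_eq_dotProduct]
    exact ⟨fun h => dotProduct_eq_zero _ (fun v => by rw [dotProduct_comm]; exact h v),
      fun h m => by rw [h, dotProduct_zero]⟩
  simp only [Submodule.mem_top, cnt_true_vec, true_and, forall_true_left, h0] at h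
  have h' : ∀ A, four ψ (fun A => ind (app A l = 0)) A =
      ord F ^ 3 * ind (∃ m : Fin 3 → F, A = prodForm l m) := fun A =>
    mul_left_cancel₀ (pow_ne_zero 3 (ord_ne_zero (F := F))) (by rw [h]; ring)
  rw [h', h']
  ring

/-- The plane orthogonal to a vector. -/
def perp (P : Fin 3 → F) : Submodule F (Fin 3 → F) where
  carrier := {m | m ⬝ᵥ P = 0}
  zero_mem' := zero_dotProduct P
  add_mem' {a b} ha hb := by simp_all [add_dotProduct]
  smul_mem' c a ha := by simp_all [smul_dotProduct]

omit [Fintype F] in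
theorem mem_perp {P m : Fin 3 → F} : m ∈ perp P ↔ m ⬝ᵥ P = 0 := Iff.rfl

theorem fourPair_ff (h2 : (2 : F) ≠ 0) (hψ : ψ.IsPrimitive) (C D : Fin 6 → F) :
    fourPair ψ ff C D = ord F ^ 4 * gg C D := by
  unfold ff gg cnt
  simp only [fourPair_sum, ind_and, fourPair_const_mul, fourPair_mul, Finset.mul_sum]
  refine Finset.sum_congr rfl fun l _ => Finset.sum_congr rfl fun P _ => ?_
  by_cases hl : l = 0
  · simp [ind, hl]
  by_cases hP : P = 0
  · simp [ind, hP]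
  have h := four_exists_prodForm (ψ := ψ) (perp P) l h2 hψ hl
  simp only [mem_perp, cnt_dotProduct_eq_zero hP] at h
  rw [h, h]
  ring

theorem fourPair_gg (h2 : (2 : F) ≠ 0) (hψ : ψ.IsPrimitive) (C D : Fin 6 → F) :
    fourPair ψ gg C D = ord F ^ 8 * ff C D := by
  unfold ff gg cnt
  simp only [fourPair_sum, ind_and, fourPair_const_mul, fourPair_mul, Finset.mul_sum]
  refine Finset.sum_congr rfl fun l _ => Finset.sum_congr rfl fun P _ => ?_
  by_cases hl : l = 0
  · simp [ind, hl]
  by_cases hP : P = 0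
  · simp [ind, hP]
  have h := four_forall_bil (ψ := ψ) (perp P) l h2 hψ hl
  simp only [mem_perp, cnt_dotProduct_eq_zero hP] at h
  have h' : ∀ A, four ψ (fun A => ind (∀ m : Fin 3 → F, m ⬝ᵥ P = 0 → bil A l m = 0)) A =
      ord F ^ 4 * ind (∃ m : Fin 3 → F, m ⬝ᵥ P = 0 ∧ A = prodForm l m) := fun A =>
    mul_left_cancel₀ (pow_ne_zero 2 (ord_ne_zero (F := F))) (by rw [h]; ring)
  rw [h', h']
  ring

end Fourier

section Fourier

variable {ψ : AddChar F ℂ}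

omit [Fintype F] in
theorem smul_sqForm_ne_zero {c : F} {m : Fin 3 → F} (hc : c ≠ 0) (hm : m ≠ 0) :
    c • sqForm m ≠ 0 := smul_ne_zero hc (sqForm_ne_zero hm)

theorem sum_sum_smul_sqForm (A : Fin 6 → F) :
    ∑ m : Fin 3 → F, ∑ c : F, ind (m ≠ 0) * ind (c ≠ 0) * ind (A = c • sqForm m) =
      (ord F - 1) * ind (adj3 A = 0 ∧ A ≠ 0) := by
  by_cases h : adj3 A = 0 ∧ A ≠ 0
  · obtain ⟨c₀, n, hA⟩ := exists_eq_smul_sqForm h.1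
    have hc₀ : c₀ ≠ 0 := by rintro rfl; exact h.2 (by simpa using hA)
    have hn : n ≠ 0 := by
      rintro rfl
      exact h.2 (by rw [hA]; apply ext6 <;> simp [sqForm])
    rw [ind_of h, mul_one, ← cnt_smul hn (p := fun m => m ≠ 0 ∧ ∃ t : F, m = t • n)
      (fun _ => Iff.rfl), cnt]
    refine Finset.sum_congr rfl fun m _ => ?_
    by_cases hm : m ≠ 0 ∧ ∃ t : F, m = t • n
    · obtain ⟨hm0, t, rfl⟩ := hm
      have ht : t ≠ 0 := by rintro rfl; exact hm0 (by simp)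
      rw [ind_of (p := t • n ≠ 0 ∧ ∃ s : F, t • n = s • n) ⟨hm0, t, rfl⟩,
        Finset.sum_eq_single (c₀ / t ^ 2)]
      · rw [ind_of hm0, ind_of (div_ne_zero hc₀ (pow_ne_zero 2 ht)), ind_of]
        · ring
        · rw [hA, sqForm_smul, smul_smul, div_mul_cancel₀ _ (pow_ne_zero 2 ht)]
      · intro c _ hc
        rw [ind_not (p := A = _), mul_zero]
        intro hA'
        rw [hA, sqForm_smul, smul_smul] at hA'
        have := smul_left_injective F (sqForm_ne_zero hn) hA'
        exact hc (by rw [this, mul_div_cancel_right₀ _ (pow_ne_zero 2 ht)])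
      · simp
    · rw [ind_not hm, Finset.sum_eq_zero]
      intro c _
      rw [← ind_and, ← ind_and, ind_not]
      rintro ⟨⟨hm0, hc⟩, hA'⟩
      exact hm ⟨hm0, eq_smul_of_smul_sqForm_eq hn hc (hA.symm.trans hA')⟩
  · rw [ind_not h, mul_zero]
    refine Finset.sum_eq_zero fun m _ => Finset.sum_eq_zero fun c _ => ?_
    rw [← ind_and, ← ind_and, ind_not]
    rintro ⟨⟨hm, hc⟩, rfl⟩
    exact h ⟨adj3_smul_sqForm c m, smul_sqForm_ne_zero hc hm⟩

/-- Summation over forms of rank at most one. -/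
theorem sum_adj3_eq_zero (f : (Fin 6 → F) → ℂ) :
    (ord F - 1) * ∑ A, ind (adj3 A = 0) * f A = (ord F - 1) * f 0 +
      ∑ m : Fin 3 → F, ∑ c : F, ind (m ≠ 0) * ind (c ≠ 0) * f (c • sqForm m) := by
  have h1 : ∑ m : Fin 3 → F, ∑ c : F, ind (m ≠ 0) * ind (c ≠ 0) * f (c • sqForm m) =
      ∑ A, (ord F - 1) * ind (adj3 A = 0 ∧ A ≠ 0) * f A := by
    simp only [← sum_sum_smul_sqForm, Finset.sum_mul]
    refine Eq.trans ?_ Finset.sum_comm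
    refine Finset.sum_congr rfl fun m _ => ?_
    refine Eq.trans ?_ Finset.sum_comm
    refine Finset.sum_congr rfl fun c _ => ?_
    rw [Finset.sum_eq_single (c • sqForm m), ind_of (p := c • sqForm m = _) rfl, mul_one]
    · intro A _ hA
      rw [ind_not (p := A = _) hA, mul_zero, zero_mul]
    · simp
  have h0 : adj3 (0 : Fin 6 → F) = 0 := by apply ext6 <;> simp [adj3]
  rw [h1, ← Finset.add_sum_erase _ _ (Finset.mem_univ (0 : Fin 6 → F)),
    ← Finset.add_sum_erase _ (fun A => (ord F - 1) * ind (adj3 A = 0 ∧ A ≠ 0) * f A)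
      (Finset.mem_univ (0 : Fin 6 → F)), ind_of h0, ind_not (p := _ ∧ _) (by simp),
    one_mul, mul_zero, zero_mul, zero_add, mul_add, Finset.mul_sum]
  congr 1
  refine Finset.sum_congr rfl fun A hA => ?_
  rw [ind_and, ind_of (Finset.ne_of_mem_erase hA)]
  ring

/-- The transform of the rank at most one forms with vertex `P`. -/
theorem four_rank_one (hψ : ψ.IsPrimitive) (P : Fin 3 → F) (C : Fin 6 → F) :
    (ord F - 1) * four ψ (fun A => ind (adj3 A = 0) * ind (app A P = 0)) C = (ord F - 1) +
      ord F * cnt (fun m => m ≠ 0 ∧ m ⬝ᵥ P = 0 ∧ bil C m m = 0) -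
        cnt (fun m => m ≠ 0 ∧ m ⬝ᵥ P = 0) := by
  have h1 := sum_adj3_eq_zero (fun A => ind (app A P = 0) * ψ (pairing A C))
  simp only [← mul_assoc] at h1
  rw [four, h1, app_zero_form, ind_of rfl, mul_one, show pairing 0 C = 0 by simp [pairing],
    AddChar.map_zero_eq_one, mul_one, add_sub_assoc, cnt, cnt, Finset.mul_sum,
    ← Finset.sum_sub_distrib]
  congr 1
  refine Finset.sum_congr rfl fun m _ => ?_
  by_cases hm : m = 0
  · simp [ind, hm]
  have h3 : ∀ c : F, ind (m ≠ 0) * ind (c ≠ 0) * ind (app (c • sqForm m) P = 0) *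
      ψ (pairing (c • sqForm m) C) = ind (m ⬝ᵥ P = 0) * (ind (c ≠ 0) * ψ (c * bil C m m)) := by
    intro c
    rw [ind_of hm, pairing_smul_left, pairing_comm, pairing_sqForm, app_smul_sqForm]
    by_cases hc : c = 0
    · simp [ind, hc]
    · simp only [smul_eq_zero, hm, or_false, mul_eq_zero, hc, false_or]
      ring
  rw [Finset.sum_congr rfl fun c _ => h3 c, ← Finset.mul_sum, sum_ind_ne_zero_mul_char hψ]
  simp only [ind_and, ind_of hm]
  ring

theorem four_conic_through (h2 : (2 : F) ≠ 0) (hψ : ψ.IsPrimitive) {P : Fin 3 → F}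
    (D : Fin 6 → F) : four ψ (fun B => ind (bil B P P = 0)) D =
      ord F ^ 5 * cnt (fun t : F => D = t • sqForm P) := by
  have h1 : ∀ B : Fin 6 → F, ord F * (ind (bil B P P = 0) * ψ (pairing B D)) =
      ∑ t : F, ψ (pairing B (D + (-t) • sqForm P)) := by
    intro B
    rw [← mul_assoc, ← sum_char_mul hψ, Finset.sum_mul, ← Equiv.sum_comp (Equiv.neg F)]
    refine Finset.sum_congr rfl fun t _ => ?_
    rw [← AddChar.map_add_eq_mul, ← pairing_sqForm]
    congr 1
    simp [pairing]
    ring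
  refine mul_left_cancel₀ (ord_ne_zero (F := F)) ?_
  rw [four, Finset.mul_sum, Finset.sum_congr rfl fun B _ => h1 B, Finset.sum_comm]
  simp only [sum_char_pairing h2 hψ, ← Finset.mul_sum]
  have h3 : ∀ t : F, D + (-t) • sqForm P = 0 ↔ D = t • sqForm P := fun t => by
    rw [neg_smul, ← sub_eq_add_neg, sub_eq_zero]
  simp only [h3, cnt]
  ring

theorem fourPair_dPt_eq (h2 : (2 : F) ≠ 0) (hψ : ψ.IsPrimitive) (C D : Fin 6 → F) :
    fourPair ψ dPt C D =
      ord F ^ 6 * (ord F - 1) * four ψ (fun A => ind (adj3 A = 0) * ind (app A 0 = 0)) C *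
          ind (D = 0) -
        ord F ^ 5 * ∑ P : Fin 3 → F, ind (P ≠ 0) *
          four ψ (fun A => ind (adj3 A = 0) * ind (app A P = 0)) C *
            cnt (fun t : F => D = t • sqForm P) := by
  have h1 : dPt = fun A B : Fin 6 → F =>
      (ord F - 1) * (ind (adj3 A = 0) * ind (app A 0 = 0) * 1) +
        (-1) * ∑ P : Fin 3 → F, ind (P ≠ 0) *
          (ind (adj3 A = 0) * ind (app A P = 0) * ind (bil B P P = 0)) := by
    funext A B
    rw [dPt, nPt, cnt, ind_of (p := app A 0 = 0) (by apply ext3 <;> simp [app])]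
    by_cases h : adj3 A = 0
    · rw [if_pos h, ind_of h]
      simp only [ind_and, one_mul]
      ring
    · rw [if_neg h, ind_not h]
      simp
  have h3 : four ψ (fun _ => 1) D = ord F ^ 6 * ind (D = 0) := by
    rw [← sum_char_pairing h2 hψ, four]
    simp
  rw [h1]
  simp only [fourPair_add, fourPair_const_mul, fourPair_sum]
  simp only [fourPair_mul (fun A => ind (adj3 A = 0) * ind (app A _ = 0)), h3,
    four_conic_through h2 hψ, Finset.mul_sum]
  rw [sub_eq_add_neg (_ * _ * _ * _), ← Finset.sum_neg_distrib]
  congr 1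
  · ring
  · refine Finset.sum_congr rfl fun P _ => ?_
    ring

theorem dPt_zero (C : Fin 6 → F) :
    dPt 0 C = ord F - 1 - cnt fun m : Fin 3 → F => m ≠ 0 ∧ bil C m m = 0 := by
  rw [dPt, if_pos (by apply ext6 <;> simp [adj3]), nPt]
  congr 1
  exact cnt_congr fun m => by simp [app_zero_form]

theorem cnt_isotropic_pairs (C : Fin 6 → F) :
    ∑ P : Fin 3 → F, ind (P ≠ 0) * cnt (fun m => m ≠ 0 ∧ m ⬝ᵥ P = 0 ∧ bil C m m = 0) =
      (ord F ^ 2 - 1) * cnt fun m : Fin 3 → F => m ≠ 0 ∧ bil C m m = 0 := by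
  simp only [cnt, Finset.mul_sum]
  rw [Finset.sum_comm]
  refine Finset.sum_congr rfl fun m _ => ?_
  by_cases hm : m ≠ 0 ∧ bil C m m = 0
  · rw [ind_of hm, mul_one, ← cnt_ne_zero_and_dotProduct hm.1, cnt]
    refine Finset.sum_congr rfl fun P _ => ?_
    rw [← ind_and, dotProduct_comm]
    congr 1
    simp [hm.1, hm.2]
  · rw [ind_not hm, mul_zero]
    refine Finset.sum_eq_zero fun P _ => ?_
    rw [ind_not (p := m ≠ 0 ∧ m ⬝ᵥ P = 0 ∧ _) fun h => hm ⟨h.1, h.2.2⟩, mul_zero]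

theorem fourPair_dPt_zero (h2 : (2 : F) ≠ 0) (hψ : ψ.IsPrimitive) (C : Fin 6 → F) :
    fourPair ψ dPt C 0 = ord F ^ 6 * dPt 0 C := by
  have h0 := four_rank_one hψ 0 C
  simp only [dotProduct_zero, and_true, true_and, cnt_ne_zero] at h0
  have h1 : ∀ P : Fin 3 → F, P ≠ 0 → cnt (fun t : F => 0 = t • sqForm P) = 1 := fun P hP =>
    cnt_eq_one 0 fun t => by
      rw [eq_comm, smul_eq_zero, or_iff_left (sqForm_ne_zero hP)]
  have h3 : (ord F - 1) * ∑ P : Fin 3 → F, ind (P ≠ 0) *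
      four ψ (fun A => ind (adj3 A = 0) * ind (app A P = 0)) C *
        cnt (fun t : F => 0 = t • sqForm P) =
      ord F * ∑ P : Fin 3 → F, ind (P ≠ 0) *
        cnt (fun m => m ≠ 0 ∧ m ⬝ᵥ P = 0 ∧ bil C m m = 0) +
      (ord F - ord F ^ 2) * cnt (fun P : Fin 3 → F => P ≠ 0) := by
    rw [cnt, Finset.mul_sum, Finset.mul_sum, Finset.mul_sum, ← Finset.sum_add_distrib]
    refine Finset.sum_congr rfl fun P _ => ?_
    by_cases hP : P = 0
    · simp [ind, hP]
    · rw [h1 P hP, mul_one, mul_left_comm, four_rank_one hψ, cnt_ne_zero_and_dotProduct hP]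
      ring
  rw [cnt_isotropic_pairs, cnt_ne_zero] at h3
  refine mul_left_cancel₀ (ord_sub_one_ne_zero (F := F)) ?_
  rw [fourPair_dPt_eq h2 hψ, ind_of rfl, dPt_zero]
  linear_combination ord F ^ 6 * (ord F - 1) * h0 - ord F ^ 5 * h3

theorem fourPair_dPt_smul_sqForm (h2 : (2 : F) ≠ 0) (hψ : ψ.IsPrimitive) (C : Fin 6 → F)
    {t : F} {P : Fin 3 → F} (ht : t ≠ 0) (hP : P ≠ 0) :
    fourPair ψ dPt C (t • sqForm P) = ord F ^ 6 * dPt (t • sqForm P) C := by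
  have h1 : ∀ Q : Fin 3 → F, (ord F - 1) * (ind (Q ≠ 0) *
      four ψ (fun A => ind (adj3 A = 0) * ind (app A Q = 0)) C *
        cnt (fun s : F => t • sqForm P = s • sqForm Q)) =
      ind (Q ≠ 0 ∧ ∃ c : F, Q = c • P) * (ord F *
        cnt (fun m => m ≠ 0 ∧ m ⬝ᵥ P = 0 ∧ bil C m m = 0) + ord F - ord F ^ 2) := by
    intro Q
    by_cases hQ : Q ≠ 0 ∧ ∃ c : F, Q = c • P
    · obtain ⟨hQ0, c, rfl⟩ := hQ
      have hc : c ≠ 0 := by rintro rfl; simp at hQ0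
      have hone : cnt (fun s : F => t • sqForm P = s • sqForm (c • P)) = 1 := by
        refine cnt_eq_one (t / c ^ 2) fun s => ?_
        rw [sqForm_smul, smul_smul, (smul_left_injective F (sqForm_ne_zero hP)).eq_iff,
          eq_div_iff (pow_ne_zero 2 hc), eq_comm]
      rw [hone, mul_one, mul_left_comm, four_rank_one hψ, cnt_ne_zero_and_dotProduct hQ0,
        ind_of hQ0, ind_of (p := c • P ≠ 0 ∧ ∃ s : F, c • P = s • P) ⟨hQ0, c, rfl⟩]
      simp only [dotProduct_smul, smul_eq_mul, mul_eq_zero, hc, false_or]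
      ring
    · rw [ind_not hQ, zero_mul]
      by_cases hQ0 : Q = 0
      · simp [ind, hQ0]
      · rw [cnt_eq_zero, mul_zero, mul_zero]
        intro s hs
        have hs0 : s ≠ 0 := by
          rintro rfl
          rw [zero_smul] at hs
          exact smul_sqForm_ne_zero ht hP hs
        exact hQ ⟨hQ0, eq_smul_of_smul_sqForm_eq hP hs0 hs⟩
  have h3 : (ord F - 1) * ∑ Q : Fin 3 → F, ind (Q ≠ 0) *
      four ψ (fun A => ind (adj3 A = 0) * ind (app A Q = 0)) C *
        cnt (fun s : F => t • sqForm P = s • sqForm Q) = (ord F - 1) * (ord F *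
        cnt (fun m => m ≠ 0 ∧ m ⬝ᵥ P = 0 ∧ bil C m m = 0) + ord F - ord F ^ 2) := by
    rw [Finset.mul_sum, Finset.sum_congr rfl fun Q _ => h1 Q, ← Finset.sum_mul]
    congr 1
    exact cnt_smul hP fun _ => Iff.rfl
  have h4 : nPt (t • sqForm P) C = cnt fun m => m ≠ 0 ∧ m ⬝ᵥ P = 0 ∧ bil C m m = 0 := by
    refine cnt_congr fun m => ?_
    rw [app_smul_sqForm, smul_eq_zero, mul_eq_zero, or_iff_left hP, or_iff_right ht,
      dotProduct_comm]
  rw [fourPair_dPt_eq h2 hψ, ind_not (smul_sqForm_ne_zero ht hP), dPt,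
    if_pos (adj3_smul_sqForm t P), h4, mul_left_cancel₀ ord_sub_one_ne_zero h3]
  ring

theorem fourPair_dPt (h2 : (2 : F) ≠ 0) (hψ : ψ.IsPrimitive) (C D : Fin 6 → F) :
    fourPair ψ dPt C D = ord F ^ 6 * dPt D C := by
  by_cases hD : adj3 D = 0
  · obtain ⟨t, P, rfl⟩ := exists_eq_smul_sqForm hD
    by_cases h : t = 0 ∨ P = 0
    · have : t • sqForm P = 0 := by
        rcases h with rfl | rfl
        · simp
        · apply ext6 <;> simp [sqForm]
      rw [this, fourPair_dPt_zero h2 hψ]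
    · rw [not_or] at h
      exact fourPair_dPt_smul_sqForm h2 hψ C h.1 h.2
  · rw [fourPair_dPt_eq h2 hψ, dPt, if_neg hD, ind_not, Finset.sum_eq_zero]
    · ring
    · intro P _
      rw [cnt_eq_zero, mul_zero]
      rintro t rfl
      exact hD (adj3_smul_sqForm t P)
    · rintro rfl
      exact hD (by apply ext6 <;> simp [adj3])

theorem fourPair_dPencil (h2 : (2 : F) ≠ 0) (hψ : ψ.IsPrimitive) (C D : Fin 6 → F) :
    fourPair ψ dPencil C D = ord F ^ 6 * dPencil D C := by
  have h1 : dPencil = fun A B : Fin 6 → F => ∑ t : F, dPt (A + t • B) B + dPt B A := rfl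
  rw [h1, fourPair_add, fourPair_sum, fourPair_swap dPt]
  simp only [fourPair_shear dPt, fourPair_dPt h2 hψ, mul_add, Finset.mul_sum]
  congr 1
  exact Equiv.sum_comp (Equiv.neg F) fun t => ord F ^ 6 * dPt (D + t • C) C

theorem ff_comm (A B : Fin 6 → F) : ff A B = ff B A :=
  Finset.sum_congr rfl fun l _ => cnt_congr fun P => by
    rw [and_comm (a := ∃ m : Fin 3 → F, m ⬝ᵥ P = 0 ∧ A = prodForm l m)]

theorem gg_comm (A B : Fin 6 → F) : gg A B = gg B A :=
  Finset.sum_congr rfl fun l _ => cnt_congr fun P => by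
    rw [and_comm (a := ∀ m : Fin 3 → F, m ⬝ᵥ P = 0 → bil A l m = 0)]

omit [Fintype F] in
theorem sing_comm (A B : Fin 6 → F) : sing A B = sing B A := by
  unfold sing
  congr 2
  unfold discCubic
  ring

/-- The transform of the singular pencils. -/
theorem fourPair_sing (h2 : (2 : F) ≠ 0) (hψ : ψ.IsPrimitive) (C D : Fin 6 → F) :
    (ord F - 1) ^ 2 * fourPair ψ sing C D =
      ord F ^ 7 * (ord F - 1) * ff C D - ord F ^ 5 * (ord F - 1) * gg C D +
        (ord F - 1) ^ 2 * (ord F ^ 6 * sing C D + ord F ^ 10 * ind (C = 0 ∧ D = 0) -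
          ord F ^ 4) := by
  have h1 : fourPair ψ (fun A B => (ord F - 1) ^ 2 * sing A B) C D =
      fourPair ψ (fun A B => gg A B + (ord F - 1) * dPencil A B +
        (-(ord F * (ord F - 1))) * (kap A B + phi A B) + ord F * ff A B +
          (-(ord F ^ 4 * (ord F - 1) ^ 2)) * ind (A = 0 ∧ B = 0)) C D := by
    congr 1
    funext A B
    rw [sing_eq h2]
    ring
  have h3 : fourPair ψ (fun A B => ind (A = 0 ∧ B = 0)) C D = 1 := by
    simp only [ind_and, fourPair_mul]
    simp [four, ind, pairing]
  have h4 := sing_eq h2 D C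
  rw [gg_comm, kap_comm, phi_comm, ff_comm, sing_comm, and_comm] at h4
  simp only [fourPair_add, fourPair_const_mul, h3] at h1
  rw [fourPair_gg h2 hψ, fourPair_dPencil h2 hψ, fourPair_kap h2 hψ, fourPair_phi h2 hψ,
    fourPair_ff h2 hψ] at h1
  linear_combination h1 - ord F ^ 6 * h4

end Fourier

/-- The number of common points of two conics at which their tangent lines are dependent. -/
def tang (A B : Fin 6 → F) : ℂ :=
  cnt fun l : Fin 3 → F => l ≠ 0 ∧ bil A l l = 0 ∧ bil B l l = 0 ∧
    ∃ a b : F, ¬ (a = 0 ∧ b = 0) ∧ app (a • A + b • B) l = 0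

omit [Fintype F] in
theorem app_smul_form (A : Fin 6 → F) (a : F) (v : Fin 3 → F) : app (a • A) v = a • app A v := by
  apply ext3 <;> simp [app] <;> ring

theorem sum_pencil_point (A B : Fin 6 → F) (l : Fin 3 → F) :
    ∑ t : F, ind (l ≠ 0 ∧ app (A + t • B) l = 0 ∧ bil B l l = 0) +
      ind (l ≠ 0 ∧ app B l = 0 ∧ bil A l l = 0) =
    ord F * ind (l ≠ 0 ∧ app A l = 0 ∧ app B l = 0) +
      ind (l ≠ 0 ∧ bil A l l = 0 ∧ bil B l l = 0 ∧
        ∃ a b : F, ¬ (a = 0 ∧ b = 0) ∧ app (a • A + b • B) l = 0) := by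
  by_cases hl : l = 0
  · simp [ind, hl]
  simp only [ne_eq, hl, not_false_eq_true, true_and, app_add_smul, app_smul_form,
    bil_eq_dotProduct]
  generalize app A l = a
  generalize app B l = b
  by_cases hb : b = 0
  · subst hb
    have hdep : ∃ s t : F, ¬ (s = 0 ∧ t = 0) ∧ s • a = 0 := ⟨0, 1, by simp, by simp⟩
    simp only [smul_zero, add_zero, dotProduct_zero, and_true, true_and, hdep,
      Finset.sum_const, Finset.card_univ, nsmul_eq_mul]
    rfl
  rw [ind_not (p := b = 0 ∧ _) fun h => hb h.1, ind_not (p := a = 0 ∧ _) fun h => hb h.2,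
    mul_zero, zero_add, add_zero]
  by_cases ha : ∃ t : F, a + t • b = 0
  · obtain ⟨t, ht⟩ := ha
    obtain rfl : a = (-t) • b := by rw [neg_smul]; exact eq_neg_of_add_eq_zero_left ht
    have hdep : ∃ r s : F, ¬ (r = 0 ∧ s = 0) ∧ r • (-t) • b + s • b = 0 :=
      ⟨1, t, by simp, by simp⟩
    have hs : ∀ s : F, (-t) • b + s • b = 0 ↔ s = t := fun s => by
      rw [← add_smul, smul_eq_zero, or_iff_left hb, neg_add_eq_zero, eq_comm]
    simp only [hdep, hs, ind_and, dotProduct_smul, smul_eq_mul, mul_eq_zero]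
    rw [ind_of trivial, ← Finset.sum_mul]
    by_cases hb' : l ⬝ᵥ b = 0 <;> simp [hb', ind]
  · rw [ind_not, Finset.sum_eq_zero]
    · intro t _
      exact ind_not fun h => ha ⟨t, h.1⟩
    · rintro ⟨-, -, r, s, hrs, h⟩
      by_cases hr : r = 0
      · subst hr
        simp only [zero_smul, zero_add, smul_eq_zero, hb, or_false] at h
        exact hrs ⟨rfl, h⟩
      · refine ha ⟨s / r, ?_⟩
        have := congrArg (r⁻¹ • ·) h
        simpa [smul_smul, hr, div_eq_inv_mul] using this

theorem gg_eq_kap_add_tang (A B : Fin 6 → F) :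
    gg A B = (ord F - 1) * (ord F * kap A B + tang A B) := by
  rw [gg_eq]
  congr 1
  simp only [nPt, kap, tang, cnt, Finset.mul_sum]
  rw [Finset.sum_comm, ← Finset.sum_add_distrib, ← Finset.sum_add_distrib]
  exact Finset.sum_congr rfl fun l _ => sum_pencil_point A B l

theorem sing_eq_one_of_dbl (h2 : (2 : F) ≠ 0) {A B : Fin 6 → F}
    (h : (∃ t : F, Dbl (A + t • B) B) ∨ Dbl B A) : sing A B = 1 := by
  by_contra hs
  have h0 : sing A B = 0 := ind_not fun h => hs (ind_of h)
  have hn : nul A B = 0 := ind_not fun h => hs <| ind_of <| by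
    rw [h.1.1, h.1.2, h.2.1, h.2.2]
    simp [discCubic]
  have h1 := sum_ite_dbl h2 A B
  rw [h0, hn, mul_zero, add_zero] at h1
  have h3 : cnt (fun t : F => Dbl (A + t • B) B) + ind (Dbl B A) = 0 := h1
  rw [cnt_eq_card] at h3
  by_cases hB : Dbl B A
  · rw [ind_of hB] at h3
    exact Nat.cast_add_one_ne_zero _ h3
  · rw [ind_not hB, add_zero, ← cnt_eq_card, cnt_eq_zero_iff] at h3
    exact h.elim (fun ⟨t, ht⟩ => h3 t ht) hB

/-- The conic matrix of a quadratic form given by its coefficients. -/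
def half (s : Fin 6 → F) : Fin 6 → F := ![s 0, s 1 / 2, s 2 / 2, s 3, s 4 / 2, s 5]

/-- The inverse of `half`. -/
def double (s : Fin 6 → F) : Fin 6 → F := ![s 0, s 1 * 2, s 2 * 2, s 3, s 4 * 2, s 5]

omit [Fintype F] in
theorem double_half (h2 : (2 : F) ≠ 0) (s : Fin 6 → F) : double (half s) = s := by
  apply ext6 <;> simp [double, half, h2]

omit [Fintype F] in
theorem half_double (h2 : (2 : F) ≠ 0) (s : Fin 6 → F) : half (double s) = s := by
  apply ext6 <;> simp [double, half, h2]

/-- Quadratic forms are identified with conic matrices in odd characteristic. -/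
def halfEquiv (h2 : (2 : F) ≠ 0) : (Fin 6 → F) ≃ (Fin 6 → F) where
  toFun := half
  invFun := double
  left_inv := double_half h2
  right_inv := half_double h2

omit [Fintype F] in
theorem bformPT_eq (h2 : (2 : F) ≠ 0) (x y : (Fin 6 → F) × (Fin 6 → F)) :
    bformPT x y = pairing (half x.1) (half y.1) + pairing (half x.2) (half y.2) := by
  simp [bformPT, pairing, half]
  field_simp

omit [Fintype F] in
theorem resolventPT_eq (x : (Fin 6 → F) × (Fin 6 → F)) :
    resolventPT x = C (-4 * det3 (half x.1)) * X 0 ^ 3 +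
      C (-4 * pairing (adj3 (half x.1)) (half x.2)) * (X 0 ^ 2 * X 1) +
      C (-4 * pairing (adj3 (half x.2)) (half x.1)) * (X 0 * X 1 ^ 2) +
      C (-4 * det3 (half x.2)) * X 1 ^ 3 := by
  have h4 : (-4 : MvPolynomial (Fin 2) F) = C (-4) := by
    rw [map_neg, map_ofNat]
  have h2 : (C 2 : MvPolynomial (Fin 2) F) = 2 := map_ofNat _ _
  rw [resolventPT, h4]
  simp only [gram3, Matrix.det_fin_three, det3, adj3, pairing, half, map_mul, map_add, map_sub,
    map_pow, Matrix.of_apply, Matrix.cons_val, h2]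
  ring

omit [Fintype F] in
theorem coeff_binary_cubic (a b c d : F) (i j : ℕ) :
    coeff (Finsupp.single 0 i + Finsupp.single 1 j)
      (C a * X 0 ^ 3 + C b * (X 0 ^ 2 * X 1) + C c * (X 0 * X 1 ^ 2) + C d * X 1 ^ 3 :
        MvPolynomial (Fin 2) F) =
      a * (if i = 3 ∧ j = 0 then 1 else 0) + b * (if i = 2 ∧ j = 1 then 1 else 0) +
      c * (if i = 1 ∧ j = 2 then 1 else 0) + d * (if i = 0 ∧ j = 3 then 1 else 0) := by
  have h : ∀ k m : ℕ, (X 0 ^ k * X 1 ^ m : MvPolynomial (Fin 2) F) =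
      monomial (Finsupp.single 0 k + Finsupp.single 1 m) 1 := fun k m => by
    rw [X_pow_eq_monomial, X_pow_eq_monomial, monomial_mul, one_mul]
  have he : ∀ k m : ℕ, (Finsupp.single (0 : Fin 2) k + Finsupp.single 1 m =
      Finsupp.single 0 i + Finsupp.single 1 j) ↔ (i = k ∧ j = m) := by
    intro k m
    rw [Finsupp.ext_iff]
    simp [Fin.forall_fin_two, eq_comm]
  have h30 := h 3 0
  have h21 := h 2 1
  have h12 := h 1 2
  have h03 := h 0 3
  simp only [pow_zero, pow_one, mul_one, one_mul] at h30 h21 h12 h03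
  rw [h30, h21, h12, h03]
  simp only [coeff_add, coeff_C_mul, coeff_monomial, he]

omit [Fintype F] in
theorem DiscPT_eq (x : (Fin 6 → F) × (Fin 6 → F)) :
    DiscPT x = 256 * discCubic (det3 (half x.1)) (pairing (adj3 (half x.1)) (half x.2))
      (pairing (adj3 (half x.2)) (half x.1)) (det3 (half x.2)) := by
  have h30 := coeff_binary_cubic (F := F) (i := 3) (j := 0)
  have h03 := coeff_binary_cubic (F := F) (i := 0) (j := 3)
  simp only [Finsupp.single_zero, add_zero, zero_add] at h30 h03
  rw [DiscPT, resolventPT_eq, h30, h03, coeff_binary_cubic, coeff_binary_cubic]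
  norm_num
  unfold discCubic
  ring

omit [Fintype F] in
theorem ite_DiscPT (h2 : (2 : F) ≠ 0) (x : (Fin 6 → F) × (Fin 6 → F)) :
    (if DiscPT x = 0 then (1 : ℂ) else 0) = sing (half x.1) (half x.2) := by
  have h : (256 : F) ≠ 0 := by
    rw [show (256 : F) = 2 ^ 8 by norm_num]
    exact pow_ne_zero 8 h2
  rw [sing, ind, DiscPT_eq]
  simp only [mul_eq_zero, h, false_or]

/-- The standard additive character as a bundled character. -/
theorem exists_addChar_eq_psiF (p : ℕ) [Fact p.Prime] [CharP F p] :
    ∃ ψ : AddChar F ℂ, ψ.IsPrimitive ∧ ∀ t, psiF p F t = ψ t := by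
  let : Algebra (ZMod p) F := ZMod.algebra F p
  let ψ : AddChar F ℂ := (ZMod.stdAddChar (N := p)).compAddMonoidHom
    (Algebra.trace (ZMod p) F).toAddMonoidHom
  refine ⟨ψ, AddChar.IsPrimitive.of_ne_one ?_, fun t => ?_⟩
  · obtain rfl : p = ringChar F := (ringChar.eq F p).symm
    obtain ⟨a, ha⟩ := FiniteField.trace_to_zmod_nondegenerate F one_ne_zero
    rw [one_mul] at ha
    refine AddChar.ne_one_iff.2 ⟨a, fun h => ha (ZMod.injective_stdAddChar ?_)⟩
    rw [AddChar.map_zero_eq_one]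
    exact h
  · show _ = ((ZMod.toCircle (Algebra.trace (ZMod p) F t) : Circle) : ℂ)
    rw [ZMod.toCircle_apply, psiF]

/-- The Fourier transform of the singular pairs in terms of incidence counts. -/
theorem FTPT_eq (p : ℕ) [Fact p.Prime] [CharP F p] (h2 : (2 : F) ≠ 0)
    (y : (Fin 6 → F) × (Fin 6 → F)) :
    (ord F - 1) ^ 2 * FTPT p (fun x => if DiscPT x = 0 then 1 else 0) y =
      (ord F ^ 12)⁻¹ * (ord F ^ 7 * (ord F - 1) * ff (half y.1) (half y.2) -
        ord F ^ 5 * (ord F - 1) * gg (half y.1) (half y.2) +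
          (ord F - 1) ^ 2 * (ord F ^ 6 * sing (half y.1) (half y.2) +
            ord F ^ 10 * ind (half y.1 = 0 ∧ half y.2 = 0) - ord F ^ 4)) := by
  obtain ⟨ψ, hψ, h⟩ := exists_addChar_eq_psiF (F := F) p
  rw [← fourPair_sing h2 hψ, mul_left_comm, FTPT]
  congr 2
  simp only [ite_DiscPT h2, h, bformPT_eq h2]
  rw [fourPair, Fintype.sum_prod_type]
  refine Fintype.sum_equiv (halfEquiv h2) _ _ fun A => Fintype.sum_equiv (halfEquiv h2) _ _ fun B => ?_
  rfl

/-! ### Changes of variables -/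

section Pull

omit [Fintype F]

theorem eq_of_bil_self (h2 : (2 : F) ≠ 0) {A B : Fin 6 → F}
    (h : ∀ v : Fin 3 → F, bil A v v = bil B v v) : A = B := by
  have e0 := h ![1, 0, 0]
  have e1 := h ![0, 1, 0]
  have e2 := h ![0, 0, 1]
  have e01 := h ![1, 1, 0]
  have e02 := h ![1, 0, 1]
  have e12 := h ![0, 1, 1]
  simp [bil] at e0 e1 e2 e01 e02 e12
  refine ext6 e0 ?_ ?_ e1 ?_ e2 <;> refine mul_left_cancel₀ h2 ?_
  · linear_combination e01 - e0 - e1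
  · linear_combination e02 - e0 - e2
  · linear_combination e12 - e1 - e2

/-- The substitution `v ↦ N v` in a quadratic form. -/
def pull (N : Matrix (Fin 3) (Fin 3) F) (A : Fin 6 → F) : Fin 6 → F :=
  ![bil A (Nᵀ 0) (Nᵀ 0), bil A (Nᵀ 0) (Nᵀ 1), bil A (Nᵀ 0) (Nᵀ 2), bil A (Nᵀ 1) (Nᵀ 1),
    bil A (Nᵀ 1) (Nᵀ 2), bil A (Nᵀ 2) (Nᵀ 2)]

theorem bil_pull (N : Matrix (Fin 3) (Fin 3) F) (A : Fin 6 → F) (v w : Fin 3 → F) :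
    bil (pull N A) v w = bil A (N *ᵥ v) (N *ᵥ w) := by
  simp [pull, bil, mulVec, dotProduct, Fin.sum_univ_three]
  ring

theorem bil_smul_add_smul (a b : F) (A B : Fin 6 → F) (v w : Fin 3 → F) :
    bil (a • A + b • B) v w = a * bil A v w + b * bil B v w := by
  simp [bil]; ring

theorem app_pull (N : Matrix (Fin 3) (Fin 3) F) (A : Fin 6 → F) (v : Fin 3 → F) :
    app (pull N A) v = Nᵀ *ᵥ app A (N *ᵥ v) := by
  apply ext3 <;> simp [pull, bil, app, mulVec, dotProduct, Fin.sum_univ_three] <;> ring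

theorem pull_smul_add_smul (h2 : (2 : F) ≠ 0) (N : Matrix (Fin 3) (Fin 3) F) (a b : F)
    (A B : Fin 6 → F) : pull N (a • A + b • B) = a • pull N A + b • pull N B :=
  eq_of_bil_self h2 fun v => by simp only [bil_pull, bil_smul_add_smul]

theorem pull_pull (h2 : (2 : F) ≠ 0) {N N' : Matrix (Fin 3) (Fin 3) F} (h : N * N' = 1)
    (A : Fin 6 → F) : pull N' (pull N A) = A :=
  eq_of_bil_self h2 fun v => by simp only [bil_pull, mulVec_mulVec, h, one_mulVec]

theorem pull_prodForm (h2 : (2 : F) ≠ 0) (N : Matrix (Fin 3) (Fin 3) F) (l m : Fin 3 → F) :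
    pull N (prodForm l m) = prodForm (Nᵀ *ᵥ l) (Nᵀ *ᵥ m) :=
  eq_of_bil_self h2 fun v => by
    simp only [bil_pull, bil_prodForm, mulVec_transpose, dotProduct_comm _ (_ ᵥ* N),
      ← dotProduct_mulVec]
    simp only [dotProduct_comm]

theorem pull_smul_sqForm (h2 : (2 : F) ≠ 0) (N : Matrix (Fin 3) (Fin 3) F) (c : F)
    (m : Fin 3 → F) : pull N (c • sqForm m) = c • sqForm (Nᵀ *ᵥ m) :=
  eq_of_bil_self h2 fun v => by
    simp only [bil_pull, bil_smul_sqForm, mulVec_transpose, dotProduct_comm _ (_ ᵥ* N),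
      ← dotProduct_mulVec]
    simp only [dotProduct_comm]

/-- The bijection given by an invertible matrix. -/
def mulVecEquiv (N N' : Matrix (Fin 3) (Fin 3) F) (h : N * N' = 1) (h' : N' * N = 1) :
    (Fin 3 → F) ≃ (Fin 3 → F) where
  toFun v := N *ᵥ v
  invFun v := N' *ᵥ v
  left_inv v := by
    show N' *ᵥ N *ᵥ v = v
    rw [mulVec_mulVec, h', one_mulVec]
  right_inv v := by
    show N *ᵥ N' *ᵥ v = v
    rw [mulVec_mulVec, h, one_mulVec]

theorem mulVec_eq_zero_iff {N N' : Matrix (Fin 3) (Fin 3) F} (h' : N' * N = 1) {v : Fin 3 → F} :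
    N *ᵥ v = 0 ↔ v = 0 := by
  refine ⟨fun h => ?_, fun h => by rw [h, mulVec_zero]⟩
  rw [← one_mulVec v, ← h', ← mulVec_mulVec, h, mulVec_zero]

theorem transpose_mul_eq_one {N N' : Matrix (Fin 3) (Fin 3) F} (h : N * N' = 1) :
    N'ᵀ * Nᵀ = 1 := by
  rw [← transpose_mul, h, transpose_one]

end Pull

theorem cnt_comp_equiv {α β : Type*} [Fintype α] [Fintype β] (e : α ≃ β) {p : β → Prop}
    {r : α → Prop} (h : ∀ a, r a ↔ p (e a)) : cnt r = cnt p := by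
  rw [cnt, cnt, ← e.sum_comp]
  exact Finset.sum_congr rfl fun a _ => by rw [h]

section Invariance

variable {N N' : Matrix (Fin 3) (Fin 3) F} (h2 : (2 : F) ≠ 0) (h : N * N' = 1) (h' : N' * N = 1)

include h h'

theorem kap_pull (A B : Fin 6 → F) : kap (pull N A) (pull N B) = kap A B := by
  refine cnt_comp_equiv (mulVecEquiv N N' h h') fun v => ?_
  show _ ↔ N *ᵥ v ≠ 0 ∧ app A (N *ᵥ v) = 0 ∧ app B (N *ᵥ v) = 0
  rw [app_pull, app_pull, mulVec_eq_zero_iff (transpose_mul_eq_one h),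
    mulVec_eq_zero_iff (transpose_mul_eq_one h), ne_eq, ne_eq, mulVec_eq_zero_iff h']

include h2

theorem tang_pull (A B : Fin 6 → F) : tang (pull N A) (pull N B) = tang A B := by
  refine cnt_comp_equiv (mulVecEquiv N N' h h') fun v => ?_
  show _ ↔ N *ᵥ v ≠ 0 ∧ bil A (N *ᵥ v) (N *ᵥ v) = 0 ∧ bil B (N *ᵥ v) (N *ᵥ v) = 0 ∧
    ∃ a b : F, ¬ (a = 0 ∧ b = 0) ∧ app (a • A + b • B) (N *ᵥ v) = 0
  simp only [← pull_smul_add_smul h2, app_pull, bil_pull,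
    mulVec_eq_zero_iff (transpose_mul_eq_one h), ne_eq, mulVec_eq_zero_iff h']

omit [Fintype F] h' in
theorem exists_pull_eq_prodForm (A : Fin 6 → F) (l : Fin 3 → F) :
    (∃ m, pull N A = prodForm (Nᵀ *ᵥ l) m) ↔ ∃ m, A = prodForm l m := by
  constructor
  · rintro ⟨m, hm⟩
    refine ⟨N'ᵀ *ᵥ m, ?_⟩
    rw [← pull_pull h2 h A, hm, pull_prodForm h2, mulVec_mulVec, transpose_mul_eq_one h,
      one_mulVec]
  · rintro ⟨m, rfl⟩
    exact ⟨_, pull_prodForm h2 N l m⟩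

theorem phi_pull (A B : Fin 6 → F) : phi (pull N A) (pull N B) = phi A B := by
  symm
  refine cnt_comp_equiv (mulVecEquiv Nᵀ N'ᵀ (transpose_mul_eq_one h') (transpose_mul_eq_one h))
    fun l => ?_
  show _ ↔ Nᵀ *ᵥ l ≠ 0 ∧ (∃ m, pull N A = prodForm (Nᵀ *ᵥ l) m) ∧
    ∃ m, pull N B = prodForm (Nᵀ *ᵥ l) m
  rw [exists_pull_eq_prodForm h2 h, exists_pull_eq_prodForm h2 h, ne_eq, ne_eq,
    mulVec_eq_zero_iff (transpose_mul_eq_one h)]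

end Invariance

section Pencil

variable {α β γ δ : F} (hd : α * δ - β * γ ≠ 0)

include hd

omit [Fintype F] in
theorem forall_mem_pencil_iff {p : (Fin 6 → F) → Prop}
    (hp : ∀ (a b : F) (A B : Fin 6 → F), p A → p B → p (a • A + b • B)) (A B : Fin 6 → F) :
    p (α • A + β • B) ∧ p (γ • A + δ • B) ↔ p A ∧ p B := by
  refine ⟨fun ⟨h, h'⟩ => ?_, fun ⟨h, h'⟩ => ⟨hp _ _ _ _ h h', hp _ _ _ _ h h'⟩⟩
  constructor
  · convert hp (δ / (α * δ - β * γ)) (-β / (α * δ - β * γ)) _ _ h h' using 1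
    funext i
    simp only [Pi.add_apply, Pi.smul_apply, smul_eq_mul, div_eq_mul_inv]
    linear_combination -(A i) * mul_inv_cancel₀ hd
  · convert hp (-γ / (α * δ - β * γ)) (α / (α * δ - β * γ)) _ _ h h' using 1
    funext i
    simp only [Pi.add_apply, Pi.smul_apply, smul_eq_mul, div_eq_mul_inv]
    linear_combination -(B i) * mul_inv_cancel₀ hd

theorem kap_pencil (A B : Fin 6 → F) : kap (α • A + β • B) (γ • A + δ • B) = kap A B :=
  cnt_congr fun v => and_congr_right fun _ =>
    forall_mem_pencil_iff hd (p := fun A => app A v = 0) (fun a b A B hA hB => by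
      rw [app_add_smul, app_smul_form, hA, hB, smul_zero, smul_zero, add_zero]) A B

theorem phi_pencil (A B : Fin 6 → F) : phi (α • A + β • B) (γ • A + δ • B) = phi A B :=
  cnt_congr fun l => and_congr_right fun _ =>
    forall_mem_pencil_iff hd (p := fun A => ∃ m, A = prodForm l m) (by
      rintro a b _ _ ⟨m, rfl⟩ ⟨n, rfl⟩
      refine ⟨a • m + b • n, ?_⟩
      apply ext6 <;> simp [prodForm] <;> ring) A B

omit [Fintype F] in
theorem exists_mem_pencil_iff (p : (Fin 6 → F) → Prop) (A B : Fin 6 → F) :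
    (∃ a b : F, ¬ (a = 0 ∧ b = 0) ∧ p (a • (α • A + β • B) + b • (γ • A + δ • B))) ↔
      ∃ a b : F, ¬ (a = 0 ∧ b = 0) ∧ p (a • A + b • B) := by
  constructor
  · rintro ⟨a, b, hab, h⟩
    refine ⟨a * α + b * γ, a * β + b * δ, fun ⟨h1, h3⟩ => hab ⟨?_, ?_⟩, ?_⟩
    · refine (mul_eq_zero.1 (?_ : a * (α * δ - β * γ) = 0)).resolve_right hd
      linear_combination δ * h1 - γ * h3
    · refine (mul_eq_zero.1 (?_ : b * (α * δ - β * γ) = 0)).resolve_right hd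
      linear_combination α * h3 - β * h1
    · convert h using 1
      module
  · rintro ⟨a, b, hab, h⟩
    refine ⟨(a * δ - b * γ) / (α * δ - β * γ), (b * α - a * β) / (α * δ - β * γ),
      fun ⟨h1, h3⟩ => hab ?_, ?_⟩
    · rw [div_eq_zero_iff, or_iff_left hd] at h1 h3
      constructor
      · refine (mul_eq_zero.1 (?_ : a * (α * δ - β * γ) = 0)).resolve_right hd
        linear_combination α * h1 + γ * h3
      · refine (mul_eq_zero.1 (?_ : b * (α * δ - β * γ) = 0)).resolve_right hd
        linear_combination β * h1 + δ * h3
    · convert h using 1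
      funext i
      simp only [Pi.add_apply, Pi.smul_apply, smul_eq_mul, div_eq_mul_inv]
      linear_combination (a * A i + b * B i) * mul_inv_cancel₀ hd

theorem tang_pencil (A B : Fin 6 → F) : tang (α • A + β • B) (γ • A + δ • B) = tang A B :=
  cnt_congr fun l => and_congr_right fun _ => by
    rw [← and_assoc, ← and_assoc, exists_mem_pencil_iff hd (fun A => app A l = 0),
      forall_mem_pencil_iff hd (p := fun A => bil A l l = 0) (fun a b A B hA hB => by
        rw [bil_smul_add_smul, hA, hB, mul_zero, mul_zero, add_zero]) A B]

end Pencil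

omit [Fintype F] in
theorem Dbl.of_smul {A B : Fin 6 → F} {c : F} (hc : c ≠ 0) (h : Dbl (c • A) B) : Dbl A B := by
  obtain ⟨h1, h2⟩ := h
  have e1 : det3 (c • A) = c ^ 3 * det3 A := by simp [det3]; ring
  have e2 : pairing (adj3 (c • A)) B = c ^ 2 * pairing (adj3 A) B := by
    simp [pairing, adj3]; ring
  rw [e1] at h1
  rw [e2] at h2
  exact ⟨(mul_eq_zero.1 h1).resolve_left (pow_ne_zero 3 hc),
    (mul_eq_zero.1 h2).resolve_left (pow_ne_zero 2 hc)⟩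

theorem sing_eq_one_of_mem (h2 : (2 : F) ≠ 0) {A B : Fin 6 → F} {a b : F}
    (hab : ¬ (a = 0 ∧ b = 0)) (hA : Dbl (a • A + b • B) A) (hB : Dbl (a • A + b • B) B) :
    sing A B = 1 := by
  refine sing_eq_one_of_dbl h2 ?_
  by_cases ha : a = 0
  · subst ha
    rw [zero_smul, zero_add] at hA
    exact Or.inr (hA.of_smul fun hb => hab ⟨rfl, hb⟩)
  · refine Or.inl ⟨b / a, Dbl.of_smul ha ?_⟩
    rwa [smul_add, smul_smul, mul_div_cancel₀ _ ha]

theorem sing_eq_one_of_tang (h2 : (2 : F) ≠ 0) {A B : Fin 6 → F} (h : tang A B ≠ 0) :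
    sing A B = 1 := by
  rw [ne_eq, tang, cnt_eq_zero_iff] at h
  push Not at h
  obtain ⟨l, hl, hA, hB, a, b, hab, hE⟩ := h
  exact sing_eq_one_of_mem h2 (fun h => hab h.1 h.2) (Dbl.of_point hl hE hA)
    (Dbl.of_point hl hE hB)

/-! ### Orbits -/

/-- Equivalence of pencils of conics. -/
def Equivalent (A B C D : Fin 6 → F) : Prop :=
  ∃ (α β γ δ : F) (N N' : Matrix (Fin 3) (Fin 3) F), α * δ - β * γ ≠ 0 ∧ N * N' = 1 ∧
    N' * N = 1 ∧ C = α • pull N A + β • pull N B ∧ D = γ • pull N A + δ • pull N B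

omit [Fintype F] in
theorem eval_TQ (h2 : (2 : F) ≠ 0) (s : Fin 6 → F) (v : Fin 3 → F) :
    eval v (TQ s) = bil (half s) v v := by
  simp [TQ, bil, half]
  field_simp
  ring

omit [Fintype F] in
theorem eval_subst3 (g : Matrix (Fin 3) (Fin 3) F) (P : MvPolynomial (Fin 3) F) (v : Fin 3 → F) :
    eval v (subst3 g P) = eval (gᵀ *ᵥ v) P := by
  rw [subst3, ← MvPolynomial.coe_aeval_eq_eval, ← MvPolynomial.coe_aeval_eq_eval]
  show aeval v (aeval _ P) = aeval _ P
  rw [← AlgHom.comp_apply, comp_aeval]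
  congr 2
  funext j
  simp [mulVec, dotProduct]

omit [Fintype F] in
theorem equivalent_of_inOrbitPT (h2 : (2 : F) ≠ 0) {r y : (Fin 6 → F) × (Fin 6 → F)}
    (h : InOrbitPT r y) : Equivalent (half r.1) (half r.2) (half y.1) (half y.2) := by
  obtain ⟨g₁, g₂, hg⟩ := h
  rw [pairActT, Prod.mk.injEq] at hg
  refine ⟨g₁ 0 0, g₁ 0 1, g₁ 1 0, g₁ 1 1, (g₂ : Matrix (Fin 3) (Fin 3) F)ᵀ,
    ((g₂⁻¹ : Matrix.GeneralLinearGroup (Fin 3) F) : Matrix (Fin 3) (Fin 3) F)ᵀ, ?_, ?_, ?_, ?_, ?_⟩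
  · rw [← Matrix.det_fin_two]
    exact g₁.isUnit.map Matrix.detMonoidHom |>.ne_zero
  · exact transpose_mul_eq_one (Units.inv_mul g₂)
  · exact transpose_mul_eq_one (Units.mul_inv g₂)
  · refine eq_of_bil_self h2 fun v => ?_
    have := congrArg (eval v) hg.1
    simp only [map_add, map_mul, eval_C, eval_subst3, eval_TQ h2] at this
    rw [bil_smul_add_smul, bil_pull, bil_pull, ← this]
  · refine eq_of_bil_self h2 fun v => ?_
    have := congrArg (eval v) hg.2
    simp only [map_add, map_mul, eval_C, eval_subst3, eval_TQ h2] at this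
    rw [bil_smul_add_smul, bil_pull, bil_pull, ← this]

variable {A B C D : Fin 6 → F}

theorem Equivalent.kap_eq (h : Equivalent A B C D) : kap C D = kap A B := by
  obtain ⟨α, β, γ, δ, N, N', hd, h, h', rfl, rfl⟩ := h
  rw [kap_pencil hd, kap_pull h h']

theorem Equivalent.phi_eq (h2 : (2 : F) ≠ 0) (h : Equivalent A B C D) : phi C D = phi A B := by
  obtain ⟨α, β, γ, δ, N, N', hd, h, h', rfl, rfl⟩ := h
  rw [phi_pencil hd, phi_pull h2 h h']

theorem Equivalent.tang_eq (h2 : (2 : F) ≠ 0) (h : Equivalent A B C D) : tang C D = tang A B := by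
  obtain ⟨α, β, γ, δ, N, N', hd, h, h', rfl, rfl⟩ := h
  rw [tang_pencil hd, tang_pull h2 h h']

theorem Equivalent.sing_eq_one (h2 : (2 : F) ≠ 0) {c : F} {m : Fin 3 → F}
    (h : Equivalent (c • sqForm m) B C D) : sing C D = 1 := by
  obtain ⟨α, β, γ, δ, N, N', hd, h, h', rfl, rfl⟩ := h
  obtain ⟨a, b, hab, hE⟩ := (exists_mem_pencil_iff hd (fun E => adj3 E = 0)
    (pull N (c • sqForm m)) (pull N B)).2 ⟨1, 0, by simp, by
      rw [zero_smul, add_zero, one_smul, pull_smul_sqForm h2, adj3_smul_sqForm]⟩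
  exact sing_eq_one_of_mem h2 hab (Dbl.of_adj3_eq_zero hE _) (Dbl.of_adj3_eq_zero hE _)

/-! ### Counting vectors -/

theorem cnt_or {α : Type*} [Fintype α] (p r : α → Prop) :
    cnt (fun a => p a ∨ r a) = cnt p + cnt r - cnt fun a => p a ∧ r a := by
  rw [cnt, cnt, cnt, cnt, ← Finset.sum_add_distrib, ← Finset.sum_sub_distrib]
  refine Finset.sum_congr rfl fun a _ => ?_
  by_cases hp : p a <;> by_cases hr : r a <;> simp [ind, hp, hr]

theorem cnt_last_eq_zero : cnt (fun v : Fin 3 → F => v ≠ 0 ∧ v 2 = 0) = ord F ^ 2 - 1 := by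
  rw [← cnt_ne_zero_and_dotProduct (F := F) (b := ![0, 0, 1]) (by simp)]
  exact cnt_congr fun v => by simp [dotProduct, Fin.sum_univ_three]

theorem cnt_middle_eq_zero : cnt (fun v : Fin 3 → F => v ≠ 0 ∧ v 1 = 0) = ord F ^ 2 - 1 := by
  rw [← cnt_ne_zero_and_dotProduct (F := F) (b := ![0, 1, 0]) (by simp)]
  exact cnt_congr fun v => by simp [dotProduct, Fin.sum_univ_three]

theorem cnt_line {b : Fin 3 → F} (hb : b ≠ 0) {p : (Fin 3 → F) → Prop}
    (h : ∀ v, p v ↔ ∃ c : F, v = c • b) : cnt (fun v => v ≠ 0 ∧ p v) = ord F - 1 :=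
  cnt_smul hb fun v => by rw [h]

theorem cnt_first_axis :
    cnt (fun v : Fin 3 → F => v ≠ 0 ∧ v 1 = 0 ∧ v 2 = 0) = ord F - 1 :=
  cnt_line (b := ![1, 0, 0]) (by simp) fun v =>
    ⟨fun ⟨h1, h2⟩ => ⟨v 0, by apply ext3 <;> simp [h1, h2]⟩, by rintro ⟨c, rfl⟩; simp⟩

theorem cnt_middle_axis :
    cnt (fun v : Fin 3 → F => v ≠ 0 ∧ v 0 = 0 ∧ v 2 = 0) = ord F - 1 :=
  cnt_line (b := ![0, 1, 0]) (by simp) fun v =>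
    ⟨fun ⟨h1, h2⟩ => ⟨v 1, by apply ext3 <;> simp [h1, h2]⟩, by rintro ⟨c, rfl⟩; simp⟩

theorem cnt_last_axis :
    cnt (fun v : Fin 3 → F => v ≠ 0 ∧ v 0 = 0 ∧ v 1 = 0) = ord F - 1 :=
  cnt_line (b := ![0, 0, 1]) (by simp) fun v =>
    ⟨fun ⟨h1, h2⟩ => ⟨v 2, by apply ext3 <;> simp [h1, h2]⟩, by rintro ⟨c, rfl⟩; simp⟩

theorem cnt_two_planes :
    cnt (fun v : Fin 3 → F => v ≠ 0 ∧ (v 1 = 0 ∨ v 2 = 0)) =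
      2 * (ord F ^ 2 - 1) - (ord F - 1) := by
  rw [cnt_congr fun v => and_or_left, cnt_or, cnt_middle_eq_zero, cnt_last_eq_zero,
    cnt_congr fun v => and_and_left.symm, cnt_first_axis]
  ring

theorem cnt_two_axes :
    cnt (fun v : Fin 3 → F => v ≠ 0 ∧ v 0 = 0 ∧ (v 1 = 0 ∨ v 2 = 0)) = 2 * (ord F - 1) := by
  rw [cnt_congr fun v => and_congr_right fun _ => and_or_left, cnt_congr fun v => and_or_left,
    cnt_or, cnt_last_axis, cnt_middle_axis, cnt_eq_zero]
  · ring
  · rintro v ⟨⟨hv, h0, h1⟩, -, -, h2⟩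
    exact hv (ext3 h0 h1 h2)

theorem cnt_two_lines (h2 : (2 : F) ≠ 0) :
    cnt (fun v : Fin 3 → F => v ≠ 0 ∧ v 2 = 0 ∧ (v 0 = v 1 ∨ v 0 = -v 1)) =
      2 * (ord F - 1) := by
  rw [cnt_congr fun v => and_congr_right fun _ => and_or_left, cnt_congr fun v => and_or_left,
    cnt_or, cnt_line (b := ![1, 1, 0]) (by simp), cnt_line (b := ![-1, 1, 0]) (by simp),
    cnt_eq_zero]
  · ring
  · rintro v ⟨⟨hv, hz, h⟩, -, -, h'⟩
    have h1 : v 1 = 0 := mul_left_cancel₀ h2 (by linear_combination h' - h)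
    exact hv (ext3 (h.trans h1) h1 hz)
  · exact fun v => ⟨fun ⟨hz, h⟩ => ⟨v 1, by apply ext3 <;> simp [hz, h]⟩, by rintro ⟨c, rfl⟩; simp⟩
  · exact fun v => ⟨fun ⟨hz, h⟩ => ⟨v 1, by apply ext3 <;> simp [hz, h]⟩, by rintro ⟨c, rfl⟩; simp⟩

/-- The cone over a smooth conic, in bijection with the plane. -/
def coneEquiv : F × F ≃ {v : Fin 3 → F // v 0 * v 0 = v 1 * v 2} where
  toFun a := if h : a.2 = 0 then ⟨![0, 0, a.1], by simp⟩
    else ⟨![a.1, a.2, a.1 * a.1 / a.2], by simp; field_simp⟩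
  invFun v := if v.1 1 = 0 then (v.1 2, 0) else (v.1 0, v.1 1)
  left_inv a := by
    by_cases h : a.2 = 0
    · simp [h, Prod.ext_iff]
    · simp [h]
  right_inv := by
    rintro ⟨v, hv⟩
    refine Subtype.ext ?_
    by_cases h : v 1 = 0
    · have h0 : v 0 = 0 := by simpa [h] using hv
      apply ext3 <;> simp [h, h0]
    · apply ext3 <;> simp [h, hv]

theorem cnt_cone :
    cnt (fun v : Fin 3 → F => v ≠ 0 ∧ v 0 * v 0 = v 1 * v 2) = ord F ^ 2 - 1 := by
  rw [cnt_ne_zero_and (by simp), cnt_eq_card, ← Fintype.card_subtype,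
    ← Fintype.card_congr coneEquiv, Fintype.card_prod, ord]
  push_cast
  ring

/-! ### The Fourier transform on orbits -/

theorem kap_eq_cnt {A B : Fin 6 → F} (p : (Fin 3 → F) → Prop)
    (h : ∀ v, (app A v = 0 ∧ app B v = 0) ↔ p v) : kap A B = cnt fun v => v ≠ 0 ∧ p v :=
  cnt_congr fun v => and_congr_right fun _ => h v

theorem tang_eq_cnt {A B : Fin 6 → F} (p : (Fin 3 → F) → Prop)
    (h : ∀ v, (bil A v v = 0 ∧ bil B v v = 0) ↔ p v) (hA : ∀ v, p v → app A v = 0) :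
    tang A B = cnt fun v => v ≠ 0 ∧ p v :=
  cnt_congr fun v => and_congr_right fun _ => by
    rw [← and_assoc, h, and_iff_left_iff_imp]
    exact fun hv => ⟨1, 0, by simp, by rw [one_smul, zero_smul, add_zero, hA v hv]⟩

omit [Fintype F] in
theorem half_eq_zero_iff (h2 : (2 : F) ≠ 0) {s : Fin 6 → F} : half s = 0 ↔ s = 0 := by
  refine ⟨fun h => ?_, fun h => ?_⟩
  · rw [← double_half h2 s, h]
    apply ext6 <;> simp [double]
  · rw [h]
    apply ext6 <;> simp [half]

omit [Fintype F] in
theorem Equivalent.eq_zero (h2 : (2 : F) ≠ 0) {A B : Fin 6 → F} (h : Equivalent A B 0 0) :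
    A = 0 ∧ B = 0 := by
  obtain ⟨α, β, γ, δ, N, N', hd, h, h', hA, hB⟩ := h
  have hp : ∀ C : Fin 6 → F, pull N C = 0 → C = 0 := fun C hC => by
    rw [← pull_pull h2 h C, hC]
    apply ext6 <;> simp [pull, bil]
  have := (forall_mem_pencil_iff hd (p := fun E => E = 0)
    (fun a b A B hA hB => by rw [hA, hB, smul_zero, smul_zero, add_zero]) _ _).1 ⟨hA.symm, hB.symm⟩
  exact ⟨hp A this.1, hp B this.2⟩

section Fourier

variable (p : ℕ) [Fact p.Prime] [CharP F p]

theorem FTPT_zero (h2 : (2 : F) ≠ 0) :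
    FTPT p (fun x : (Fin 6 → F) × (Fin 6 → F) => if DiscPT x = 0 then 1 else 0) 0 =
      1 / ord F + 2 / ord F ^ 2 - 1 / ord F ^ 3 - 2 / ord F ^ 4 - 1 / ord F ^ 5 + 2 / ord F ^ 6 +
        1 / ord F ^ 7 - 1 / ord F ^ 8 := by
  refine mul_left_cancel₀ (pow_ne_zero 2 (ord_sub_one_ne_zero (F := F))) ?_
  have h0 : half (0 : Fin 6 → F) = 0 := (half_eq_zero_iff h2).2 rfl
  have hs : sing (0 : Fin 6 → F) 0 = 1 := ind_of (by simp [discCubic, det3, pairing])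
  rw [FTPT_eq p h2, Prod.fst_zero, Prod.snd_zero, h0, ff_zero, gg_zero, hs, ind_of ⟨rfl, rfl⟩]
  have := ord_ne_zero (F := F)
  field_simp
  ring

theorem FTPT_of_sing_eq_zero (h2 : (2 : F) ≠ 0) {y : (Fin 6 → F) × (Fin 6 → F)}
    (hy : DiscPT y ≠ 0) :
    FTPT p (fun x : (Fin 6 → F) × (Fin 6 → F) => if DiscPT x = 0 then 1 else 0) y =
      -(1 / ord F ^ 8) := by
  refine mul_left_cancel₀ (pow_ne_zero 2 (ord_sub_one_ne_zero (F := F))) ?_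
  have hs : sing (half y.1) (half y.2) = 0 := by rw [← ite_DiscPT h2, if_neg hy]
  have h0 : ¬ (half y.1 = 0 ∧ half y.2 = 0) := fun h => by
    rw [h.1, h.2, show sing (0 : Fin 6 → F) 0 = 1 from ind_of (by simp [discCubic, det3, pairing])]
      at hs
    exact one_ne_zero hs
  have hk : kap (half y.1) (half y.2) = 0 := kap_eq_zero fun h => by
    rw [sing_eq_one_of_dbl h2 (Or.inr h.2)] at hs
    exact one_ne_zero hs
  have ht : tang (half y.1) (half y.2) = 0 := by
    by_contra ht
    rw [sing_eq_one_of_tang h2 ht] at hs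
    exact one_ne_zero hs
  rw [FTPT_eq p h2, ff_eq_mul h2 h0, gg_eq_kap_add_tang, hk, ht, hs, ind_not h0]
  have := ord_ne_zero (F := F)
  field_simp
  ring

variable {p} in
theorem FTPT_of_equivalent (h2 : (2 : F) ≠ 0) {r y : (Fin 6 → F) × (Fin 6 → F)} {k m t : ℂ}
    (h : InOrbitPT r y) (hr : r ≠ 0) (hs : sing (half y.1) (half y.2) = 1)
    (hk : kap (half r.1) (half r.2) = k) (hm : kap (half r.1) (half r.2) *
      phi (half r.1) (half r.2) = k * m) (ht : tang (half r.1) (half r.2) = t) :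
    FTPT p (fun x : (Fin 6 → F) × (Fin 6 → F) => if DiscPT x = 0 then 1 else 0) y =
      k * m / ((ord F - 1) * ord F ^ 5) - (ord F * k + t) / ord F ^ 7 + 1 / ord F ^ 6 -
        1 / ord F ^ 8 := by
  have he := equivalent_of_inOrbitPT h2 h
  have h0 : ¬ (half y.1 = 0 ∧ half y.2 = 0) := fun h0 => hr <| by
    rw [h0.1, h0.2] at he
    exact Prod.ext ((half_eq_zero_iff h2).1 (he.eq_zero h2).1)
      ((half_eq_zero_iff h2).1 (he.eq_zero h2).2)
  have h1 := ord_sub_one_ne_zero (F := F)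
  have h3 := ord_ne_zero (F := F)
  refine mul_left_cancel₀ (pow_ne_zero 2 h1) ?_
  rw [FTPT_eq p h2, ff_eq_mul h2 h0, gg_eq_kap_add_tang, ind_not h0, he.phi_eq h2, he.kap_eq, hm,
    he.tang_eq h2, hs, hk, ht]
  field_simp
  ring

theorem FTPT_of_tang (h2 : (2 : F) ≠ 0) {r y : (Fin 6 → F) × (Fin 6 → F)} {k m t : ℂ}
    (h : InOrbitPT r y) (hr : r ≠ 0)
    (hk : kap (half r.1) (half r.2) = k) (hm : phi (half r.1) (half r.2) = m)
    (ht : tang (half r.1) (half r.2) = t) (ht0 : t ≠ 0) :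
    FTPT p (fun x : (Fin 6 → F) × (Fin 6 → F) => if DiscPT x = 0 then 1 else 0) y =
      k * m / ((ord F - 1) * ord F ^ 5) - (ord F * k + t) / ord F ^ 7 + 1 / ord F ^ 6 -
        1 / ord F ^ 8 := by
  refine FTPT_of_equivalent h2 h hr (sing_eq_one_of_tang h2 ?_) hk (by rw [hk, hm]) ht
  rw [(equivalent_of_inOrbitPT h2 h).tang_eq h2, ht]
  exact ht0

theorem FTPT_of_tang_of_no_vertex (h2 : (2 : F) ≠ 0) {r y : (Fin 6 → F) × (Fin 6 → F)} {t : ℂ}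
    (h : InOrbitPT r y) (hr : r ≠ 0) (hk : kap (half r.1) (half r.2) = 0)
    (ht : tang (half r.1) (half r.2) = t) (ht0 : t ≠ 0) :
    FTPT p (fun x : (Fin 6 → F) × (Fin 6 → F) => if DiscPT x = 0 then 1 else 0) y =
      1 / ord F ^ 6 - t / ord F ^ 7 - 1 / ord F ^ 8 := by
  rw [FTPT_of_tang p h2 h hr hk rfl ht ht0]
  ring

end Fourier

/-! ### Invariants of the representatives -/

section Representatives

omit [Fintype F]

theorem mul_self_eq_mul_iff {l : F} (hl : ¬ IsSquare l) {a b : F} :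
    a * a = l * (b * b) ↔ a = 0 ∧ b = 0 := by
  refine ⟨fun h => ?_, fun ⟨ha, hb⟩ => by rw [ha, hb]; ring⟩
  have hb : b = 0 := by
    by_contra hb
    exact hl ⟨a / b, by field_simp; linear_combination -h⟩
  subst hb
  simpa using h

theorem eq_prodForm_iff {A : Fin 6 → F} {v m : Fin 3 → F} :
    A = prodForm v m ↔ A 0 = 2 * (v 0 * m 0) ∧ A 1 = v 0 * m 1 + v 1 * m 0 ∧
      A 2 = v 0 * m 2 + v 2 * m 0 ∧ A 3 = 2 * (v 1 * m 1) ∧ A 4 = v 1 * m 2 + v 2 * m 1 ∧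
      A 5 = 2 * (v 2 * m 2) := by
  refine ⟨?_, fun ⟨h0, h1, h2, h3, h4, h5⟩ => ext6 h0 h1 h2 h3 h4 h5⟩
  rintro rfl
  simp [prodForm]

theorem exists_prodForm_last_sq (h2 : (2 : F) ≠ 0) {v : Fin 3 → F} (hv : v ≠ 0) :
    (∃ m, half ![0, 0, 0, 0, 0, 1] = prodForm v m) ↔ v 0 = 0 ∧ v 1 = 0 := by
  constructor
  · rintro ⟨m, hm⟩
    rw [eq_prodForm_iff] at hm
    simp [half, h2] at hm
    grind
  · rintro ⟨h0, h1⟩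
    have hz : v 2 ≠ 0 := fun h => hv (ext3 h0 h1 h)
    refine ⟨![0, 0, 1 / (2 * v 2)], eq_prodForm_iff.2 ?_⟩
    simp [half, h0, h1]
    field_simp

theorem exists_prodForm_middle_sq (h2 : (2 : F) ≠ 0) {v : Fin 3 → F} (hv : v ≠ 0) :
    (∃ m, half ![0, 0, 0, 1, 0, 0] = prodForm v m) ↔ v 0 = 0 ∧ v 2 = 0 := by
  constructor
  · rintro ⟨m, hm⟩
    rw [eq_prodForm_iff] at hm
    simp [half, h2] at hm
    grind
  · rintro ⟨h0, h1⟩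
    have hz : v 1 ≠ 0 := fun h => hv (ext3 h0 h h1)
    refine ⟨![0, 1 / (2 * v 1), 0], eq_prodForm_iff.2 ?_⟩
    simp [half, h0, h1]
    field_simp

theorem exists_prodForm_mul (h2 : (2 : F) ≠ 0) {v : Fin 3 → F} (hv : v ≠ 0) :
    (∃ m, half ![0, 0, 0, 0, 1, 0] = prodForm v m) ↔ v 0 = 0 ∧ (v 1 = 0 ∨ v 2 = 0) := by
  constructor
  · rintro ⟨m, hm⟩
    rw [eq_prodForm_iff] at hm
    simp [half, h2] at hm
    grind
  · rintro ⟨h0, h1 | h1⟩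
    · have hz : v 2 ≠ 0 := fun h => hv (ext3 h0 h1 h)
      refine ⟨![0, 1 / (2 * v 2), 0], eq_prodForm_iff.2 ?_⟩
      simp [half, h0, h1]
      field_simp
    · have hz : v 1 ≠ 0 := fun h => hv (ext3 h0 h h1)
      refine ⟨![0, 0, 1 / (2 * v 1)], eq_prodForm_iff.2 ?_⟩
      simp [half, h0, h1]
      field_simp

/-- A nondegenerate binary form has no linear factor vanishing on a coordinate axis. -/
theorem ne_zero_of_eq_prodForm {b c : F} (hb : b ≠ 0) (hc : c ≠ 0) {v m : Fin 3 → F}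
    (hm : half ![0, 0, 0, b, 0, c] = prodForm v m) : v 1 ≠ 0 ∧ v 2 ≠ 0 := by
  rw [eq_prodForm_iff] at hm
  simp [half] at hm
  grind

theorem not_exists_prodForm_of_not_isSquare {l : F} (hl : ¬ IsSquare l) (v : Fin 3 → F) :
    ¬ ∃ m, half ![0, 0, 0, 1, 0, -l] = prodForm v m := by
  rintro ⟨m, hm⟩
  have hv : v 1 ≠ 0 ∧ v 2 ≠ 0 := ne_zero_of_eq_prodForm one_ne_zero
    (fun h => hl (by rw [neg_eq_zero.1 h]; exact IsSquare.zero)) hm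
  rw [eq_prodForm_iff] at hm
  simp [half] at hm
  obtain ⟨-, -, -, h3, h4, h5⟩ := hm
  refine hv.2 (((mul_self_eq_mul_iff hl (a := v 2) (b := v 1)).1 ?_).1)
  linear_combination (v 2 * v 2) * h3 + (v 1 * v 1) * h5 - 2 * (v 1) * (v 2) * h4

end Representatives

theorem phi_eq_cnt {A B : Fin 6 → F} (p : (Fin 3 → F) → Prop)
    (h : ∀ v : Fin 3 → F, v ≠ 0 → (((∃ m, A = prodForm v m) ∧ ∃ m, B = prodForm v m) ↔ p v)) :
    phi A B = cnt fun v => v ≠ 0 ∧ p v :=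
  cnt_congr fun v => and_congr_right fun hv => h v hv

theorem phi_zero_left (B : Fin 6 → F) :
    phi (half 0) B = cnt fun v => v ≠ 0 ∧ ∃ m, B = prodForm v m :=
  phi_eq_cnt _ fun v _ => and_iff_right ⟨0, by apply ext6 <;> simp [half, prodForm]⟩

theorem kap_eq_zero_of_forall {A B : Fin 6 → F}
    (h : ∀ v : Fin 3 → F, app A v = 0 → app B v = 0 → v = 0) : kap A B = 0 :=
  cnt_eq_zero fun v hv => hv.1 (h v hv.2.1 hv.2.2)

theorem phi_eq_zero_of_forall {A B : Fin 6 → F}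
    (h : ∀ v : Fin 3 → F, v ≠ 0 → (∃ m, A = prodForm v m) → ¬ ∃ m, B = prodForm v m) :
    phi A B = 0 :=
  cnt_eq_zero fun v hv => h v hv.1 hv.2.1 hv.2.2

omit [Field F] in
theorem natCast_mul_ord_add_one_ne_zero (n : ℕ) : n * ord F + 1 ≠ 0 := by
  have := Nat.cast_add_one_ne_zero (R := ℂ) (n * Fintype.card F)
  rwa [Nat.cast_mul] at this

theorem ord_sq_sub_one_ne_zero : ord F ^ 2 - 1 ≠ 0 := by
  have := natCast_mul_ord_add_one_ne_zero (F := F) 1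
  rw [Nat.cast_one, one_mul] at this
  rw [show ord F ^ 2 - 1 = (ord F - 1) * (ord F + 1) by ring]
  exact mul_ne_zero ord_sub_one_ne_zero this

theorem two_planes_ne_zero : 2 * (ord F ^ 2 - 1) - (ord F - 1) ≠ 0 := by
  have := natCast_mul_ord_add_one_ne_zero (F := F) 2
  rw [Nat.cast_two] at this
  rw [show 2 * (ord F ^ 2 - 1) - (ord F - 1) = (ord F - 1) * (2 * ord F + 1) by ring]
  exact mul_ne_zero ord_sub_one_ne_zero this

section Fourier

variable (p : ℕ) [Fact p.Prime] [CharP F p] (h2 : (2 : F) ≠ 0) {y : (Fin 6 → F) × (Fin 6 → F)}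

include h2

theorem FTPT_last_sq (h : InOrbitPT (0, ![0, 0, 0, 0, 0, 1]) y) :
    FTPT p (fun x => if DiscPT x = 0 then 1 else 0) y =
      1 / ord F ^ 3 - 1 / ord F ^ 4 - 2 / ord F ^ 5 + 2 / ord F ^ 6 + 1 / ord F ^ 7 -
        1 / ord F ^ 8 := by
  rw [FTPT_of_tang p h2 h (by simp [Prod.ext_iff])
    ((kap_eq_cnt (fun v => v 2 = 0) fun v => by simp [app, half]).trans cnt_last_eq_zero)
    (((phi_zero_left _).trans (cnt_congr fun v => and_congr_right fun hv =>
      exists_prodForm_last_sq h2 hv)).trans cnt_last_axis)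
    ((tang_eq_cnt (fun v => v 2 = 0) (fun v => by simp [bil, half])
      fun v hv => by simp [app, half]).trans cnt_last_eq_zero) ord_sq_sub_one_ne_zero]
  have := ord_ne_zero (F := F)
  have := ord_sub_one_ne_zero (F := F)
  field_simp
  ring

theorem FTPT_mul (h : InOrbitPT (0, ![0, 0, 0, 0, 1, 0]) y) :
    FTPT p (fun x => if DiscPT x = 0 then 1 else 0) y =
      2 / ord F ^ 4 - 5 / ord F ^ 5 + 3 / ord F ^ 6 + 1 / ord F ^ 7 - 1 / ord F ^ 8 := by
  rw [FTPT_of_tang p h2 h (by simp [Prod.ext_iff])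
    ((kap_eq_cnt (fun v => v 1 = 0 ∧ v 2 = 0) fun v => by
      simp [app, half, h2, and_comm]).trans cnt_first_axis)
    (((phi_zero_left _).trans (cnt_congr fun v => and_congr_right fun hv =>
      exists_prodForm_mul h2 hv)).trans cnt_two_axes)
    ((tang_eq_cnt (fun v => v 1 = 0 ∨ v 2 = 0) (fun v => by
      simp [bil, half]; grind) fun v hv => by simp [app, half]).trans cnt_two_planes)
    two_planes_ne_zero]
  have := ord_ne_zero (F := F)
  have := ord_sub_one_ne_zero (F := F)
  field_simp
  ring

theorem FTPT_last_sq_mul (h : InOrbitPT (![0, 0, 0, 0, 0, 1], ![0, 0, 0, 0, 1, 0]) y) :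
    FTPT p (fun x => if DiscPT x = 0 then 1 else 0) y =
      1 / ord F ^ 4 - 3 / ord F ^ 5 + 2 / ord F ^ 6 + 1 / ord F ^ 7 - 1 / ord F ^ 8 := by
  rw [FTPT_of_tang p h2 h (by simp [Prod.ext_iff])
    ((kap_eq_cnt (fun v => v 1 = 0 ∧ v 2 = 0) fun v => by
      simp [app, half, h2]; grind).trans cnt_first_axis)
    ((phi_eq_cnt (fun v => v 0 = 0 ∧ v 1 = 0) fun v hv => by
      rw [exists_prodForm_last_sq h2 hv, exists_prodForm_mul h2 hv]
      grind).trans cnt_last_axis)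
    ((tang_eq_cnt (fun v => v 2 = 0) (fun v => by
      simp [bil, half]; grind) fun v hv => by simp [app, half, hv]).trans cnt_last_eq_zero)
    ord_sq_sub_one_ne_zero]
  have := ord_ne_zero (F := F)
  have := ord_sub_one_ne_zero (F := F)
  field_simp
  ring

theorem FTPT_of_line {r : (Fin 6 → F) × (Fin 6 → F)} (h : InOrbitPT r y) (hr : r ≠ 0)
    (hk : ∀ v, (app (half r.1) v = 0 ∧ app (half r.2) v = 0) ↔ v 1 = 0 ∧ v 2 = 0)
    (hm : ∀ v : Fin 3 → F, v ≠ 0 → (∃ m, half r.1 = prodForm v m) → ¬ ∃ m, half r.2 = prodForm v m)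
    (ht : ∀ v, (bil (half r.1) v v = 0 ∧ bil (half r.2) v v = 0) ↔ v 1 = 0 ∧ v 2 = 0) :
    FTPT p (fun x => if DiscPT x = 0 then 1 else 0) y =
      -(1 / ord F ^ 5) + 1 / ord F ^ 6 + 1 / ord F ^ 7 - 1 / ord F ^ 8 := by
  rw [FTPT_of_tang p h2 h hr ((kap_eq_cnt _ hk).trans cnt_first_axis) (phi_eq_zero_of_forall hm)
    ((tang_eq_cnt _ ht fun v hv => ((hk v).2 hv).1).trans cnt_first_axis) ord_sub_one_ne_zero]
  have := ord_ne_zero (F := F)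
  have := ord_sub_one_ne_zero (F := F)
  field_simp
  ring

theorem FTPT_anisotropic {l : F} (hl : ¬ IsSquare l) (h : InOrbitPT (0, ![0, 0, 0, 1, 0, -l]) y) :
    FTPT p (fun x => if DiscPT x = 0 then 1 else 0) y =
      -(1 / ord F ^ 5) + 1 / ord F ^ 6 + 1 / ord F ^ 7 - 1 / ord F ^ 8 := by
  have hl0 : l ≠ 0 := fun h => hl (h ▸ IsSquare.zero)
  refine FTPT_of_line p h2 h (by simp [Prod.ext_iff]) (fun v => by simp [app, half, hl0])
    (fun v _ _ => not_exists_prodForm_of_not_isSquare hl v) fun v =>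
    ⟨fun ⟨_, hB⟩ => (mul_self_eq_mul_iff hl).1 ?_, fun ⟨h1, h3⟩ => by simp [bil, half, h1, h3]⟩
  simp [bil, half] at hB
  linear_combination hB

theorem FTPT_two_squares (h : InOrbitPT (![0, 0, 0, 0, 0, 1], ![0, 0, 0, 1, 0, 0]) y) :
    FTPT p (fun x => if DiscPT x = 0 then 1 else 0) y =
      -(1 / ord F ^ 5) + 1 / ord F ^ 6 + 1 / ord F ^ 7 - 1 / ord F ^ 8 := by
  refine FTPT_of_line p h2 h (by simp [Prod.ext_iff]) (fun v => by simp [app, half, and_comm])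
    (fun v hv h h' => hv ?_) fun v => by simp [bil, half, and_comm]
  rw [exists_prodForm_last_sq h2 hv] at h
  rw [exists_prodForm_middle_sq h2 hv] at h'
  exact ext3 h.1 h.2 h'.2

theorem FTPT_mul_sum {l : F} (hl : l ≠ 0)
    (h : InOrbitPT (![0, 0, 0, 0, 1, 0], ![0, 0, 0, 1, 0, l]) y) :
    FTPT p (fun x => if DiscPT x = 0 then 1 else 0) y =
      -(1 / ord F ^ 5) + 1 / ord F ^ 6 + 1 / ord F ^ 7 - 1 / ord F ^ 8 := by
  refine FTPT_of_line p h2 h (by simp [Prod.ext_iff]) (fun v => by simp [app, half, hl, h2]; grind)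
    (fun v hv h => ?_) fun v => by simp [bil, half]; grind
  rintro ⟨m, hm⟩
  have := ne_zero_of_eq_prodForm one_ne_zero hl hm
  rw [exists_prodForm_mul h2 hv] at h
  exact h.2.elim this.1 this.2

theorem FTPT_conic (h : InOrbitPT (0, ![1, 0, 0, 0, -1, 0]) y) :
    FTPT p (fun x => if DiscPT x = 0 then 1 else 0) y =
      -(1 / ord F ^ 5) + 1 / ord F ^ 6 + 1 / ord F ^ 7 - 1 / ord F ^ 8 := by
  rw [FTPT_of_tang_of_no_vertex p h2 h (by simp [Prod.ext_iff])
    (kap_eq_zero_of_forall fun v _ hB => by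
      simp [app, half, h2] at hB
      exact ext3 hB.1 hB.2.2 hB.2.1)
    ((tang_eq_cnt (fun v => v 0 * v 0 = v 1 * v 2) (fun v => by
      simp [bil, half]; grind) fun v hv => by simp [app, half]).trans cnt_cone)
    ord_sq_sub_one_ne_zero]
  have := ord_ne_zero (F := F)
  field_simp
  ring

theorem FTPT_mul_mul (h : InOrbitPT (![0, 0, 0, 0, 1, 0], ![0, 0, 1, 0, 0, 0]) y) :
    FTPT p (fun x => if DiscPT x = 0 then 1 else 0) y =
      -(1 / ord F ^ 5) + 1 / ord F ^ 6 + 1 / ord F ^ 7 - 1 / ord F ^ 8 := by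
  have ht : tang (F := F) (half ![0, 0, 0, 0, 1, 0]) (half ![0, 0, 1, 0, 0, 0]) = ord F ^ 2 - 1 := by
    rw [← cnt_last_eq_zero]
    refine cnt_congr fun v => and_congr_right fun hv => ⟨?_, fun hz => ⟨?_, ?_, ?_⟩⟩
    · rintro ⟨-, -, a, b, hab, h⟩
      simp [app, half, h2] at h
      grind
    · simp [bil, half, hz]
    · simp [bil, half, hz]
    · refine ⟨v 0, -v 1, fun h => hv (ext3 h.1 (neg_eq_zero.1 h.2) hz), ?_⟩
      apply ext3 <;> simp [app, half, hz]
      ring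
  rw [FTPT_of_tang_of_no_vertex p h2 h (by simp [Prod.ext_iff])
    (kap_eq_zero_of_forall fun v hA hB => by
      simp [app, half, h2] at hA hB
      exact ext3 hB.2 hA.2 hA.1) ht ord_sq_sub_one_ne_zero]
  have := ord_ne_zero (F := F)
  field_simp
  ring

theorem FTPT_last_sq_split (h : InOrbitPT (![0, 0, 0, 0, 0, 1], ![1, 0, 0, -1, 0, 0]) y) :
    FTPT p (fun x => if DiscPT x = 0 then 1 else 0) y =
      -(1 / ord F ^ 6) + 2 / ord F ^ 7 - 1 / ord F ^ 8 := by
  rw [FTPT_of_tang_of_no_vertex p h2 h (by simp [Prod.ext_iff])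
    (kap_eq_zero_of_forall fun v hA hB => by
      simp [app, half] at hA hB
      exact ext3 hB.1 hB.2 hA)
    ((tang_eq_cnt (fun v => v 2 = 0 ∧ (v 0 = v 1 ∨ v 0 = -v 1)) (fun v => by
      simp [bil, half, ← mul_self_eq_mul_self_iff, ← sub_eq_add_neg, sub_eq_zero])
      fun v hv => by simp [app, half, hv.1]).trans (cnt_two_lines h2))
    (mul_ne_zero two_ne_zero ord_sub_one_ne_zero)]
  have := ord_ne_zero (F := F)
  field_simp
  ring

theorem FTPT_last_sq_nonsplit {l : F} (hl : ¬ IsSquare l)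
    (h : InOrbitPT (![0, 0, 0, 0, 0, 1], ![1, 0, 0, -l, 0, 0]) y) :
    FTPT p (fun x => if DiscPT x = 0 then 1 else 0) y = 1 / ord F ^ 6 - 1 / ord F ^ 8 := by
  have hl0 : l ≠ 0 := fun h => hl (h ▸ IsSquare.zero)
  have he := equivalent_of_inOrbitPT h2 h
  have hk : kap (F := F) (half ![0, 0, 0, 0, 0, 1]) (half ![1, 0, 0, -l, 0, 0]) = 0 :=
    kap_eq_zero_of_forall fun v hA hB => by
      simp [app, half, hl0] at hA hB
      exact ext3 hB.1 hB.2 hA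
  have hs : half (F := F) ![0, 0, 0, 0, 0, 1] = (1 : F) • sqForm ![0, 0, 1] := by
    apply ext6 <;> simp [half, sqForm]
  have ht : tang (F := F) (half ![0, 0, 0, 0, 0, 1]) (half ![1, 0, 0, -l, 0, 0]) = 0 :=
    cnt_eq_zero fun v hv => by
      obtain ⟨hv, hA, hB, -⟩ := hv
      simp [bil, half] at hA hB
      have := (mul_self_eq_mul_iff hl (a := v 0) (b := v 1)).1 (by linear_combination hB)
      exact hv (ext3 this.1 this.2 hA)
  rw [hs] at he
  rw [FTPT_of_equivalent (m := 0) h2 h (by simp [Prod.ext_iff]) (he.sing_eq_one h2) hk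
    (by rw [hk, zero_mul, zero_mul]) ht]
  ring

theorem FTPT_of_point {r : (Fin 6 → F) × (Fin 6 → F)} (h : InOrbitPT r y) (hr : r ≠ 0)
    (hk : ∀ v : Fin 3 → F, app (half r.1) v = 0 → app (half r.2) v = 0 → v = 0)
    (ht : ∀ v, (bil (half r.1) v v = 0 ∧ bil (half r.2) v v = 0 ∧
      ∃ a b : F, ¬ (a = 0 ∧ b = 0) ∧ app (a • half r.1 + b • half r.2) v = 0) ↔
        v 1 = 0 ∧ v 2 = 0) :
    FTPT p (fun x => if DiscPT x = 0 then 1 else 0) y = 1 / ord F ^ 7 - 1 / ord F ^ 8 := by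
  have ht' : tang (half r.1) (half r.2) = ord F - 1 := by
    rw [← cnt_first_axis]
    exact cnt_congr fun v => and_congr_right fun _ => ht v
  rw [FTPT_of_tang_of_no_vertex p h2 h hr (kap_eq_zero_of_forall hk) ht' ord_sub_one_ne_zero]
  have := ord_ne_zero (F := F)
  field_simp
  ring

theorem FTPT_last_sq_cone (h : InOrbitPT (![0, 0, 0, 0, 0, 1], ![0, 0, 1, 1, 0, 0]) y) :
    FTPT p (fun x => if DiscPT x = 0 then 1 else 0) y = 1 / ord F ^ 7 - 1 / ord F ^ 8 := by
  refine FTPT_of_point p h2 h (by simp [Prod.ext_iff]) (fun v hA hB => ?_) fun v =>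
    ⟨fun ⟨hA, hB, _⟩ => ?_, fun ⟨h1, h3⟩ => ⟨?_, ?_, 1, 0, by simp, ?_⟩⟩
  · simp [app, half, h2] at hA hB
    exact ext3 hB.2.2 hB.2.1 hA
  · simp [bil, half] at hA hB
    grind
  · simp [bil, half, h3]
  · simp [bil, half, h1, h3]
  · simp [app, half, h3]

theorem FTPT_mul_cone (h : InOrbitPT (![0, 0, 0, 0, 1, 0], ![0, 0, 1, 1, 0, 0]) y) :
    FTPT p (fun x => if DiscPT x = 0 then 1 else 0) y = 1 / ord F ^ 7 - 1 / ord F ^ 8 := by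
  refine FTPT_of_point p h2 h (by simp [Prod.ext_iff]) (fun v hA hB => ?_) fun v =>
    ⟨fun ⟨hA, hB, a, b, hab, hE⟩ => ?_, fun ⟨h1, h3⟩ => ⟨?_, ?_, 1, 0, by simp, ?_⟩⟩
  · simp [app, half, h2] at hA hB
    exact ext3 hB.2.2 hA.2 hA.1
  · simp [bil, half] at hA hB
    simp [app, half, h2] at hE
    grind
  · simp [bil, half, h3]
  · simp [bil, half, h1, h3]
  · simp [app, half, h1, h3]

theorem FTPT_sub_mul {l : F} (hl : l ≠ 0)
    (h : InOrbitPT (![0, 0, 0, 1, 0, -l], ![0, 0, 1, 0, 0, 0]) y) :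
    FTPT p (fun x => if DiscPT x = 0 then 1 else 0) y = 1 / ord F ^ 7 - 1 / ord F ^ 8 := by
  refine FTPT_of_point p h2 h (by simp [Prod.ext_iff]) (fun v hA hB => ?_) fun v =>
    ⟨fun ⟨hA, hB, a, b, hab, hE⟩ => ?_, fun ⟨h1, h3⟩ => ⟨?_, ?_, 1, 0, by simp, ?_⟩⟩
  · simp [app, half, h2, hl] at hA hB
    exact ext3 hB.2 hA.1 hA.2
  · simp [bil, half] at hA hB
    simp [app, half, h2] at hE
    grind
  · simp [bil, half, h1, h3]
  · simp [bil, half, h1, h3]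
  · simp [app, half, h1, h3]

end Fourier

end TernaryPencil

open TernaryPencil

/-- the Fourier transform of the characteristic function of singular pairs
of ternary quadratic forms. -/
theorem stmt1 (p : ℕ) [Fact p.Prime] [CharP F p] (hp : p ≠ 2) (l : F) (hl : ¬ IsSquare l)
    (y : (Fin 6 → F) × (Fin 6 → F)) :
    let Q : ℂ := (Fintype.card F : ℂ)
    let Ψ : (Fin 6 → F) × (Fin 6 → F) → ℂ := fun x => if DiscPT x = 0 then 1 else 0
    (y = 0 →
      FTPT p Ψ y = 1/Q + 2/Q^2 - 1/Q^3 - 2/Q^4 - 1/Q^5 + 2/Q^6 + 1/Q^7 - 1/Q^8) ∧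
    (InOrbitPT (0, ![0,0,0,0,0,1]) y →
      FTPT p Ψ y = 1/Q^3 - 1/Q^4 - 2/Q^5 + 2/Q^6 + 1/Q^7 - 1/Q^8) ∧
    (InOrbitPT (0, ![0,0,0,0,1,0]) y →
      FTPT p Ψ y = 2/Q^4 - 5/Q^5 + 3/Q^6 + 1/Q^7 - 1/Q^8) ∧
    (InOrbitPT (![0,0,0,0,0,1], ![0,0,0,0,1,0]) y →
      FTPT p Ψ y = 1/Q^4 - 3/Q^5 + 2/Q^6 + 1/Q^7 - 1/Q^8) ∧
    (InOrbitPT (0, ![0,0,0,1,0,-l]) y ∨ InOrbitPT (0, ![1,0,0,0,-1,0]) y ∨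
        InOrbitPT (![0,0,0,0,1,0], ![0,0,1,0,0,0]) y ∨
        InOrbitPT (![0,0,0,0,0,1], ![0,0,0,1,0,0]) y ∨
        InOrbitPT (![0,0,0,0,1,0], ![0,0,0,1,0,l]) y →
      FTPT p Ψ y = -(1/Q^5) + 1/Q^6 + 1/Q^7 - 1/Q^8) ∧
    (InOrbitPT (![0,0,0,0,0,1], ![1,0,0,-1,0,0]) y →
      FTPT p Ψ y = -(1/Q^6) + 2/Q^7 - 1/Q^8) ∧
    (InOrbitPT (![0,0,0,0,0,1], ![1,0,0,-l,0,0]) y →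
      FTPT p Ψ y = 1/Q^6 - 1/Q^8) ∧
    (InOrbitPT (![0,0,0,0,0,1], ![0,0,1,1,0,0]) y ∨
        InOrbitPT (![0,0,0,0,1,0], ![0,0,1,1,0,0]) y ∨
        InOrbitPT (![0,0,0,1,0,-1], ![0,0,1,0,0,0]) y ∨
        InOrbitPT (![0,0,0,1,0,-l], ![0,0,1,0,0,0]) y →
      FTPT p Ψ y = 1/Q^7 - 1/Q^8) ∧
    (DiscPT y ≠ 0 → FTPT p Ψ y = -(1/Q^8)) := by
  have h2 : (2 : F) ≠ 0 := Ring.two_ne_zero (by rwa [ringChar.eq F p])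
  have hl0 : l ≠ 0 := fun h => hl (h ▸ IsSquare.zero)
  intro Q Ψ
  refine ⟨?_, FTPT_last_sq p h2, FTPT_mul p h2, FTPT_last_sq_mul p h2, ?_,
    FTPT_last_sq_split p h2, FTPT_last_sq_nonsplit p h2 hl, ?_, FTPT_of_sing_eq_zero p h2⟩
  · rintro rfl
    exact FTPT_zero p h2
  · rintro (h | h | h | h | h)
    · exact FTPT_anisotropic p h2 hl h
    · exact FTPT_conic p h2 h
    · exact FTPT_mul_mul p h2 h
    · exact FTPT_two_squares p h2 h
    · exact FTPT_mul_sum p h2 hl0 h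
  · rintro (h | h | h | h)
    · exact FTPT_last_sq_cone p h2 h
    · exact FTPT_mul_cone p h2 h
    · exact FTPT_sub_mul p h2 one_ne_zero h
    · exact FTPT_sub_mul p h2 hl0 h

end
end

section
/- The action of G = GL_2(F_q) on the space V of binary cubic forms has exactly six orbits, with representatives 0, v^3, uv^2, uv(u−v), v(u^2 + a_2 uv + b_2 v^2), and u^3 + a_3 u^2 v + b_3 uv^2 + c_3 v^3, where u^2 + a_2 u + b_2 and u^3 + a_3 u^2 + b_3 u + c_3 are respectively an irreducible quadratic and an irreducible cubic polynomial over F_q. The number of zeros in P^1(F_q) of any element of these orbits is respectively q+1, 1, 2, 3, 1, 0, and the orbit sizes are respectively 1, q^2 − 1, q(q^2 − 1), (q^2 − 1)(q^2 − q)/6, (q^2 − 1)(q^2 − q)/2, and (q^2 − 1)(q^2 − q)/3. -/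
open scoped Classical
open MvPolynomial Matrix

noncomputable section

variable {F : Type*} [Field F] [Fintype F]

/-- The binary cubic form `a u³ + b u²v + c uv² + d v³` attached to `(a,b,c,d)`. -/
def toPoly (x : Fin 4 → F) : MvPolynomial (Fin 2) F :=
  C (x 0) * X 0 ^ 3 + C (x 1) * X 0 ^ 2 * X 1 + C (x 2) * X 0 * X 1 ^ 2 + C (x 3) * X 1 ^ 3

/-- Substitution corresponding to the linear change of variables `(u,v) ↦ (u,v)·g`. -/
def subst2 (g : Matrix (Fin 2) (Fin 2) F) (P : MvPolynomial (Fin 2) F) : MvPolynomial (Fin 2) F :=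
  aeval (fun j => ∑ i : Fin 2, C (g i j) * X i) P

/-- The twisted `GL₂`-action `(g∘x)(u,v) = det(g)⁻¹ · x((u,v)g)` on binary cubic forms. -/
def act (g : Matrix.GeneralLinearGroup (Fin 2) F) (P : MvPolynomial (Fin 2) F) :
    MvPolynomial (Fin 2) F :=
  C ((g : Matrix (Fin 2) (Fin 2) F).det)⁻¹ * subst2 (g : Matrix (Fin 2) (Fin 2) F) P

/-- `x` lies in the `GL₂(F)`-orbit of `r` (binary cubic forms). -/
def InOrbit (r x : Fin 4 → F) : Prop :=
  ∃ g : Matrix.GeneralLinearGroup (Fin 2) F, act g (toPoly r) = toPoly x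

/-- The number of roots of the binary cubic form `x` in `ℙ¹(F)`. -/
def numRoots (x : Fin 4 → F) : ℕ :=
  Nat.card {P : Projectivization F (Fin 2 → F) // MvPolynomial.eval P.rep (toPoly x) = 0}

set_option linter.unusedSectionVars false

/-- The twisted action on coefficient vectors of binary cubic forms. -/
def coeffAct (g : Matrix (Fin 2) (Fin 2) F) (x : Fin 4 → F) : Fin 4 → F :=
  g.det⁻¹ • ![x 0 * g 0 0 ^ 3 + x 1 * g 0 0 ^ 2 * g 0 1 + x 2 * g 0 0 * g 0 1 ^ 2 + x 3 * g 0 1 ^ 3,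
    3 * x 0 * g 0 0 ^ 2 * g 1 0 + x 1 * (g 0 0 ^ 2 * g 1 1 + 2 * g 0 0 * g 1 0 * g 0 1)
      + x 2 * (g 1 0 * g 0 1 ^ 2 + 2 * g 0 0 * g 0 1 * g 1 1) + 3 * x 3 * g 0 1 ^ 2 * g 1 1,
    3 * x 0 * g 0 0 * g 1 0 ^ 2 + x 1 * (g 1 0 ^ 2 * g 0 1 + 2 * g 0 0 * g 1 0 * g 1 1)
      + x 2 * (g 0 0 * g 1 1 ^ 2 + 2 * g 1 0 * g 0 1 * g 1 1) + 3 * x 3 * g 0 1 * g 1 1 ^ 2,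
    x 0 * g 1 0 ^ 3 + x 1 * g 1 0 ^ 2 * g 1 1 + x 2 * g 1 0 * g 1 1 ^ 2 + x 3 * g 1 1 ^ 3]

theorem coeffAct_mul (g h : Matrix (Fin 2) (Fin 2) F) (x : Fin 4 → F) :
    coeffAct (g * h) x = coeffAct g (coeffAct h x) := by
  funext i
  fin_cases i <;> simp [coeffAct, Matrix.det_mul, Matrix.mul_apply, Fin.sum_univ_two] <;>
    ring

theorem coeffAct_one (x : Fin 4 → F) : coeffAct 1 x = x := by
  funext i
  fin_cases i <;> simp [coeffAct]

/-- The twisted action of `GL₂(F)` on coefficient vectors of binary cubic forms. -/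
@[reducible] def cubicAction : MulAction (Matrix.GeneralLinearGroup (Fin 2) F) (Fin 4 → F) where
  smul g x := coeffAct g x
  one_smul x := coeffAct_one x
  mul_smul _ _ x := coeffAct_mul _ _ x

theorem act_toPoly (g : Matrix.GeneralLinearGroup (Fin 2) F) (x : Fin 4 → F) :
    act g (toPoly x) = toPoly (coeffAct g x) := by
  simp only [act, subst2, toPoly, coeffAct, map_add, map_mul, map_pow, aeval_X, algHom_C,
    algebraMap_eq, Fin.sum_univ_two, Pi.smul_apply, smul_eq_mul, Matrix.cons_val, map_ofNat]
  ring

theorem toPoly_injective : Function.Injective (toPoly : (Fin 4 → F) → MvPolynomial (Fin 2) F) := by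
  have key (i : Fin 4) (x : Fin 4 → F) :
      coeff (Finsupp.single 0 (3 - i : ℕ) + Finsupp.single 1 (i : ℕ)) (toPoly x) = x i := by
    have hX : toPoly x = monomial (Finsupp.single 0 3 + Finsupp.single 1 0) (x 0) +
        monomial (Finsupp.single 0 2 + Finsupp.single 1 1) (x 1) +
        monomial (Finsupp.single 0 1 + Finsupp.single 1 2) (x 2) +
        monomial (Finsupp.single 0 0 + Finsupp.single 1 3) (x 3) := by
      simp [toPoly, monomial_add_single, C_mul_X_pow_eq_monomial]
      simp [X, C_mul_monomial]
    rw [hX]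
    fin_cases i <;>
      simp [coeff_monomial, Finsupp.ext_iff, Fin.forall_fin_two, Finsupp.single_apply]
  intro x y h
  funext i
  rw [← key i x, h, key]

theorem inOrbit_iff (r x : Fin 4 → F) :
    InOrbit r x ↔ ∃ g : Matrix.GeneralLinearGroup (Fin 2) F, coeffAct g r = x := by
  simp only [InOrbit, act_toPoly, toPoly_injective.eq_iff]

theorem card_inOrbit_mul_card_stabilizer (r : Fin 4 → F) :
    Nat.card {x // InOrbit r x} *
        Nat.card {g : Matrix.GeneralLinearGroup (Fin 2) F // coeffAct g r = r} =
      (Fintype.card F ^ 2 - 1) * (Fintype.card F ^ 2 - Fintype.card F) := by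
  let _ : MulAction (Matrix.GeneralLinearGroup (Fin 2) F) (Fin 4 → F) := cubicAction
  have h := MulAction.card_orbit_mul_card_stabilizer_eq_card_group
    (Matrix.GeneralLinearGroup (Fin 2) F) r
  simp only [Fintype.card_eq_nat_card, Matrix.card_GL_field, Fin.prod_univ_two] at h
  have ho : Nat.card {x // InOrbit r x} =
      Nat.card (MulAction.orbit (Matrix.GeneralLinearGroup (Fin 2) F) r) :=
    Nat.card_congr (Equiv.subtypeEquivRight fun x => inOrbit_iff r x)
  rw [ho]
  refine Eq.trans ?_ (h.trans ?_)
  · rfl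
  · simp

theorem card_stabilizer_le {α : Type*} (r : Fin 4 → F)
    (f : Matrix.GeneralLinearGroup (Fin 2) F → α) (s : Finset α)
    (hs : ∀ g : Matrix.GeneralLinearGroup (Fin 2) F, coeffAct g r = r → f g ∈ s)
    (hf : ∀ g h : Matrix.GeneralLinearGroup (Fin 2) F, coeffAct g r = r → coeffAct h r = r →
      f g = f h → g = h) :
    Nat.card {g : Matrix.GeneralLinearGroup (Fin 2) F // coeffAct g r = r} ≤ s.card := by
  have := Nat.card_le_card_of_injective
    (fun g : {g : Matrix.GeneralLinearGroup (Fin 2) F // coeffAct g r = r} =>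
      (⟨f g, hs g g.2⟩ : s)) fun g h e => Subtype.ext (hf g h g.2 h.2 (congrArg Subtype.val e))
  simpa using this

/-- The value of the cubic form with coefficients `x` at `(s, t)`. -/
def cubicVal {K : Type*} [Field K] [Algebra F K] (x : Fin 4 → F) (s t : K) : K :=
  algebraMap F K (x 0) * s ^ 3 + algebraMap F K (x 1) * s ^ 2 * t +
    algebraMap F K (x 2) * s * t ^ 2 + algebraMap F K (x 3) * t ^ 3

theorem cubicVal_coeffAct {K : Type*} [Field K] [Algebra F K] (g : Matrix (Fin 2) (Fin 2) F)
    (x : Fin 4 → F) (s t : K) :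
    cubicVal (coeffAct g x) s t = algebraMap F K g.det⁻¹ *
      cubicVal x (algebraMap F K (g 0 0) * s + algebraMap F K (g 1 0) * t)
        (algebraMap F K (g 0 1) * s + algebraMap F K (g 1 1) * t) := by
  simp only [cubicVal, coeffAct, map_add, map_mul, map_pow, Pi.smul_apply, smul_eq_mul,
    Matrix.cons_val, map_ofNat]
  ring

/-- The set of zeros in `ℙ¹(F)` of the cubic form with coefficients `x`. -/
def rootSet (x : Fin 4 → F) : Set (Projectivization F (Fin 2 → F)) :=
  {P | MvPolynomial.eval P.rep (toPoly x) = 0}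

theorem mk_mem_rootSet (x : Fin 4 → F) (w : Fin 2 → F) (hw : w ≠ 0) :
    Projectivization.mk F w hw ∈ rootSet x ↔ cubicVal x (w 0) (w 1) = 0 := by
  obtain ⟨a, ha⟩ := Projectivization.exists_smul_eq_mk_rep F w hw
  have : MvPolynomial.eval (Projectivization.mk F w hw).rep (toPoly x) =
      a ^ 3 * cubicVal x (w 0) (w 1) := by
    rw [← ha]
    simp [toPoly, cubicVal, Units.smul_def]
    ring
  simp [rootSet, this]

theorem numRoots_coeffAct_le (g : Matrix.GeneralLinearGroup (Fin 2) F) (x : Fin 4 → F) :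
    numRoots (coeffAct g x) ≤ numRoots x := by
  have hinj : Function.Injective (Matrix.vecMulLinear (g : Matrix (Fin 2) (Fin 2) F)) :=
    Matrix.vecMul_injective_iff_isUnit.2 g.isUnit
  have hmaps : Set.MapsTo (Projectivization.map _ hinj) (rootSet (coeffAct g x)) (rootSet x) := by
    intro P hP
    induction P using Projectivization.ind with
    | h w hw =>
      rw [mk_mem_rootSet, cubicVal_coeffAct] at hP
      rw [Projectivization.map_mk, mk_mem_rootSet]
      have hdet : (g : Matrix (Fin 2) (Fin 2) F).det ≠ 0 := g.det_ne_zero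
      simpa [Matrix.vecMul, dotProduct, Fin.sum_univ_two, hdet, mul_comm] using hP
  exact Set.ncard_le_ncard_of_injOn _ hmaps
    (Projectivization.map_injective (τ := RingHom.id F) _ hinj).injOn

theorem InOrbit.numRoots_eq {r x : Fin 4 → F} (h : InOrbit r x) : numRoots x = numRoots r := by
  obtain ⟨g, rfl⟩ := (inOrbit_iff r x).1 h
  refine (numRoots_coeffAct_le g r).antisymm ?_
  conv_lhs => rw [← coeffAct_one r, ← Units.val_one, ← inv_mul_cancel g, Units.val_mul,
    coeffAct_mul]
  exact numRoots_coeffAct_le _ _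

theorem numRoots_eq_ncard (x : Fin 4 → F) : numRoots x = (rootSet x).ncard := rfl

/-- The point `[s : t]` of `ℙ¹(F)`. -/
def point (s t : F) (h : s ≠ 0 ∨ t ≠ 0) : Projectivization F (Fin 2 → F) :=
  Projectivization.mk F ![s, t] fun e => by
    have h0 := congrFun e 0
    have h1 := congrFun e 1
    simp_all

theorem exists_eq_point (P : Projectivization F (Fin 2 → F)) : ∃ s t h, P = point s t h := by
  induction P using Projectivization.ind with
  | h w hw =>
    have h : w 0 ≠ 0 ∨ w 1 ≠ 0 := by
      by_contra! h
      exact hw (funext fun i => by fin_cases i <;> simp [h])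
    refine ⟨w 0, w 1, h, ?_⟩
    simp only [point]
    congr
    funext i
    fin_cases i <;> rfl

theorem point_mem_rootSet (x : Fin 4 → F) (s t : F) (h : s ≠ 0 ∨ t ≠ 0) :
    point s t h ∈ rootSet x ↔ cubicVal x s t = 0 :=
  mk_mem_rootSet x _ _

theorem point_eq_point_iff (s t s' t' : F) (h : s ≠ 0 ∨ t ≠ 0) (h' : s' ≠ 0 ∨ t' ≠ 0) :
    point s t h = point s' t' h' ↔ s * t' = s' * t := by
  rw [point, point, Projectivization.mk_eq_mk_iff']
  constructor
  · rintro ⟨a, ha⟩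
    have h0 : a * s' = s := by simpa using congrFun ha 0
    have h1 : a * t' = t := by simpa using congrFun ha 1
    rw [← h0, ← h1]
    ring
  · intro e
    obtain h0 | h1 := h'
    · refine ⟨s / s', funext fun i => ?_⟩
      fin_cases i <;> simp <;> field_simp
      rw [e]
    · refine ⟨t / t', funext fun i => ?_⟩
      fin_cases i <;> simp <;> field_simp
      linear_combination -e

theorem numRoots_zero : numRoots (![0, 0, 0, 0] : Fin 4 → F) = Fintype.card F + 1 := by
  have : rootSet (![0, 0, 0, 0] : Fin 4 → F) = Set.univ := by
    ext P
    obtain ⟨s, t, h, rfl⟩ := exists_eq_point P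
    simp [point_mem_rootSet, cubicVal]
  rw [numRoots_eq_ncard, this, Set.ncard_univ, Projectivization.card_of_finrank_two _ _ (by simp),
    Nat.card_eq_fintype_card]

theorem numRoots_cube : numRoots (![0, 0, 0, 1] : Fin 4 → F) = 1 := by
  have : rootSet (![0, 0, 0, 1] : Fin 4 → F) = {point 1 0 (by simp)} := by
    ext P
    obtain ⟨s, t, h, rfl⟩ := exists_eq_point P
    simp [point_mem_rootSet, cubicVal, point_eq_point_iff, eq_comm (a := (0 : F))]
  rw [numRoots_eq_ncard, this, Set.ncard_singleton]

theorem numRoots_double : numRoots (![0, 0, 1, 0] : Fin 4 → F) = 2 := by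
  have : rootSet (![0, 0, 1, 0] : Fin 4 → F) = {point 1 0 (by simp), point 0 1 (by simp)} := by
    ext P
    obtain ⟨s, t, h, rfl⟩ := exists_eq_point P
    simp [point_mem_rootSet, cubicVal, point_eq_point_iff, eq_comm (a := (0 : F)), or_comm]
  rw [numRoots_eq_ncard, this, Set.ncard_pair]
  simp [point_eq_point_iff]

theorem numRoots_split : numRoots (![0, 1, -1, 0] : Fin 4 → F) = 3 := by
  have : rootSet (![0, 1, -1, 0] : Fin 4 → F) =
      {point 1 0 (by simp), point 0 1 (by simp), point 1 1 (by simp)} := by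
    ext P
    obtain ⟨s, t, h, rfl⟩ := exists_eq_point P
    have : cubicVal (![0, 1, -1, 0] : Fin 4 → F) s t = t * (s * (s - t)) := by
      simp [cubicVal]
      ring
    simp [point_mem_rootSet, this, point_eq_point_iff, sub_eq_zero, eq_comm (a := (0 : F))]
  rw [numRoots_eq_ncard, Set.ncard_eq_three]
  exact ⟨_, _, _, by simp [point_eq_point_iff], by simp [point_eq_point_iff],
    by simp [point_eq_point_iff], this⟩

theorem no_root_of_irreducible_quadratic {a b : F}
    (h : Irreducible (Polynomial.X ^ 2 + Polynomial.C a * Polynomial.X + Polynomial.C b)) (t : F) :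
    t ^ 2 + a * t + b ≠ 0 := by
  have hd : (Polynomial.X ^ 2 + Polynomial.C a * Polynomial.X + Polynomial.C b).natDegree = 2 := by
    compute_degree!
  simpa [Polynomial.IsRoot] using h.not_isRoot_of_natDegree_ne_one (by simp [hd]) (x := t)

theorem no_root_of_irreducible_cubic {a b c : F}
    (h : Irreducible (Polynomial.X ^ 3 + Polynomial.C a * Polynomial.X ^ 2 +
      Polynomial.C b * Polynomial.X + Polynomial.C c)) (t : F) :
    t ^ 3 + a * t ^ 2 + b * t + c ≠ 0 := by
  have hd : (Polynomial.X ^ 3 + Polynomial.C a * Polynomial.X ^ 2 +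
      Polynomial.C b * Polynomial.X + Polynomial.C c).natDegree = 3 := by
    compute_degree!
  simpa [Polynomial.IsRoot] using h.not_isRoot_of_natDegree_ne_one (by simp [hd]) (x := t)

theorem quadratic_form_anisotropic {a b : F} (h : ∀ t : F, t ^ 2 + a * t + b ≠ 0) {s t : F}
    (e : s ^ 2 + a * s * t + b * t ^ 2 = 0) : s = 0 ∧ t = 0 := by
  by_cases ht : t = 0
  · simpa [ht] using e
  · refine absurd ?_ (h (s / t))
    field_simp
    linear_combination e

theorem numRoots_quadratic {a b : F} (h : ∀ t : F, t ^ 2 + a * t + b ≠ 0) :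
    numRoots ![0, 1, a, b] = 1 := by
  have : rootSet ![0, 1, a, b] = {point 1 0 (by simp)} := by
    ext P
    obtain ⟨s, t, hst, rfl⟩ := exists_eq_point P
    have : cubicVal ![0, 1, a, b] s t = t * (s ^ 2 + a * s * t + b * t ^ 2) := by
      simp [cubicVal]
      ring
    simp only [point_mem_rootSet, this, point_eq_point_iff, Set.mem_singleton_iff, mul_eq_zero,
      mul_zero, one_mul, eq_comm (a := (0 : F)), or_iff_left_iff_imp]
    exact fun e => (quadratic_form_anisotropic h e).2
  rw [numRoots_eq_ncard, this, Set.ncard_singleton]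

theorem numRoots_cubic {a b c : F} (h : ∀ t : F, t ^ 3 + a * t ^ 2 + b * t + c ≠ 0) :
    numRoots ![1, a, b, c] = 0 := by
  have : rootSet ![1, a, b, c] = ∅ := by
    ext P
    obtain ⟨s, t, hst, rfl⟩ := exists_eq_point P
    simp only [point_mem_rootSet, cubicVal, Algebra.algebraMap_self, RingHom.id_apply,
      Matrix.cons_val, Set.mem_empty_iff_false, iff_false]
    intro e
    by_cases ht : t = 0
    · simp_all
    · refine h (s / t) ?_
      field_simp
      linear_combination e
  rw [numRoots_eq_ncard, this, Set.ncard_empty]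

theorem equations_of_coeffAct_eq {g : Matrix.GeneralLinearGroup (Fin 2) F} {x y : Fin 4 → F}
    (h : coeffAct g x = y) :
    (g 0 0 * g 1 1 - g 0 1 * g 1 0 ≠ 0) ∧
    (x 0 * g 0 0 ^ 3 + x 1 * g 0 0 ^ 2 * g 0 1 + x 2 * g 0 0 * g 0 1 ^ 2 + x 3 * g 0 1 ^ 3 =
      (g 0 0 * g 1 1 - g 0 1 * g 1 0) * y 0) ∧
    (3 * x 0 * g 0 0 ^ 2 * g 1 0 + x 1 * (g 0 0 ^ 2 * g 1 1 + 2 * g 0 0 * g 1 0 * g 0 1)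
      + x 2 * (g 1 0 * g 0 1 ^ 2 + 2 * g 0 0 * g 0 1 * g 1 1) + 3 * x 3 * g 0 1 ^ 2 * g 1 1 =
      (g 0 0 * g 1 1 - g 0 1 * g 1 0) * y 1) ∧
    (3 * x 0 * g 0 0 * g 1 0 ^ 2 + x 1 * (g 1 0 ^ 2 * g 0 1 + 2 * g 0 0 * g 1 0 * g 1 1)
      + x 2 * (g 0 0 * g 1 1 ^ 2 + 2 * g 1 0 * g 0 1 * g 1 1) + 3 * x 3 * g 0 1 * g 1 1 ^ 2 =
      (g 0 0 * g 1 1 - g 0 1 * g 1 0) * y 2) ∧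
    (x 0 * g 1 0 ^ 3 + x 1 * g 1 0 ^ 2 * g 1 1 + x 2 * g 1 0 * g 1 1 ^ 2 + x 3 * g 1 1 ^ 3 =
      (g 0 0 * g 1 1 - g 0 1 * g 1 0) * y 3) := by
  have hdet : (g : Matrix (Fin 2) (Fin 2) F).det ≠ 0 := g.det_ne_zero
  subst h
  rw [← Matrix.det_fin_two (g : Matrix (Fin 2) (Fin 2) F)]
  refine ⟨hdet, ?_, ?_, ?_, ?_⟩ <;> simp [coeffAct, hdet]

theorem generalLinearGroup_ext {g h : Matrix.GeneralLinearGroup (Fin 2) F} (h00 : g 0 0 = h 0 0)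
    (h01 : g 0 1 = h 0 1) (h10 : g 1 0 = h 1 0) (h11 : g 1 1 = h 1 1) : g = h := by
  ext i j
  fin_cases i <;> fin_cases j <;> assumption

theorem card_stabilizer_cube :
    Nat.card {g : Matrix.GeneralLinearGroup (Fin 2) F //
      coeffAct g (![0, 0, 0, 1] : Fin 4 → F) = ![0, 0, 0, 1]} ≤
      Fintype.card F * (Fintype.card F - 1) := by
  have key {g : Matrix.GeneralLinearGroup (Fin 2) F}
      (hg : coeffAct g (![0, 0, 0, 1] : Fin 4 → F) = ![0, 0, 0, 1]) :
      g 0 1 = 0 ∧ g 1 1 ≠ 0 ∧ g 0 0 = g 1 1 ^ 2 := by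
    obtain ⟨hdet, h0, -, -, h3⟩ := equations_of_coeffAct_eq hg
    have hb : g 0 1 = 0 := by simpa using h0
    simp only [hb] at hdet h3
    have hd : g 1 1 ≠ 0 := by rintro e; simp [e] at hdet
    refine ⟨hb, hd, ?_⟩
    simp only [Matrix.cons_val] at h3
    apply mul_right_cancel₀ hd
    linear_combination -h3
  refine (card_stabilizer_le _ (fun g => (g 1 0, g 1 1)) (Finset.univ ×ˢ Finset.univ.erase 0)
    ?_ ?_).trans (by simp [Finset.card_product])
  · intro g hg
    simpa using (key hg).2.1
  · intro g h hg hh e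
    obtain ⟨e0, e1⟩ := Prod.mk.inj e
    exact generalLinearGroup_ext (by rw [(key hg).2.2, (key hh).2.2, e1])
      (by rw [(key hg).1, (key hh).1]) e0 e1

theorem card_stabilizer_double :
    Nat.card {g : Matrix.GeneralLinearGroup (Fin 2) F //
      coeffAct g (![0, 0, 1, 0] : Fin 4 → F) = ![0, 0, 1, 0]} ≤ Fintype.card F - 1 := by
  have key {g : Matrix.GeneralLinearGroup (Fin 2) F}
      (hg : coeffAct g (![0, 0, 1, 0] : Fin 4 → F) = ![0, 0, 1, 0]) :
      g 0 0 ≠ 0 ∧ g 0 1 = 0 ∧ g 1 0 = 0 ∧ g 1 1 = 1 := by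
    obtain ⟨hdet, h0, h1, h2, h3⟩ := equations_of_coeffAct_eq hg
    simp only [Matrix.cons_val] at h0 h1 h2 h3
    have ha : g 0 0 ≠ 0 := fun e => by simp_all
    have hb : g 0 1 = 0 := by simpa [ha] using h0
    simp only [hb] at hdet h1 h2 h3
    have hd : g 1 1 ≠ 0 := by rintro e; simp [e] at hdet
    refine ⟨ha, hb, by simpa [hd] using h3, ?_⟩
    apply mul_left_cancel₀ (mul_ne_zero ha hd)
    linear_combination h2
  refine (card_stabilizer_le _ (fun g => g 0 0) (Finset.univ.erase 0) ?_ ?_).trans (by simp)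
  · intro g hg
    simpa using (key hg).1
  · intro g h hg hh e
    obtain ⟨-, hb, hc, hd⟩ := key hg
    obtain ⟨-, hb', hc', hd'⟩ := key hh
    exact generalLinearGroup_ext e (by rw [hb, hb']) (by rw [hc, hc']) (by rw [hd, hd'])

theorem card_stabilizer_split :
    Nat.card {g : Matrix.GeneralLinearGroup (Fin 2) F //
      coeffAct g (![0, 1, -1, 0] : Fin 4 → F) = ![0, 1, -1, 0]} ≤ 6 := by
  refine (card_stabilizer_le _ (fun g => (g 0 0, g 0 1, g 1 0, g 1 1))
    {(0, 1, 1, 0), (0, 1, -1, -1), (1, 0, 0, 1), (1, 0, -1, -1), (-1, -1, 0, 1), (-1, -1, 1, 0)}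
    ?_ ?_).trans Finset.card_le_six
  · intro g hg
    obtain ⟨hdet, h0, h1, h2, h3⟩ := equations_of_coeffAct_eq hg
    simp only [Matrix.cons_val] at h0 h1 h2 h3
    simp only [Finset.mem_insert, Finset.mem_singleton, Prod.mk.injEq]
    generalize g 0 0 = a, g 0 1 = b, g 1 0 = c, g 1 1 = d at *
    have hab : a = 0 ∨ b = 0 ∨ a = b := by
      have : a * (b * (a - b)) = 0 := by linear_combination h0
      simpa [sub_eq_zero] using this
    have hcd : c = 0 ∨ d = 0 ∨ c = d := by
      have : c * (d * (c - d)) = 0 := by linear_combination h3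
      simpa [sub_eq_zero] using this
    obtain rfl | rfl | rfl := hab
    · have hb : b = 1 := mul_left_cancel₀ hdet (by linear_combination h1)
      subst hb
      have hc : c - 2 * d = 1 := mul_left_cancel₀ hdet (by linear_combination -h2)
      grind
    · have ha : a = 1 := mul_left_cancel₀ hdet (by linear_combination h1)
      subst ha
      have hd : d - 2 * c = 1 := mul_left_cancel₀ hdet (by linear_combination -h2)
      grind
    · have ha : a = -1 := mul_left_cancel₀ hdet (by linear_combination -h1)
      subst ha
      have hd : c + d = 1 := mul_left_cancel₀ hdet (by linear_combination -h2)
      grind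
  · intro g h _ _ e
    simp only [Prod.mk.injEq] at e
    exact generalLinearGroup_ext e.1 e.2.1 e.2.2.1 e.2.2.2

theorem discriminant_ne_zero {a b : F} (h : ∀ t : F, t ^ 2 + a * t + b ≠ 0) :
    a ^ 2 - 4 * b ≠ 0 := by
  intro e
  by_cases h2 : (2 : F) = 0
  · have : CharP F 2 := CharTwo.of_one_ne_zero_of_two_eq_zero one_ne_zero h2
    obtain ⟨t, rfl⟩ := FiniteField.isSquare_of_char_two (ringChar.eq F 2) b
    have ha : a = 0 := by
      rw [← sq_eq_zero_iff]
      linear_combination e + 2 * t * t * h2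
    refine h t ?_
    linear_combination t * ha + t ^ 2 * h2
  · refine h (-a / 2) ?_
    field_simp
    linear_combination -e

theorem card_stabilizer_quadratic {p q : F} (h : ∀ t : F, t ^ 2 + p * t + q ≠ 0) :
    Nat.card {g : Matrix.GeneralLinearGroup (Fin 2) F //
      coeffAct g ![0, 1, p, q] = ![0, 1, p, q]} ≤ 2 := by
  have key {g : Matrix.GeneralLinearGroup (Fin 2) F}
      (hg : coeffAct g ![0, 1, p, q] = ![0, 1, p, q]) :
      g 0 0 = 1 ∧ g 0 1 = 0 ∧ (g 1 0 = 0 ∧ g 1 1 = 1 ∨ g 1 0 = p ∧ g 1 1 = -1) := by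
    obtain ⟨hdet, h0, h1, h2, h3⟩ := equations_of_coeffAct_eq hg
    simp only [Matrix.cons_val] at h0 h1 h2 h3
    generalize g 0 0 = a, g 0 1 = b, g 1 0 = c, g 1 1 = d at *
    have hb : b = 0 := by
      have : b * (a ^ 2 + p * a * b + q * b ^ 2) = 0 := by linear_combination h0
      exact (mul_eq_zero.1 this).elim id fun e => (quadratic_form_anisotropic h e).2
    subst hb
    have ha : a = 1 := mul_left_cancel₀ hdet (by linear_combination h1)
    subst ha
    have hd : d ≠ 0 := by rintro rfl; simp at hdet
    have hc : 2 * c = p * (1 - d) := mul_left_cancel₀ hd (by linear_combination h2)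
    have hq : c ^ 2 + p * c * d + q * d ^ 2 = q := mul_left_cancel₀ hd (by linear_combination h3)
    have hd2 : (d - 1) * (d + 1) = 0 := by
      apply mul_left_cancel₀ (discriminant_ne_zero h)
      linear_combination (2 * c + p * (1 - d) + 2 * p * d) * hc - 4 * hq
    refine ⟨rfl, rfl, ?_⟩
    obtain hd1 | hd1 := mul_eq_zero.1 hd2
    · obtain rfl := sub_eq_zero.1 hd1
      have : c * (c + p) = 0 := by linear_combination hq
      grind
    · obtain rfl := eq_neg_of_add_eq_zero_left hd1
      have : c * (c - p) = 0 := by linear_combination hq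
      grind
  refine (card_stabilizer_le _ (fun g => (g 1 0, g 1 1)) {(0, 1), (p, -1)} ?_ ?_).trans
    Finset.card_le_two
  · intro g hg
    simpa using (key hg).2.2
  · intro g h hg hh e
    obtain ⟨e0, e1⟩ := Prod.mk.inj e
    exact generalLinearGroup_ext (by rw [(key hg).1, (key hh).1])
      (by rw [(key hg).2.1, (key hh).2.1]) e0 e1

theorem exists_mul_eq_of_cross_eq {a b a' b' : F} (h : a ≠ 0 ∨ b ≠ 0) (e : a * b' = a' * b) :
    ∃ s, a' = s * a ∧ b' = s * b := by
  obtain h | h := h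
  · exact ⟨a' / a, by field_simp, by field_simp; linear_combination e⟩
  · exact ⟨b' / b, by field_simp; linear_combination -e, by field_simp⟩

theorem card_stabilizer_le_of_root {K : Type*} [Field K] [Algebra F K] {p q r : F} {θ : K}
    (root : cubicVal ![1, p, q, r] θ 1 = 0)
    (indep : ∀ x y z : F, algebraMap F K z * θ ^ 2 + algebraMap F K y * θ + algebraMap F K x = 0 →
      z = 0 ∧ y = 0 ∧ x = 0) :
    Nat.card {g : Matrix.GeneralLinearGroup (Fin 2) F //
      coeffAct g ![1, p, q, r] = ![1, p, q, r]} ≤ 3 := by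
  set f := Polynomial.X ^ 3 + Polynomial.C (algebraMap F K p) * Polynomial.X ^ 2 +
      Polynomial.C (algebraMap F K q) * Polynomial.X + Polynomial.C (algebraMap F K r) with f_def
  have hdeg : f.natDegree = 3 := by rw [f_def]; compute_degree!
  have hf : f ≠ 0 := fun e => by simp [e] at hdeg
  have denom_ne (g : Matrix.GeneralLinearGroup (Fin 2) F) :
      algebraMap F K (g 0 1) * θ + algebraMap F K (g 1 1) ≠ 0 := by
    intro e
    obtain ⟨-, hb, hd⟩ := indep (g 1 1) (g 0 1) 0 (by simpa using e)
    exact g.det_ne_zero (by simp [Matrix.det_fin_two, hb, hd])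
  refine (card_stabilizer_le _
    (fun g => (algebraMap F K (g 0 0) * θ + algebraMap F K (g 1 0)) /
      (algebraMap F K (g 0 1) * θ + algebraMap F K (g 1 1)))
    f.roots.toFinset ?_ ?_).trans ?_
  · intro g hg
    have hval := cubicVal_coeffAct (K := K) g ![1, p, q, r] θ 1
    rw [hg, root, eq_comm, mul_eq_zero, map_eq_zero, inv_eq_zero,
      or_iff_right g.det_ne_zero, mul_one, mul_one] at hval
    have hne := denom_ne g
    simp only [cubicVal, Matrix.cons_val, map_one, one_mul] at hval
    rw [Multiset.mem_toFinset, Polynomial.mem_roots hf, Polynomial.IsRoot.def, f_def]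
    simp only [Polynomial.eval_add, Polynomial.eval_mul, Polynomial.eval_pow, Polynomial.eval_X,
      Polynomial.eval_C]
    generalize algebraMap F K (g 0 1) * θ + algebraMap F K (g 1 1) = d at *
    field_simp
    linear_combination hval
  · intro g h hg hh e
    rw [div_eq_div_iff (denom_ne g) (denom_ne h)] at e
    obtain ⟨e0, e1, e2⟩ := indep (g 1 0 * h 1 1 - h 1 0 * g 1 1)
      (g 0 0 * h 1 1 + g 1 0 * h 0 1 - h 0 0 * g 1 1 - h 1 0 * g 0 1)
      (g 0 0 * h 0 1 - h 0 0 * g 0 1) (by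
        simp only [map_sub, map_add, map_mul]
        linear_combination e)
    obtain ⟨dg, g0, -⟩ := equations_of_coeffAct_eq hg
    obtain ⟨dh, h0, -⟩ := equations_of_coeffAct_eq hh
    simp only [Matrix.cons_val] at g0 h0
    obtain ⟨s, hs0, hs1⟩ := exists_mul_eq_of_cross_eq
      (by by_contra! hz; simp [hz.1, hz.2] at dg) (sub_eq_zero.1 e0)
    obtain ⟨t, ht0, ht1⟩ := exists_mul_eq_of_cross_eq
      (by by_contra! hz; simp [hz.1, hz.2] at dg) (sub_eq_zero.1 e2)
    rw [hs0, hs1, ht0, ht1] at e1 dh h0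
    have hst : s = t := mul_left_cancel₀ dg (by linear_combination -e1)
    subst hst
    have hs : s = 1 := mul_left_cancel₀ dh (by linear_combination h0 - s ^ 3 * g0)
    subst hs
    rw [one_mul] at hs0 hs1 ht0 ht1
    exact generalLinearGroup_ext hs0.symm hs1.symm ht0.symm ht1.symm
  · rw [← hdeg]
    exact (Multiset.toFinset_card_le _).trans (Polynomial.card_roots' _)

theorem card_stabilizer_cubic {p q r : F}
    (hf : Irreducible (Polynomial.X ^ 3 + Polynomial.C p * Polynomial.X ^ 2 +
      Polynomial.C q * Polynomial.X + Polynomial.C r)) :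
    Nat.card {g : Matrix.GeneralLinearGroup (Fin 2) F //
      coeffAct g ![1, p, q, r] = ![1, p, q, r]} ≤ 3 := by
  set f := Polynomial.X ^ 3 + Polynomial.C p * Polynomial.X ^ 2 +
      Polynomial.C q * Polynomial.X + Polynomial.C r with f_def
  have hdeg : f.natDegree = 3 := by rw [f_def]; compute_degree!
  have : Fact (Irreducible f) := ⟨hf⟩
  refine card_stabilizer_le_of_root (K := AdjoinRoot f) (θ := AdjoinRoot.root f) ?_ ?_
  · have h : AdjoinRoot.mk f (Polynomial.X ^ 3 + Polynomial.C p * Polynomial.X ^ 2 +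
        Polynomial.C q * Polynomial.X + Polynomial.C r) = 0 := AdjoinRoot.mk_self
    simpa [cubicVal, AdjoinRoot.algebraMap_eq] using h
  · intro x y z e
    have hmk : AdjoinRoot.mk f (Polynomial.C z * Polynomial.X ^ 2 + Polynomial.C y * Polynomial.X +
        Polynomial.C x) = 0 := by
      simpa [AdjoinRoot.algebraMap_eq] using e
    have h0 := Polynomial.eq_zero_of_dvd_of_natDegree_lt (AdjoinRoot.mk_eq_zero.1 hmk) <|
      (Polynomial.natDegree_quadratic_le).trans_lt (by rw [hdeg]; norm_num)
    refine ⟨?_, ?_, ?_⟩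
    · simpa using congrArg (Polynomial.coeff · 2) h0
    · simpa [Polynomial.coeff_X, Polynomial.coeff_C] using congrArg (Polynomial.coeff · 1) h0
    · simpa using congrArg (Polynomial.coeff · 0) h0

theorem card_inOrbit_ge {r : Fin 4 → F} {s : ℕ}
    (hs : Nat.card {g : Matrix.GeneralLinearGroup (Fin 2) F // coeffAct g r = r} ≤ s) :
    (((Fintype.card F : ℚ) ^ 2 - 1) * ((Fintype.card F : ℚ) ^ 2 - Fintype.card F)) ≤
      Nat.card {x // InOrbit r x} * (s : ℚ) := by
  have hq : 1 ≤ Fintype.card F := Fintype.card_pos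
  have h := card_inOrbit_mul_card_stabilizer r
  have h1 : 1 ≤ Fintype.card F ^ 2 := Nat.one_le_pow _ _ hq
  have h2 : Fintype.card F ≤ Fintype.card F ^ 2 := Nat.le_self_pow two_ne_zero _
  have h' := h.symm.le.trans (Nat.mul_le_mul_left _ hs)
  rw [← Nat.cast_le (α := ℚ)] at h'
  push_cast [h1, h2] at h'
  exact h'

theorem inOrbit_zero_iff (x : Fin 4 → F) : InOrbit ![0, 0, 0, 0] x ↔ x = ![0, 0, 0, 0] := by
  have h (g : Matrix (Fin 2) (Fin 2) F) : coeffAct g ![0, 0, 0, 0] = ![0, 0, 0, 0] := by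
    funext i
    fin_cases i <;> simp [coeffAct]
  simp only [inOrbit_iff, h, exists_const, eq_comm]

theorem InOrbit.trans_symm {r s x : Fin 4 → F} (hr : InOrbit r x) (hs : InOrbit s x) :
    InOrbit r s := by
  rw [inOrbit_iff] at *
  obtain ⟨g, rfl⟩ := hr
  obtain ⟨h, hh⟩ := hs
  refine ⟨h⁻¹ * g, ?_⟩
  rw [Units.val_mul, coeffAct_mul, ← hh, ← coeffAct_mul, ← Units.val_mul, inv_mul_cancel,
    Units.val_one, coeffAct_one]

theorem not_inOrbit_cube_quadratic (a b : F) : ¬ InOrbit ![0, 0, 0, 1] ![0, 1, a, b] := by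
  rw [inOrbit_iff]
  rintro ⟨g, hg⟩
  obtain ⟨hdet, h0, h1, -⟩ := equations_of_coeffAct_eq hg
  simp only [Matrix.cons_val] at h0 h1
  have hb : g 0 1 = 0 := by simpa using h0
  apply hdet
  linear_combination -h1 + 3 * g 0 1 * g 1 1 * hb

/-- orbits of `GL₂(F_q)` on binary cubic forms. -/
theorem stmt6 (a₂ b₂ a₃ b₃ c₃ : F)
    (h2 : Irreducible (Polynomial.X ^ 2 + Polynomial.C a₂ * Polynomial.X + Polynomial.C b₂ :
      Polynomial F))
    (h3 : Irreducible (Polynomial.X ^ 3 + Polynomial.C a₃ * Polynomial.X ^ 2 +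
      Polynomial.C b₃ * Polynomial.X + Polynomial.C c₃ : Polynomial F)) :
    let r : Fin 6 → Fin 4 → F :=
      ![![0,0,0,0], ![0,0,0,1], ![0,0,1,0], ![0,1,-1,0], ![0,1,a₂,b₂], ![1,a₃,b₃,c₃]]
    let q : ℚ := (Fintype.card F : ℚ)
    (∀ i j : Fin 6, i ≠ j → ¬ ∃ x : Fin 4 → F, InOrbit (r i) x ∧ InOrbit (r j) x) ∧
    (∀ x : Fin 4 → F, ∃ i : Fin 6, InOrbit (r i) x) ∧
    (∀ (i : Fin 6) (x : Fin 4 → F), InOrbit (r i) x →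
      numRoots x = ![Fintype.card F + 1, 1, 2, 3, 1, 0] i) ∧
    (∀ i : Fin 6, (Nat.card {x : Fin 4 → F // InOrbit (r i) x} : ℚ) =
      ![1, q^2 - 1, q*(q^2 - 1), (q^2 - 1)*(q^2 - q)/6, (q^2 - 1)*(q^2 - q)/2,
        (q^2 - 1)*(q^2 - q)/3] i) := by
  intro r q
  have q2 := no_root_of_irreducible_quadratic h2
  have c3 := no_root_of_irreducible_cubic h3
  have hroots (i : Fin 6) : numRoots (r i) = ![Fintype.card F + 1, 1, 2, 3, 1, 0] i := by
    fin_cases i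
    exacts [numRoots_zero, numRoots_cube, numRoots_double, numRoots_split, numRoots_quadratic q2,
      numRoots_cubic c3]
  have hzero (i : Fin 6) (hi : i ≠ 0) : ¬ InOrbit (r 0) (r i) := by
    intro h
    have h' := (inOrbit_zero_iff _).1 h
    revert hi h'
    fin_cases i <;> simp [r]
  have hdisj (i j : Fin 6) (hij : i < j) : ¬ InOrbit (r i) (r j) := by
    by_cases hi : i = 0
    · subst hi
      exact hzero j hij.ne'
    by_cases h14 : i = 1 ∧ j = 4
    · obtain ⟨rfl, rfl⟩ := h14
      exact not_inOrbit_cube_quadratic a₂ b₂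
    intro h
    have e := h.numRoots_eq
    rw [hroots, hroots] at e
    revert e
    fin_cases i <;> fin_cases j <;> simp_all
  have hne (i j : Fin 6) (hij : i ≠ j) : ¬ ∃ x : Fin 4 → F, InOrbit (r i) x ∧ InOrbit (r j) x := by
    rintro ⟨x, hi, hj⟩
    obtain h | h := lt_or_gt_of_ne hij
    · exact hdisj i j h (hi.trans_symm hj)
    · exact hdisj j i h (hj.trans_symm hi)
  let φ : (Σ i, {x // InOrbit (r i) x}) → Fin 4 → F := fun p => p.2
  have φ_inj : Function.Injective φ := by
    rintro ⟨i, x, hx⟩ ⟨j, y, hy⟩ (rfl : x = y)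
    by_cases hij : i = j
    · subst hij
      rfl
    · exact absurd ⟨x, hx, hy⟩ (hne i j hij)
  have card_φ : (Nat.card (Σ i, {x // InOrbit (r i) x}) : ℚ) =
      ∑ i, (Nat.card {x // InOrbit (r i) x} : ℚ) := by
    rw [Nat.card_sigma]
    push_cast
    rfl
  have card_V : (Nat.card (Fin 4 → F) : ℚ) = q ^ 4 := by simp [q]
  have hsum : ∑ i, (Nat.card {x // InOrbit (r i) x} : ℚ) ≤ q ^ 4 := by
    rw [← card_φ, ← card_V]
    exact_mod_cast Nat.card_le_card_of_injective φ φ_inj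
  have hq : 1 < q := Nat.one_lt_cast.2 (Fintype.one_lt_card (α := F))
  have n0 : (Nat.card {x // InOrbit (r 0) x} : ℚ) = 1 := by
    simp [r, inOrbit_zero_iff]
  have n1 : q ^ 2 - 1 ≤ Nat.card {x // InOrbit (r 1) x} := by
    have h := card_inOrbit_ge (card_stabilizer_cube (F := F))
    push_cast [Fintype.card_pos] at h
    refine le_of_mul_le_mul_right (h.trans' ?_) (mul_pos (by linarith : 0 < q) (sub_pos.2 hq))
    exact le_of_eq (by ring)
  have n2 : q * (q ^ 2 - 1) ≤ Nat.card {x // InOrbit (r 2) x} := by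
    have h := card_inOrbit_ge (card_stabilizer_double (F := F))
    push_cast [Fintype.card_pos] at h
    refine le_of_mul_le_mul_right (h.trans' ?_) (sub_pos.2 hq)
    exact le_of_eq (by ring)
  have n3 : (q ^ 2 - 1) * (q ^ 2 - q) / 6 ≤ Nat.card {x // InOrbit (r 3) x} :=
    (div_le_iff₀ (by norm_num)).2 (card_inOrbit_ge (card_stabilizer_split (F := F)))
  have n4 : (q ^ 2 - 1) * (q ^ 2 - q) / 2 ≤ Nat.card {x // InOrbit (r 4) x} :=
    (div_le_iff₀ (by norm_num)).2 (card_inOrbit_ge (card_stabilizer_quadratic q2))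
  have n5 : (q ^ 2 - 1) * (q ^ 2 - q) / 3 ≤ Nat.card {x // InOrbit (r 5) x} :=
    (div_le_iff₀ (by norm_num)).2 (card_inOrbit_ge (card_stabilizer_cubic h3))
  have total : 1 + (q ^ 2 - 1) + q * (q ^ 2 - 1) + (q ^ 2 - 1) * (q ^ 2 - q) / 6 +
      (q ^ 2 - 1) * (q ^ 2 - q) / 2 + (q ^ 2 - 1) * (q ^ 2 - q) / 3 = q ^ 4 := by
    ring
  obtain ⟨N, hN⟩ : ∃ N : Fin 6 → ℚ, ∀ i, (Nat.card {x // InOrbit (r i) x} : ℚ) = N i :=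
    ⟨_, fun _ => rfl⟩
  clear_value q
  simp only [hN, Fin.sum_univ_six] at *
  refine ⟨hne, ?_, fun i x h => h.numRoots_eq.trans (hroots i), ?_⟩
  · have hle : Nat.card (Fin 4 → F) ≤ Nat.card (Σ i, {x // InOrbit (r i) x}) := by
      rw [← Nat.cast_le (α := ℚ), card_φ, card_V]
      linarith
    intro x
    obtain ⟨⟨i, y, hy⟩, rfl⟩ := (φ_inj.bijective_of_nat_card_le hle).2 x
    exact ⟨i, hy⟩
  · clear hN φ_inj card_φ
    clear φ hzero hdisj hne hroots r
    intro i
    fin_cases i <;> simp only [Matrix.cons_val, Fin.reduceFinMk, Fin.mk_one, Fin.zero_eta] <;>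
      linarith

end
end
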